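/- For every admissible Strichartz pair (n,p) there is a constant C > 0 such that for every real N ≥ 1, every ξ₀ ∈ ℝⁿ, every orthonormal basis v₁,…,v_n of ℝⁿ, and every finitely supported a : ℤⁿ → ℂ supported in the (arbitrarily centered and oriented) cube {ξ ∈ ℤⁿ : |(ξ − ξ₀)·v_i| ≤ N for all i = 1,…,n}, one has ‖u_a‖_{L^p([0,2π]×[0,2π]ⁿ)} ≤ C · N^{n/2 − (n+2)/p} · ‖a‖_{ℓ²}; in particular the constant C is independent of the center ξ₀ and the orientation of the cube. -/

import Mathlib

open MeasureTheory Real Finset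

noncomputable section

/-- The free Schrödinger wave `u_a(t,x) = Σ_ξ a(ξ) e^{i(x·ξ − t|ξ|²)}` on the torus. -/
def tWave (n : ℕ) (a : (Fin n → ℤ) →₀ ℂ) (t : ℝ) (x : Fin n → ℝ) : ℂ :=
  ∑ ξ ∈ a.support, a ξ *
    Complex.exp (Complex.I *
      (((∑ i, x i * (ξ i : ℝ)) - t * ∑ i, ((ξ i : ℝ)) ^ 2 : ℝ) : ℂ))

/-- The ℓ² norm of the Fourier coefficients. -/
def l2Norm (n : ℕ) (a : (Fin n → ℤ) →₀ ℂ) : ℝ :=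
  Real.sqrt (∑ ξ ∈ a.support, ‖a ξ‖ ^ 2)

/-- Euclidean norm of a lattice point in `ℤⁿ`. -/
def znorm (n : ℕ) (ξ : Fin n → ℤ) : ℝ :=
  Real.sqrt (∑ i, ((ξ i : ℝ)) ^ 2)

/-- The period box `[0,2π] × [0,2π]ⁿ`. -/
def stBox (n : ℕ) : Set (ℝ × (Fin n → ℝ)) :=
  Set.Icc 0 (2 * π) ×ˢ Set.univ.pi fun _ => Set.Icc 0 (2 * π)

/-- The `L^p` norm over the period box `[0,2π] × [0,2π]ⁿ`. -/
def boxLpNorm (n : ℕ) (p : ℝ) (f : ℝ → (Fin n → ℝ) → ℂ) : ℝ :=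
  (∫ q in stBox n, ‖f q.1 q.2‖ ^ p) ^ (1 / p)

end

/-- `(n,p)` is an admissible Strichartz pair. -/
def AdmissibleStrichartz (n : ℕ) (p : ℝ) : Prop :=
  (n = 1 ∧ 6 < p) ∨ ((n = 2 ∨ n = 3) ∧ 4 < p) ∨ (4 ≤ n ∧ 2 * ((n : ℝ) + 4) / n ≤ p)

theorem exists_card_divisors_le_rpow (ε : ℝ) (hε : 0 < ε) :
    ∃ C : ℝ, 1 ≤ C ∧ ∀ m : ℕ, m ≠ 0 → ((m.divisors.card : ℕ) : ℝ) ≤ C * (m : ℝ) ^ ε := by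
  have hl : 0 < ε * Real.log 2 := mul_pos hε (Real.log_pos (by norm_num))
  set c : ℝ := 1 + 1 / (ε * Real.log 2) with hc
  have hc1 : 1 ≤ c := by rw [hc]; have := one_div_pos.2 hl; linarith
  obtain ⟨P, hP⟩ := exists_nat_ge ((2 : ℝ) ^ (1 / ε))
  refine ⟨c ^ P, one_le_pow₀ hc1, fun m hm => ?_⟩
  have two_le : ∀ v : ℕ, (v : ℝ) + 1 ≤ c * ((2 : ℝ) ^ v) ^ ε := by
    intro v
    have h1 : ((2 : ℝ) ^ v) ^ ε = Real.exp (ε * Real.log 2 * v) := by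
      rw [← Real.rpow_natCast, ← Real.rpow_mul (by norm_num), Real.rpow_def_of_pos (by norm_num)]
      ring_nf
    rw [h1]
    have h2 := Real.add_one_le_exp (ε * Real.log 2 * v)
    have h3 : c * (ε * Real.log 2 * v + 1) = ε * Real.log 2 * v + 1 + v + 1 / (ε * Real.log 2) := by
      rw [hc]; field_simp; ring
    nlinarith [mul_le_mul_of_nonneg_left h2 (by linarith : 0 ≤ c)]
  have key : ∀ p ∈ m.primeFactors, ((m.factorization p + 1 : ℕ) : ℝ) ≤
      (if p < P then c else 1) * ((p : ℝ) ^ m.factorization p) ^ ε := by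
    intro p hp
    have hp2 : 2 ≤ p := (Nat.prime_of_mem_primeFactors hp).two_le
    have hp2' : (2 : ℝ) ≤ p := by exact_mod_cast hp2
    push_cast
    split_ifs with h
    · refine (two_le _).trans ?_
      gcongr
    · have h2 : (2 : ℝ) ≤ (p : ℝ) ^ ε := by
        have : (2 : ℝ) ^ (1 / ε) ≤ p := hP.trans (by exact_mod_cast not_lt.1 h)
        calc (2 : ℝ) = ((2 : ℝ) ^ (1 / ε)) ^ ε := by
              rw [← Real.rpow_mul (by norm_num), one_div_mul_cancel hε.ne', Real.rpow_one]
          _ ≤ _ := by gcongr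
      rw [one_mul, ← Real.rpow_natCast, ← Real.rpow_mul (by positivity), mul_comm,
        Real.rpow_mul (by positivity), Real.rpow_natCast]
      calc (m.factorization p : ℝ) + 1 ≤ 2 ^ (m.factorization p) := by
            exact_mod_cast Nat.lt_two_pow_self
        _ ≤ _ := by gcongr
  rw [Nat.card_divisors hm, Nat.cast_prod]
  refine (Finset.prod_le_prod (fun _ _ => by positivity) key).trans ?_
  rw [Finset.prod_mul_distrib]
  gcongr
  · rw [← Finset.prod_filter, Finset.prod_const]
    refine pow_le_pow_right₀ hc1 ?_
    calc _ ≤ (Finset.range P).card := Finset.card_le_card (fun p hp => by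
          simp only [Finset.mem_filter] at hp; exact Finset.mem_range.2 hp.2)
      _ = P := by simp
  · rw [Real.finsetProd_rpow _ _ (fun _ _ => by positivity)]
    have := Nat.prod_factorization_pow_eq_self hm
    rw [Finsupp.prod, Nat.support_factorization] at this
    have h2 : (∏ i ∈ m.primeFactors, (i : ℝ) ^ m.factorization i) = m := by
      exact_mod_cast this
    rw [h2]

theorem dvd_two_mul_of_represented {D : ℤ} {m d x0 y0 x1 y1 x y : ℤ}
    (h0 : x0 ^ 2 + D * y0 ^ 2 = m) (c0 : IsCoprime x0 y0)
    (h1 : x1 ^ 2 + D * y1 ^ 2 = m)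
    (h : x ^ 2 + D * y ^ 2 = m) (c : IsCoprime x y) (hm : m ≠ 0)
    (g1 : (Int.gcd (x1 * y0 - x0 * y1) m : ℤ) = d) (g : (Int.gcd (x * y0 - x0 * y) m : ℤ) = d) :
    m ∣ 2 * D * (x * y1 - x1 * y) := by
  have cy0 : IsCoprime y0 m := by
    rw [← h0, show x0 ^ 2 + D * y0 ^ 2 = x0 ^ 2 + y0 * (D * y0) by ring]
    exact (IsCoprime.add_mul_left_right_iff).2 (c0.symm.pow_right)
  have cy : IsCoprime y m := by
    rw [← h, show x ^ 2 + D * y ^ 2 = x ^ 2 + y * (D * y) by ring]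
    exact (IsCoprime.add_mul_left_right_iff).2 (c.symm.pow_right)
  obtain ⟨m', hm'⟩ : d ∣ m := g ▸ Int.gcd_dvd_right _ _
  have hd0 : d ≠ 0 := by rintro rfl; simp at hm'; exact hm hm'
  have plus : ∀ x y : ℤ, x ^ 2 + D * y ^ 2 = m → (Int.gcd (x * y0 - x0 * y) m : ℤ) = d →
      m' ∣ x * y0 + x0 * y := by
    intro x y h g
    obtain ⟨A', hA'⟩ : d ∣ x * y0 - x0 * y := g ▸ Int.gcd_dvd_left _ _
    have hcop : IsCoprime m' A' := by
      have hb := Int.gcd_eq_gcd_ab (x * y0 - x0 * y) m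
      rw [g] at hb
      refine ⟨Int.gcdB (x * y0 - x0 * y) m, Int.gcdA (x * y0 - x0 * y) m, ?_⟩
      apply mul_left_cancel₀ hd0
      generalize Int.gcdA (x * y0 - x0 * y) m = u at *
      generalize Int.gcdB (x * y0 - x0 * y) m = v at *
      rw [hA', hm'] at hb
      linear_combination -hb
    apply hcop.dvd_of_dvd_mul_left
    apply (mul_dvd_mul_iff_left hd0).1
    rw [← hm', ← mul_assoc, ← hA']
    refine ⟨y0 ^ 2 - y ^ 2, ?_⟩
    linear_combination y0 ^ 2 * h - y ^ 2 * h0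
  have dc : d ∣ x * y1 - x1 * y := by
    have : IsCoprime d y0 := (cy0.of_isCoprime_of_dvd_right ⟨m', hm'⟩).symm
    apply this.dvd_of_dvd_mul_left
    have e : y0 * (x * y1 - x1 * y) = y1 * (x * y0 - x0 * y) - y * (x1 * y0 - x0 * y1) := by ring
    rw [e]
    exact dvd_sub (Dvd.dvd.mul_left (g ▸ Int.gcd_dvd_left _ _) _)
      (Dvd.dvd.mul_left (g1 ▸ Int.gcd_dvd_left _ _) _)
  have mc : m' ∣ x * y1 - x1 * y := by
    have : IsCoprime m' y0 := (cy0.of_isCoprime_of_dvd_right ⟨d, by rw [hm', mul_comm]⟩).symm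
    apply this.dvd_of_dvd_mul_left
    have e : y0 * (x * y1 - x1 * y) = y1 * (x * y0 + x0 * y) - y * (x1 * y0 + x0 * y1) := by ring
    rw [e]
    exact dvd_sub (Dvd.dvd.mul_left (plus _ _ h g) _) (Dvd.dvd.mul_left (plus _ _ h1 g1) _)
  have gd : (Int.gcd d m' : ℤ) ∣ 2 * D := by
    set e : ℤ := (Int.gcd d m' : ℤ) with he
    have ed : e ∣ d := Int.gcd_dvd_left _ _
    have em' : e ∣ m' := Int.gcd_dvd_right _ _
    have em : e ∣ m := ed.trans ⟨m', hm'⟩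
    have ea : e ∣ x * y0 - x0 * y := ed.trans (g ▸ Int.gcd_dvd_left _ _)
    have eb : e ∣ x * y0 + x0 * y := em'.trans (plus _ _ h g)
    have e1 : e ∣ 2 * x := by
      apply (cy0.of_isCoprime_of_dvd_right em).symm.dvd_of_dvd_mul_left
      have := dvd_add ea eb
      rwa [show x * y0 - x0 * y + (x * y0 + x0 * y) = y0 * (2 * x) by ring] at this
    have cye := (cy.of_isCoprime_of_dvd_right em).symm
    apply cye.dvd_of_dvd_mul_left
    apply cye.dvd_of_dvd_mul_left
    have := dvd_sub (em.mul_left 2) (e1.mul_right x)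
    rwa [← h, show 2 * (x ^ 2 + D * y ^ 2) - 2 * x * x = y * (y * (2 * D)) by ring] at this
  have hb := Int.gcd_eq_gcd_ab d m'
  have : m ∣ (Int.gcd d m' : ℤ) * (x * y1 - x1 * y) := by
    rw [hb, add_mul]
    obtain ⟨s, hs⟩ := dc
    obtain ⟨t, ht⟩ := mc
    refine dvd_add ⟨d.gcdA m' * t, ?_⟩ ⟨d.gcdB m' * s, ?_⟩
    · rw [ht, hm']; ring
    · rw [hs, hm']; ring
  exact this.trans (mul_dvd_mul_right gd _)

theorem card_primitive_representations_le (D : ℕ) (hD : 1 ≤ D) (m : ℕ) (hm : m ≠ 0)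
    (S : Finset (ℤ × ℤ))
    (hS : ∀ z ∈ S, z.1 ^ 2 + (D : ℤ) * z.2 ^ 2 = m ∧ IsCoprime z.1 z.2) :
    S.card ≤ (2 * (4 * D + 1)) * m.divisors.card := by
  classical
  rcases S.eq_empty_or_nonempty with rfl | ⟨z0, hz0⟩
  · simp
  have hmZ : (m : ℤ) ≠ 0 := by exact_mod_cast hm
  refine (Finset.card_le_mul_card_image_of_maps_to
    (f := fun z : ℤ × ℤ => Int.gcd (z.1 * z0.2 - z0.1 * z.2) m) (t := m.divisors) ?_ _ ?_)
  · intro z _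
    rw [Nat.mem_divisors]
    exact ⟨by simpa using Int.gcd_dvd_natAbs_right (z.1 * z0.2 - z0.1 * z.2) m, hm⟩
  intro d _
  set F := S.filter (fun z : ℤ × ℤ => Int.gcd (z.1 * z0.2 - z0.1 * z.2) m = d) with hF
  rcases F.eq_empty_or_nonempty with hFe | ⟨z1, hz1⟩
  · rw [hFe]; simp
  have hz1' := (Finset.mem_filter.1 hz1)
  obtain ⟨h1, c1⟩ := hS z1 hz1'.1
  obtain ⟨h0, c0⟩ := hS z0 hz0
  have hdvd : ∀ z ∈ F, (m : ℤ) ∣ 2 * D * (z.1 * z1.2 - z1.1 * z.2) := by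
    intro z hz
    have hz' := Finset.mem_filter.1 hz
    obtain ⟨h, c⟩ := hS z hz'.1
    exact dvd_two_mul_of_represented (d := d) h0 c0 h1 h c hmZ
      (by exact_mod_cast hz1'.2) (by exact_mod_cast hz'.2)
  let φ : ℤ × ℤ → ℤ × Bool := fun z =>
    (2 * D * (z.1 * z1.2 - z1.1 * z.2) / m, decide (0 ≤ z.1 * z1.1 + D * (z.2 * z1.2)))
  have hident : ∀ z ∈ F, (D : ℤ) * (z.1 * z1.2 - z1.1 * z.2) ^ 2
      + (z.1 * z1.1 + D * (z.2 * z1.2)) ^ 2 = (m : ℤ) ^ 2 := by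
    intro z hz
    obtain ⟨h, c⟩ := hS z (Finset.mem_filter.1 hz).1
    linear_combination (z1.1 ^ 2 + D * z1.2 ^ 2) * h + m * h1
  have hmaps : ∀ z ∈ F, φ z ∈ (Finset.Icc (-(2 * D : ℤ)) (2 * D)) ×ˢ (Finset.univ : Finset Bool) := by
    intro z hz
    simp only [φ, Finset.mem_product, Finset.mem_univ, and_true, Finset.mem_Icc]
    obtain ⟨k, hk⟩ := hdvd z hz
    rw [hk, Int.mul_ediv_cancel_left _ hmZ]
    have hid := hident z hz
    have hc : (z.1 * z1.2 - z1.1 * z.2) ^ 2 ≤ (m : ℤ) ^ 2 := by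
      nlinarith [sq_nonneg (z.1 * z1.1 + D * (z.2 * z1.2)), sq_nonneg (z.1 * z1.2 - z1.1 * z.2)]
    have hmpos : (0 : ℤ) < m := by positivity
    have hc' := abs_le_of_sq_le_sq' hc hmpos.le
    constructor <;> nlinarith
  have hinj : Set.InjOn φ F := by
    intro z hz w hw hzw
    simp only [φ, Prod.mk.injEq] at hzw
    obtain ⟨h2, h3⟩ := hzw
    obtain ⟨k, hk⟩ := hdvd z hz
    obtain ⟨l, hl⟩ := hdvd w hw
    rw [hk, hl, Int.mul_ediv_cancel_left _ hmZ, Int.mul_ediv_cancel_left _ hmZ] at h2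
    have hD0 : (2 * D : ℤ) ≠ 0 := by have : D ≠ 0 := by omega
                                     positivity
    have hc : z.1 * z1.2 - z1.1 * z.2 = w.1 * z1.2 - w.2 * z1.1 := by
      apply mul_left_cancel₀ hD0
      rw [hk, h2, ← hl]; ring
    have he : z.1 * z1.1 + D * (z.2 * z1.2) = w.1 * z1.1 + D * (w.2 * z1.2) := by
      have i1 := hident z hz
      have i2 := hident w hw
      rw [show w.1 * z1.2 - z1.1 * w.2 = w.1 * z1.2 - w.2 * z1.1 by ring, ← hc] at i2
      have hsq : (z.1 * z1.1 + D * (z.2 * z1.2)) ^ 2 = (w.1 * z1.1 + D * (w.2 * z1.2)) ^ 2 := by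
        linarith
      have h3' : (0 ≤ z.1 * z1.1 + D * (z.2 * z1.2)) ↔ (0 ≤ w.1 * z1.1 + D * (w.2 * z1.2)) := by
        simpa using h3
      rcases sq_eq_sq_iff_eq_or_eq_neg.1 hsq with h | h
      · exact h
      · rw [h] at h3' ⊢
        omega
    have hx : (m : ℤ) * z.1 = m * w.1 := by
      rw [← h1]; linear_combination z1.1 * he + D * z1.2 * hc
    have hy : (m : ℤ) * z.2 = m * w.2 := by
      rw [← h1]; linear_combination z1.2 * he - z1.1 * hc
    exact Prod.ext (mul_left_cancel₀ hmZ hx) (mul_left_cancel₀ hmZ hy)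
  have := Finset.card_le_card_of_injOn φ hmaps hinj
  refine this.trans ?_
  rw [Finset.card_product, Int.card_Icc]
  simp
  omega

theorem exists_card_representations_le_rpow (D : ℕ) (hD : 1 ≤ D) (ε : ℝ) (hε : 0 < ε) :
    ∃ C : ℝ, 1 ≤ C ∧ ∀ m : ℕ, m ≠ 0 → ∀ S : Finset (ℤ × ℤ),
      (∀ z ∈ S, z.1 ^ 2 + (D : ℤ) * z.2 ^ 2 = m) → (S.card : ℝ) ≤ C * (m : ℝ) ^ ε := by
  classical
  obtain ⟨C, hC, hdiv⟩ := exists_card_divisors_le_rpow (ε / 2) (by positivity)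
  refine ⟨(2 * (4 * D + 1)) * C * C, ?_, fun m hm S hS => ?_⟩
  · have : (1 : ℝ) ≤ D := by exact_mod_cast hD
    nlinarith [mul_le_mul hC hC (by norm_num) (by linarith)]
  have hmZ : (m : ℤ) ≠ 0 := by exact_mod_cast hm
  have hcard : S.card ≤ (2 * (4 * D + 1)) * m.divisors.card * m.divisors.card := by
    refine (Finset.card_le_mul_card_image_of_maps_to
      (f := fun z : ℤ × ℤ => Int.gcd z.1 z.2) (t := m.divisors) ?_ _ ?_)
    · intro z hz
      rw [Nat.mem_divisors]
      refine ⟨?_, hm⟩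
      have h := hS z hz
      have h1 : ((Int.gcd z.1 z.2 : ℕ) : ℤ) ∣ m := by
        rw [← h]
        exact dvd_add ((Int.gcd_dvd_left _ _).trans (dvd_pow_self _ two_ne_zero))
          (((Int.gcd_dvd_right _ _).trans (dvd_pow_self _ two_ne_zero)).mul_left _)
      exact_mod_cast h1
    intro g _
    set F := S.filter (fun z : ℤ × ℤ => Int.gcd z.1 z.2 = g) with hF
    rcases F.eq_empty_or_nonempty with hFe | ⟨z1, hz1⟩
    · rw [hFe]; simp
    have repr : ∀ z ∈ F, ∃ x y : ℤ, z.1 = g * x ∧ z.2 = g * y ∧ IsCoprime x y ∧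
        (g : ℤ) ^ 2 * (x ^ 2 + D * y ^ 2) = m := by
      intro z hz
      obtain ⟨hzS, hg⟩ := Finset.mem_filter.1 hz
      have h := hS z hzS
      have hgpos : 0 < Int.gcd z.1 z.2 := by
        apply Nat.pos_of_ne_zero
        intro h0
        rw [Int.gcd_eq_zero_iff] at h0
        rw [h0.1, h0.2] at h
        simp at h
        exact hmZ h.symm
      obtain ⟨x, y, hxy, hx, hy⟩ := Int.exists_gcd_one hgpos
      rw [hg] at hx hy
      refine ⟨x, y, by rw [hx]; ring, by rw [hy]; ring, Int.isCoprime_iff_gcd_eq_one.2 hxy, ?_⟩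
      rw [← h, hx, hy]; ring
    obtain ⟨x1, y1, -, -, -, hm1⟩ := repr z1 hz1
    have hg0 : (g : ℤ) ≠ 0 := by rintro h0; rw [h0] at hm1; simp at hm1; exact hmZ hm1.symm
    have hgm : g ^ 2 ∣ m := by
      have : (g : ℤ) ^ 2 ∣ m := ⟨_, hm1.symm⟩
      exact_mod_cast this
    obtain ⟨m', hm'⟩ := hgm
    have hm'0 : m' ≠ 0 := by rintro rfl; simp at hm'; exact hm hm'
    have hinj : Set.InjOn (fun z : ℤ × ℤ => (z.1 / g, z.2 / g)) F := by
      intro z hz w hw hzw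
      obtain ⟨x, y, hx, hy, -, -⟩ := repr z hz
      obtain ⟨x', y', hx', hy', -, -⟩ := repr w hw
      simp only [hx, hy, hx', hy', Int.mul_ediv_cancel_left _ hg0, Prod.mk.injEq] at hzw
      exact Prod.ext (by rw [hx, hx', hzw.1]) (by rw [hy, hy', hzw.2])
    rw [← Finset.card_image_of_injOn hinj]
    refine (card_primitive_representations_le D hD m' hm'0 _ ?_).trans ?_
    · intro w hw
      obtain ⟨z, hz, rfl⟩ := Finset.mem_image.1 hw
      obtain ⟨x, y, hx, hy, hc, hxy⟩ := repr z hz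
      simp only [hx, hy, Int.mul_ediv_cancel_left _ hg0]
      refine ⟨?_, hc⟩
      apply mul_left_cancel₀ (pow_ne_zero 2 hg0)
      rw [hxy, hm']; push_cast; ring
    · gcongr
      exact ⟨g ^ 2, by rw [hm', mul_comm]⟩
  have h1 := hdiv m hm
  have h2 : (m : ℝ) ^ ε = (m : ℝ) ^ (ε / 2) * (m : ℝ) ^ (ε / 2) := by
    rw [← Real.rpow_add (by positivity)]; ring_nf
  calc (S.card : ℝ) ≤ (2 * (4 * D + 1)) * m.divisors.card * m.divisors.card := by
        exact_mod_cast hcard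
    _ ≤ (2 * (4 * D + 1)) * (C * (m : ℝ) ^ (ε / 2)) * (C * (m : ℝ) ^ (ε / 2)) := by gcongr
    _ = _ := by rw [h2]; ring

theorem exists_card_divisors_pow_le (B : ℕ) (hB : 1 ≤ B) :
    ∃ C : ℝ, 1 ≤ C ∧ ∀ Q : ℕ, 1 ≤ Q → ∀ k : ℕ, k ≠ 0 →
      ((((Finset.Icc 1 Q).filter (· ∣ k)).card : ℕ) : ℝ) ^ B ≤
        C * Q * (((Finset.Icc 1 (Q ^ B)).filter (· ∣ k)).card : ℕ) := by
  classical
  obtain ⟨C, hC, hdiv⟩ := exists_card_divisors_le_rpow (1 / (B : ℝ) ^ 2) (by positivity)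
  refine ⟨C ^ B, one_le_pow₀ hC, fun Q hQ k hk => ?_⟩
  set T := (Finset.Icc 1 Q).filter (· ∣ k) with hT
  set U := (Finset.Icc 1 (Q ^ B)).filter (· ∣ k) with hU
  set P := Fintype.piFinset (fun _ : Fin B => T) with hP
  have hPcard : P.card = T.card ^ B := by simp [hP]
  let f : (Fin B → ℕ) → ℕ := fun t => Finset.univ.lcm t
  have hpos : ∀ t ∈ P, ∀ i, 1 ≤ t i ∧ t i ≤ Q ∧ t i ∣ k := by
    intro t ht i
    have := Fintype.mem_piFinset.1 ht i
    simp only [hT, Finset.mem_filter, Finset.mem_Icc] at this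
    exact ⟨this.1.1, this.1.2, this.2⟩
  have hmaps : ∀ t ∈ P, f t ∈ U := by
    intro t ht
    have hk' : f t ∣ k := Finset.lcm_dvd fun i _ => (hpos t ht i).2.2
    simp only [hU, Finset.mem_filter, Finset.mem_Icc]
    refine ⟨⟨Nat.pos_of_dvd_of_pos hk' (Nat.pos_of_ne_zero hk), ?_⟩, hk'⟩
    have h1 : f t ∣ ∏ i, t i := Finset.lcm_dvd fun i hi => Finset.dvd_prod_of_mem _ hi
    calc f t ≤ ∏ i, t i := Nat.le_of_dvd (Finset.prod_pos fun i _ => (hpos t ht i).1) h1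
      _ ≤ ∏ _i : Fin B, Q := Finset.prod_le_prod' fun i _ => (hpos t ht i).2.1
      _ = Q ^ B := by simp
  have hfib : ∀ L ∈ U, (((P.filter (fun t => f t = L)).card : ℕ) : ℝ) ≤ C ^ B * Q := by
    intro L hL
    simp only [hU, Finset.mem_filter, Finset.mem_Icc] at hL
    have hL0 : L ≠ 0 := by omega
    have h1 : (P.filter (fun t => f t = L)).card ≤ L.divisors.card ^ B := by
      have : (Fintype.piFinset (fun _ : Fin B => L.divisors)).card = L.divisors.card ^ B := by simp
      rw [← this]
      refine Finset.card_le_card fun t ht => ?_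
      rw [Finset.mem_filter] at ht
      rw [Fintype.mem_piFinset]
      intro i
      rw [Nat.mem_divisors]
      exact ⟨ht.2 ▸ Finset.dvd_lcm (Finset.mem_univ i), hL0⟩
    calc (((P.filter (fun t => f t = L)).card : ℕ) : ℝ) ≤ (L.divisors.card : ℝ) ^ B := by
          exact_mod_cast h1
      _ ≤ (C * (L : ℝ) ^ (1 / (B : ℝ) ^ 2)) ^ B := by gcongr; exact hdiv L hL0
      _ ≤ (C * ((Q : ℝ) ^ B) ^ (1 / (B : ℝ) ^ 2)) ^ B := by
          have : (L : ℝ) ≤ (Q : ℝ) ^ B := by exact_mod_cast hL.1.2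
          gcongr
      _ = C ^ B * Q := by
          rw [mul_pow]
          congr 1
          rw [← Real.rpow_natCast (Q : ℝ), ← Real.rpow_mul (by positivity), ← Real.rpow_natCast,
            ← Real.rpow_mul (by positivity)]
          rw [show (B : ℝ) * (1 / (B : ℝ) ^ 2) * B = 1 by field_simp, Real.rpow_one]
  calc (T.card : ℝ) ^ B = ((P.card : ℕ) : ℝ) := by rw [hPcard]; push_cast; rfl
    _ = ∑ L ∈ U, (((P.filter (fun t => f t = L)).card : ℕ) : ℝ) := by
        rw [Finset.card_eq_sum_card_fiberwise hmaps]; push_cast; rfl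
    _ ≤ ∑ L ∈ U, C ^ B * Q := Finset.sum_le_sum hfib
    _ = _ := by rw [Finset.sum_const, nsmul_eq_mul]; ring

theorem sum_inv_le_rpow (B : ℕ) (hB : 1 ≤ B) (Q : ℕ) (hQ : 1 ≤ Q) :
    ∑ d ∈ Finset.Icc 1 Q, ((d : ℝ))⁻¹ ≤ (1 + B) * (Q : ℝ) ^ (1 / (B : ℝ)) := by
  have hQ1 : (1 : ℝ) ≤ Q := by exact_mod_cast hQ
  have h1 : ∑ d ∈ Finset.Icc 1 Q, ((d : ℝ))⁻¹ ≤ 1 + Real.log Q := by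
    have := harmonic_le_one_add_log Q
    rw [harmonic_eq_sum_Icc] at this
    push_cast at this
    exact this
  have h2 := Real.log_le_rpow_div (by positivity : (0 : ℝ) ≤ Q) (by positivity : 0 < 1 / (B : ℝ))
  have h3 : 1 ≤ (Q : ℝ) ^ (1 / (B : ℝ)) := Real.one_le_rpow hQ1 (by positivity)
  rw [div_div_eq_mul_div, div_one] at h2
  linarith

theorem norm_sum_coprime_pow_le (q : ℕ) (hq : 0 < q) (k : ℤ) :
    ‖∑ a ∈ (Finset.range q).filter (fun a => Nat.Coprime a q),
      Complex.exp (2 * π * Complex.I * (k * a / q : ℝ))‖ ≤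
      ∑ d ∈ q.divisors.filter (fun d : ℕ => (d : ℤ) ∣ k), (d : ℝ) := by
  classical
  have geom : ∀ e : ℕ, e ≠ 0 → ∑ b ∈ Finset.range e, Complex.exp (2 * π * Complex.I * (k * b / e : ℝ))
      = if (e : ℤ) ∣ k then (e : ℂ) else 0 := by
    intro e he
    have heC : (e : ℂ) ≠ 0 := by exact_mod_cast he
    set z := Complex.exp (2 * π * Complex.I * (k / e)) with hz
    have h1 : ∀ b : ℕ, Complex.exp (2 * π * Complex.I * (k * b / e : ℝ)) = z ^ b := by
      intro b
      rw [hz, ← Complex.exp_nat_mul]; congr 1; push_cast; ring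
    simp_rw [h1]
    have hze : z ^ e = 1 := by
      rw [hz, ← Complex.exp_nat_mul, Complex.exp_eq_one_iff]
      exact ⟨k, by field_simp⟩
    split_ifs with h
    · obtain ⟨l, hl⟩ := h
      have : z = 1 := by
        rw [hz, Complex.exp_eq_one_iff]
        refine ⟨l, ?_⟩
        rw [hl]; push_cast; field_simp
      simp [this]
    · have hz1 : z ≠ 1 := by
        intro hz1
        rw [hz, Complex.exp_eq_one_iff] at hz1
        obtain ⟨l, hl⟩ := hz1
        apply h
        refine ⟨l, ?_⟩
        have h2 : (2 * π * Complex.I : ℂ) ≠ 0 := Complex.two_pi_I_ne_zero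
        have h3 : (k / e : ℂ) = l := by
          apply mul_left_cancel₀ h2; rw [hl]; ring
        rw [div_eq_iff heC] at h3
        have : (k : ℂ) = ((e * l : ℤ) : ℂ) := by rw [h3]; push_cast; ring
        exact_mod_cast this
      rw [geom_sum_eq hz1, hze]; simp
  have ind : ∀ a : ℕ, (if Nat.Coprime a q then (1 : ℂ) else 0)
      = ∑ d ∈ q.divisors, if d ∣ a then (ArithmeticFunction.moebius d : ℂ) else 0 := by
    intro a
    have h1 : ∑ d ∈ (Nat.gcd a q).divisors, (ArithmeticFunction.moebius d : ℤ) =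
        if Nat.gcd a q = 1 then 1 else 0 := by
      have := ArithmeticFunction.coe_zeta_mul_apply (f := ArithmeticFunction.moebius) (x := Nat.gcd a q)
      rw [← this, ArithmeticFunction.coe_zeta_mul_moebius, ArithmeticFunction.one_apply]
    rw [← Finset.sum_filter]
    have h2 : q.divisors.filter (fun d => d ∣ a) = (Nat.gcd a q).divisors := by
      ext d
      simp only [Finset.mem_filter, Nat.mem_divisors, Nat.dvd_gcd_iff]
      have : Nat.gcd a q ≠ 0 := (Nat.gcd_pos_of_pos_right a hq).ne'
      have := hq.ne'
      tauto
    rw [h2]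
    have h3 := congrArg (fun z : ℤ => (z : ℂ)) h1
    push_cast at h3
    rw [h3]
  have inner : ∀ d ∈ q.divisors, ∑ a ∈ (Finset.range q).filter (fun a => d ∣ a),
      Complex.exp (2 * π * Complex.I * (k * a / q : ℝ)) =
      if ((q / d : ℕ) : ℤ) ∣ k then ((q / d : ℕ) : ℂ) else 0 := by
    intro d hd
    obtain ⟨⟨e, he⟩, -⟩ := Nat.mem_divisors.1 hd
    have hd0 : 0 < d := Nat.pos_of_mem_divisors hd
    have he0 : e ≠ 0 := by rintro rfl; omega
    rw [he, Nat.mul_div_cancel_left _ hd0, ← geom e he0]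
    symm
    refine Finset.sum_bij (fun b _ => d * b) ?_ ?_ ?_ ?_
    · intro b hb
      simp only [Finset.mem_filter, Finset.mem_range] at hb ⊢
      exact ⟨Nat.mul_lt_mul_of_pos_left hb hd0, dvd_mul_right _ _⟩
    · intro b _ c _ h
      exact Nat.eq_of_mul_eq_mul_left hd0 h
    · intro a ha
      simp only [Finset.mem_filter, Finset.mem_range] at ha
      obtain ⟨ha, b, rfl⟩ := ha
      exact ⟨b, Finset.mem_range.2 (Nat.lt_of_mul_lt_mul_left ha), rfl⟩
    · intro b _
      have : (d : ℂ) ≠ 0 := by exact_mod_cast hd0.ne'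
      have : (e : ℂ) ≠ 0 := by exact_mod_cast he0
      congr 2
      push_cast
      field_simp
  have hsum : ∑ a ∈ (Finset.range q).filter (fun a => Nat.Coprime a q),
      Complex.exp (2 * π * Complex.I * (k * a / q : ℝ)) =
      ∑ d ∈ q.divisors, (ArithmeticFunction.moebius d : ℂ) *
        (if ((q / d : ℕ) : ℤ) ∣ k then ((q / d : ℕ) : ℂ) else 0) := by
    rw [Finset.sum_filter]
    calc _ = ∑ a ∈ Finset.range q, (if Nat.Coprime a q then (1 : ℂ) else 0) *
          Complex.exp (2 * π * Complex.I * (k * a / q : ℝ)) := by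
          refine Finset.sum_congr rfl fun a _ => ?_
          split_ifs <;> simp
      _ = ∑ d ∈ q.divisors, ∑ a ∈ Finset.range q,
          (if d ∣ a then (ArithmeticFunction.moebius d : ℂ) else 0) *
          Complex.exp (2 * π * Complex.I * (k * a / q : ℝ)) := by
          rw [Finset.sum_comm]
          refine Finset.sum_congr rfl fun a _ => ?_
          rw [ind, Finset.sum_mul]
      _ = _ := by
          refine Finset.sum_congr rfl fun d hd => ?_
          rw [← inner d hd, Finset.sum_filter, Finset.mul_sum]
          refine Finset.sum_congr rfl fun a _ => ?_
          split_ifs <;> simp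
  rw [hsum]
  refine (norm_sum_le _ _).trans ?_
  calc _ ≤ ∑ d ∈ q.divisors, (if ((q / d : ℕ) : ℤ) ∣ k then ((q / d : ℕ) : ℝ) else 0) := by
        refine Finset.sum_le_sum fun d _ => ?_
        rw [norm_mul]
        have h1 : ‖(ArithmeticFunction.moebius d : ℂ)‖ ≤ 1 := by
          rw [Complex.norm_intCast]
          exact_mod_cast ArithmeticFunction.abs_moebius_le_one
        split_ifs
        · rw [Complex.norm_natCast]
          exact mul_le_of_le_one_left (by positivity) h1
        · simp
    _ = ∑ d ∈ q.divisors, (if (d : ℤ) ∣ k then (d : ℝ) else 0) :=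
        Nat.sum_div_divisors q (fun d => if (d : ℤ) ∣ k then (d : ℝ) else 0)
    _ = _ := by rw [Finset.sum_filter]

/-- The distance from `θ` to the nearest integer. -/
noncomputable def distInt (θ : ℝ) : ℝ := |θ - round θ|

theorem distInt_nonneg (θ : ℝ) : 0 ≤ distInt θ := abs_nonneg _

theorem sum_range_inv_sq_le {c : ℝ} (hc : 0 < c) (V : ℕ) :
    ∑ v ∈ Finset.range V, 1 / (1 + c * ((v : ℝ) + 1)) ^ 2 ≤ 1 / c := by
  have key : ∑ v ∈ Finset.range V, 1 / (1 + c * ((v : ℝ) + 1)) ^ 2 ≤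
      (1 / c) * (1 - 1 / (1 + c * V)) := by
    induction V with
    | zero => simp
    | succ V ih =>
      rw [Finset.sum_range_succ]
      have h1 : 0 < 1 + c * (V : ℝ) := by positivity
      have h2 : 0 < 1 + c * ((V : ℝ) + 1) := by positivity
      have h3 : 1 / (1 + c * ((V : ℝ) + 1)) ^ 2 ≤
          (1 / c) * (1 / (1 + c * V) - 1 / (1 + c * ((V : ℝ) + 1))) := by
        rw [div_sub_div _ _ h1.ne' h2.ne', ← mul_div_assoc, div_le_div_iff₀ (by positivity) (by positivity)]
        have : 1 / c * (1 * (1 + c * ((V : ℝ) + 1)) - (1 + c * V) * 1) = 1 := by field_simp; ring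
        rw [this]
        nlinarith [mul_pos hc h2]
      push_cast
      linarith
  refine key.trans (mul_le_of_le_one_right (by positivity) ?_)
  have : 0 ≤ 1 / (1 + c * (V : ℝ)) := by positivity
  linarith

theorem sum_range_inv_sq_le' {c : ℝ} (hc : 0 < c) (V : ℕ) :
    ∑ v ∈ Finset.range V, 1 / (1 + c * (v : ℝ)) ^ 2 ≤ 1 + 1 / c := by
  have h := sum_range_inv_sq_le hc V
  calc _ ≤ ∑ v ∈ Finset.range (V + 1), 1 / (1 + c * (v : ℝ)) ^ 2 :=
        Finset.sum_le_sum_of_subset_of_nonneg (Finset.range_mono (Nat.le_succ V))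
          (fun _ _ _ => by positivity)
    _ = _ := by rw [Finset.sum_range_succ']
    _ ≤ _ := by
        push_cast
        norm_num at h ⊢
        linarith

theorem norm_sum_Icc_exp_mul_le (W : ℕ) (θ : ℝ) :
    ‖∑ i ∈ Finset.Icc (-(W : ℤ)) W, Complex.exp (2 * π * Complex.I * ((i : ℝ) * θ : ℝ))‖ *
      (1 + (2 * W + 1) * distInt θ) ≤ 2 * (2 * W + 1) := by
  set S := ∑ i ∈ Finset.Icc (-(W : ℤ)) W, Complex.exp (2 * π * Complex.I * ((i : ℝ) * θ : ℝ)) with hS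
  have hnorm : ∀ x : ℝ, ‖Complex.exp (2 * π * Complex.I * x)‖ = 1 := by
    intro x
    rw [show (2 * π * Complex.I * x : ℂ) = ((2 * π * x : ℝ) : ℂ) * Complex.I by push_cast; ring]
    exact Complex.norm_exp_ofReal_mul_I _
  have h1 : ‖S‖ ≤ 2 * W + 1 := by
    refine (norm_sum_le _ _).trans ?_
    simp_rw [hnorm]
    rw [Finset.sum_const, Int.card_Icc, nsmul_eq_mul, mul_one]
    have : ((W : ℤ) + 1 - -(W : ℤ)).toNat = 2 * W + 1 := by omega
    rw [this]; push_cast; rfl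
  have hre : S = ∑ j ∈ Finset.range (2 * W + 1),
      Complex.exp (2 * π * Complex.I * (((j : ℝ) - W) * θ : ℝ)) := by
    rw [hS]
    refine Finset.sum_bij (fun i _ => (i + W).toNat) ?_ ?_ ?_ ?_
    · intro i hi; simp only [Finset.mem_Icc, Finset.mem_range] at hi ⊢; omega
    · intro i hi j hj h; simp only [Finset.mem_Icc] at hi hj; omega
    · intro j hj
      simp only [Finset.mem_range] at hj
      exact ⟨(j : ℤ) - W, by simp only [Finset.mem_Icc]; omega, by omega⟩
    · intro i hi
      simp only [Finset.mem_Icc] at hi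
      have : (((i + W).toNat : ℕ) : ℝ) = (i : ℝ) + W := by
        have : (((i + W).toNat : ℕ) : ℤ) = i + W := by omega
        exact_mod_cast this
      rw [this, add_sub_cancel_right]
  have h2 : ‖S‖ * ‖Complex.exp (2 * π * Complex.I * θ) - 1‖ ≤ 2 := by
    rw [← norm_mul, hre, Finset.sum_mul]
    have : ∀ j ∈ Finset.range (2 * W + 1),
        Complex.exp (2 * π * Complex.I * (((j : ℝ) - W) * θ : ℝ)) *
          (Complex.exp (2 * π * Complex.I * θ) - 1) =
        Complex.exp (2 * π * Complex.I * ((((j + 1 : ℕ) : ℝ) - W) * θ : ℝ)) -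
        Complex.exp (2 * π * Complex.I * (((j : ℝ) - W) * θ : ℝ)) := by
      intro j _
      rw [mul_sub, ← Complex.exp_add, mul_one]
      congr 2
      push_cast; ring
    rw [Finset.sum_congr rfl this,
      Finset.sum_range_sub (fun j : ℕ => Complex.exp (2 * π * Complex.I * (((j : ℝ) - W) * θ : ℝ)))]
    refine (norm_sub_le _ _).trans ?_
    rw [hnorm, hnorm]; norm_num
  have h3 : 4 * distInt θ ≤ ‖Complex.exp (2 * π * Complex.I * θ) - 1‖ := by
    set y := θ - round θ with hy
    have e1 : Complex.exp (2 * π * Complex.I * θ) = Complex.exp (Complex.I * (2 * π * y : ℝ)) := by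
      rw [Complex.exp_eq_exp_iff_exists_int]
      refine ⟨round θ, ?_⟩
      rw [hy]; push_cast; ring
    rw [e1, Complex.norm_exp_I_mul_ofReal_sub_one, norm_mul, Real.norm_eq_abs, Real.norm_eq_abs,
      show 2 * π * y / 2 = π * y by ring]
    have hy2 : |y| ≤ 1 / 2 := abs_sub_round θ
    have := Real.mul_abs_le_abs_sin (x := π * y) (by
      rw [abs_mul, abs_of_pos Real.pi_pos]; nlinarith [Real.pi_pos])
    rw [abs_mul π, abs_of_pos Real.pi_pos] at this
    have e2 : 2 / π * (π * |y|) = 2 * |y| := by field_simp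
    rw [e2] at this
    rw [abs_two]
    change 4 * |y| ≤ _
    linarith
  have h4 : ‖S‖ * distInt θ ≤ 1 / 2 := by
    nlinarith [mul_le_mul_of_nonneg_left h3 (norm_nonneg S)]
  nlinarith

theorem distInt_separated {α : ℝ} {a : ℤ} {q : ℕ} (hq : 0 < q) (hc : IsCoprime a (q : ℤ))
    (hα : |α - a / q| ≤ 1 / (q : ℝ) ^ 2) {d z : ℤ} (hd0 : d ≠ 0) (hd : 2 * |d| ≤ q) :
    1 / (2 * (q : ℝ)) ≤ |α * d - z| := by
  have hqR : (0 : ℝ) < q := by exact_mod_cast hq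
  have hne : a * d - q * z ≠ 0 := by
    intro h
    have h1 : (q : ℤ) ∣ a * d := ⟨z, by linarith⟩
    have h2 : (q : ℤ) ∣ d := hc.symm.dvd_of_dvd_mul_left h1
    have := Int.le_of_dvd (abs_pos.2 hd0) ((dvd_abs _ _).2 h2)
    omega
  have h1 : (1 : ℝ) ≤ |(a : ℝ) * d - q * z| := by
    have := Int.one_le_abs hne
    exact_mod_cast this
  have h2 : 1 / (q : ℝ) ≤ |(a : ℝ) / q * d - z| := by
    rw [show (a : ℝ) / q * d - z = (a * d - q * z) / q by field_simp, abs_div, abs_of_pos hqR]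
    gcongr
  have h3 : |(α - a / q) * d| ≤ 1 / (2 * q) := by
    rw [abs_mul]
    have hdR : |(d : ℝ)| ≤ q / 2 := by
      have : (2 : ℝ) * |(d : ℝ)| ≤ q := by exact_mod_cast hd
      linarith
    calc _ ≤ 1 / (q : ℝ) ^ 2 * (q / 2) := by gcongr
      _ = _ := by field_simp
  have h4 : |(a : ℝ) / q * d - z| ≤ |α * d - z| + |(α - a / q) * d| := by
    have := abs_sub (α * d - z) ((α - a / q) * d)
    rwa [show α * d - z - (α - a / q) * d = a / q * d - z by ring] at this
  have h5 : 1 / (q : ℝ) = 1 / (2 * q) + 1 / (2 * q) := by field_simp; norm_num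
  linarith

theorem sum_block_inv_sq_le {α : ℝ} {a : ℤ} {q : ℕ} (hq : 0 < q) (hc : IsCoprime a (q : ℤ))
    (hα : |α - a / q| ≤ 1 / (q : ℝ) ^ 2) {P : ℝ} (hP : 0 < P) (I : Finset ℤ)
    (hI : ∀ h ∈ I, ∀ h' ∈ I, 2 * |h - h'| ≤ q) :
    ∑ h ∈ I, 1 / (1 + P * distInt (α * h)) ^ 2 ≤ 2 * (1 + 2 * q / P) := by
  classical
  set y : ℤ → ℝ := fun h => α * h - round (α * h) with hy
  set f : ℤ → ℕ := fun h => ⌊2 * q * |y h|⌋₊ with hf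
  set c : ℝ := P / (2 * q) with hcdef
  have hc0 : 0 < c := by positivity
  have part : ∀ J ⊆ I, (∀ h ∈ J, ∀ h' ∈ J, |y h - y h'| = |(|y h| - |y h'|)|) →
      ∑ h ∈ J, 1 / (1 + P * distInt (α * h)) ^ 2 ≤ 1 + 2 * q / P := by
    intro J hJ hs
    have hinj : Set.InjOn f J := by
      intro h hh h' hh' hff
      by_contra hne
      have hsep := distInt_separated hq hc hα (d := h - h')
        (z := round (α * h) - round (α * h')) (sub_ne_zero.2 hne) (hI h (hJ hh) h' (hJ hh'))
      rw [show α * ((h - h' : ℤ) : ℝ) - ((round (α * h) - round (α * h') : ℤ) : ℝ) = y h - y h' by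
        rw [hy]; push_cast; ring, hs h hh h' hh'] at hsep
      have a1 := Nat.floor_le (by positivity : 0 ≤ 2 * q * |y h|)
      have a2 := Nat.lt_floor_add_one (2 * q * |y h|)
      have b1 := Nat.floor_le (by positivity : 0 ≤ 2 * q * |y h'|)
      have b2 := Nat.lt_floor_add_one (2 * q * |y h'|)
      have hff' : ⌊2 * q * |y h|⌋₊ = ⌊2 * q * |y h'|⌋₊ := hff
      rw [hff'] at a1 a2
      have : 2 * q * |(|y h| - |y h'|)| < 1 := by
        rw [← abs_of_pos (by positivity : (0 : ℝ) < 2 * q), ← abs_mul, abs_lt]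
        constructor <;> linarith
      rw [div_le_iff₀ (by positivity)] at hsep
      linarith
    calc _ ≤ ∑ h ∈ J, 1 / (1 + c * (f h : ℝ)) ^ 2 := by
          refine Finset.sum_le_sum fun h _ => ?_
          have a1 := Nat.floor_le (by positivity : 0 ≤ 2 * q * |y h|)
          have : c * (f h : ℝ) ≤ P * distInt (α * h) := by
            calc c * (f h : ℝ) ≤ c * (2 * q * |y h|) := by gcongr
              _ = P * |y h| := by rw [hcdef]; field_simp
          gcongr
      _ = ∑ v ∈ J.image f, 1 / (1 + c * (v : ℝ)) ^ 2 := by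
          rw [Finset.sum_image hinj]
      _ ≤ ∑ v ∈ Finset.range ((J.image f).sup id + 1), 1 / (1 + c * (v : ℝ)) ^ 2 :=
          Finset.sum_le_sum_of_subset_of_nonneg
            (fun v hv => Finset.mem_range.2 (Nat.lt_succ_of_le (Finset.le_sup (f := id) hv)))
            (fun _ _ _ => by positivity)
      _ ≤ 1 + 1 / c := sum_range_inv_sq_le' hc0 _
      _ = 1 + 2 * q / P := by rw [hcdef, one_div_div]
  rw [← Finset.sum_filter_add_sum_filter_not I (fun h => 0 ≤ y h)]
  have p1 := part (I.filter (fun h => 0 ≤ y h)) (Finset.filter_subset _ _) (by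
    intro h hh h' hh'
    rw [abs_of_nonneg (Finset.mem_filter.1 hh).2, abs_of_nonneg (Finset.mem_filter.1 hh').2])
  have p2 := part (I.filter (fun h => ¬ 0 ≤ y h)) (Finset.filter_subset _ _) (by
    intro h hh h' hh'
    rw [abs_of_neg (not_le.1 (Finset.mem_filter.1 hh).2),
      abs_of_neg (not_le.1 (Finset.mem_filter.1 hh').2), neg_sub_neg, abs_sub_comm])
  linarith

theorem sum_inv_sq_distInt_le {α : ℝ} {a : ℤ} {q : ℕ} (hq : 0 < q) (hc : IsCoprime a (q : ℤ))
    (hα : |α - a / q| ≤ 1 / (q : ℝ) ^ 2) {P : ℝ} (hP : 0 < P) (H : ℕ) :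
    ∑ h ∈ Finset.Icc (-(H : ℤ)) H, 1 / (1 + P * distInt (α * h)) ^ 2 ≤
      (4 * H / q + 2) * (2 * (1 + 2 * q / P)) := by
  classical
  have hqR : (0 : ℝ) < q := by exact_mod_cast hq
  set b : ℤ := ((q : ℤ) + 1) / 2 with hb
  have hb0 : 0 < b := by omega
  have hmaps : ∀ h ∈ Finset.Icc (-(H : ℤ)) H, h / b ∈ Finset.Icc (-(H : ℤ) / b) (H / b) := by
    intro h hh
    rw [Finset.mem_Icc] at hh ⊢
    exact ⟨Int.ediv_le_ediv hb0 hh.1, Int.ediv_le_ediv hb0 hh.2⟩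
  rw [← Finset.sum_fiberwise_of_maps_to hmaps]
  calc _ ≤ ∑ _v ∈ Finset.Icc (-(H : ℤ) / b) (H / b), 2 * (1 + 2 * q / P) := by
        refine Finset.sum_le_sum fun v _ => sum_block_inv_sq_le hq hc hα hP _ ?_
        intro h hh h' hh'
        have e1 := (Finset.mem_filter.1 hh).2
        have e2 := (Finset.mem_filter.1 hh').2
        have m1 := Int.emod_add_mul_ediv h b
        have m2 := Int.emod_add_mul_ediv h' b
        rw [e1] at m1
        rw [e2] at m2
        have r1 := Int.emod_nonneg h hb0.ne'
        have r2 := Int.emod_nonneg h' hb0.ne'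
        have r3 := Int.emod_lt_of_pos h hb0
        have r4 := Int.emod_lt_of_pos h' hb0
        have : |h - h'| ≤ b - 1 := by rw [abs_le]; constructor <;> linarith
        omega
    _ = ((Finset.Icc (-(H : ℤ) / b) (H / b)).card : ℝ) * (2 * (1 + 2 * q / P)) := by
        rw [Finset.sum_const, nsmul_eq_mul]
    _ ≤ _ := by
        have hcard : ((Finset.Icc (-(H : ℤ) / b) (H / b)).card : ℝ) ≤ 4 * H / q + 2 := by
          rw [Int.card_Icc]
          have u1 : (((H : ℤ) / b : ℤ) : ℝ) ≤ (H : ℝ) / b := by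
            have hbR : (0 : ℝ) < b := by exact_mod_cast hb0
            rw [le_div_iff₀ hbR]
            exact_mod_cast Int.ediv_mul_le (H : ℤ) hb0.ne'
          have u2 : -(H : ℝ) / b - 1 ≤ ((-(H : ℤ) / b : ℤ) : ℝ) := by
            have h1 := Int.emod_add_mul_ediv (-(H : ℤ)) b
            have h2 := Int.emod_lt_of_pos (-(H : ℤ)) hb0
            have h3 : -(H : ℤ) ≤ b * (-(H : ℤ) / b) + b := by linarith
            have h4 : -(H : ℝ) ≤ b * ((-(H : ℤ) / b : ℤ) : ℝ) + b := by exact_mod_cast h3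
            have hbR : (0 : ℝ) < b := by exact_mod_cast hb0
            rw [sub_le_iff_le_add, div_le_iff₀ hbR]
            linarith
          have hnn : (0 : ℤ) ≤ (H : ℤ) / b + 1 - -(H : ℤ) / b := by
            have a1 : 0 ≤ (H : ℤ) / b := Int.ediv_nonneg (by positivity) hb0.le
            have a2 : -(H : ℤ) / b ≤ 0 := Int.ediv_nonpos_of_nonpos_of_neg (by omega) hb0
            omega
          have h5 : ((((H : ℤ) / b + 1 - -(H : ℤ) / b).toNat : ℕ) : ℝ) =
              (((H : ℤ) / b : ℤ) : ℝ) + 1 - ((-(H : ℤ) / b : ℤ) : ℝ) := by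
            have : ((((H : ℤ) / b + 1 - -(H : ℤ) / b).toNat : ℕ) : ℤ) =
              (H : ℤ) / b + 1 - -(H : ℤ) / b := Int.toNat_of_nonneg hnn
            exact_mod_cast this
          rw [h5]
          have hbq : (q : ℝ) / 2 ≤ b := by
            have : (q : ℤ) ≤ 2 * b := by omega
            have : (q : ℝ) ≤ 2 * b := by exact_mod_cast this
            linarith
          have h6 : (H : ℝ) / b ≤ 2 * H / q := by
            rw [div_le_div_iff₀ (by linarith) hqR]
            nlinarith [(by positivity : (0 : ℝ) ≤ H)]
          have h7 : -(H : ℝ) / b = -(H / b) := by ring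
          have h8 : 4 * (H : ℝ) / q = 2 * H / q + 2 * H / q := by ring
          linarith
        gcongr

theorem card_Icc_sum_representations {N : ℕ} {x : ℤ} (hx : x ∈ Finset.Icc (-(N : ℤ)) N) :
    N ≤ #{a ∈ Finset.Icc (-(N : ℤ)) N | x - a ∈ Finset.Icc (-(N : ℤ)) N} := by
  have : ({a ∈ Finset.Icc (-(N : ℤ)) N | x - a ∈ Finset.Icc (-(N : ℤ)) N} : Finset ℤ) =
      Finset.Icc (max (-(N : ℤ)) (x - N)) (min N (x + N)) := by
    ext a
    simp only [Finset.mem_filter, Finset.mem_Icc, max_le_iff, le_min_iff]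
    omega
  rw [Finset.mem_Icc] at hx
  rw [this, Int.card_Icc]
  omega

theorem mul_sum_Icc_le_sum_sum_sub (N : ℕ) {F : ℤ → ℝ} (hF : ∀ x, 0 ≤ F x) :
    (N : ℝ) * ∑ x ∈ Finset.Icc (-(N : ℤ)) N, F x ≤
      ∑ c ∈ Finset.Icc (-(N : ℤ)) N, ∑ c' ∈ Finset.Icc (-(N : ℤ)) N, F (c - c') := by
  set I := Finset.Icc (-(N : ℤ)) N with hI
  calc (N : ℝ) * ∑ x ∈ I, F x
      ≤ ∑ x ∈ I, ∑ c ∈ I with x - c ∈ I, F x := by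
        rw [Finset.mul_sum]
        refine Finset.sum_le_sum fun x hx => ?_
        rw [Finset.sum_const, nsmul_eq_mul]
        exact mul_le_mul_of_nonneg_right (by exact_mod_cast card_Icc_sum_representations hx) (hF x)
    _ = ∑ c ∈ I, ∑ x ∈ I with x - c ∈ I, F x := by
        simp only [Finset.sum_filter]
        rw [Finset.sum_comm]
    _ ≤ ∑ c ∈ I, ∑ c' ∈ I, F (c - c') := by
        refine Finset.sum_le_sum fun c _ => ?_
        calc _ = ∑ x ∈ I with x - c ∈ I, F (c - (c - x)) := by simp only [sub_sub_cancel]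
          _ = ∑ y ∈ (I.filter fun x => x - c ∈ I).image (fun x => c - x), F (c - y) := by
              rw [Finset.sum_image]
              intro x _ y _ h
              simpa using h
          _ ≤ _ := by
              refine Finset.sum_le_sum_of_subset_of_nonneg ?_ fun _ _ _ => hF _
              intro y hy
              simp only [Finset.mem_image, Finset.mem_filter, hI, Finset.mem_Icc] at hy ⊢
              omega

/-- The exponential `e(x) = exp (2 * π * i * x)`. -/
noncomputable def expCirc (x : ℝ) : ℂ := Complex.exp (2 * π * Complex.I * (x : ℂ))

theorem expCirc_add (x y : ℝ) : expCirc (x + y) = expCirc x * expCirc y := by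
  rw [expCirc, expCirc, expCirc, ← Complex.exp_add]
  congr 1
  push_cast
  ring

theorem norm_expCirc (x : ℝ) : ‖expCirc x‖ = 1 := by
  rw [expCirc, show (2 * π * Complex.I * (x : ℂ) : ℂ) = ((2 * π * x : ℝ) : ℂ) * Complex.I by
    push_cast; ring, Complex.norm_exp_ofReal_mul_I]

theorem conj_expCirc (x : ℝ) : (starRingEnd ℂ) (expCirc x) = expCirc (-x) := by
  rw [expCirc, expCirc, ← Complex.exp_conj]
  congr 1
  rw [show (2 * π * Complex.I * (x : ℂ) : ℂ) = ((2 * π * x : ℝ) : ℂ) * Complex.I by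
    push_cast; ring, map_mul, Complex.conj_ofReal, Complex.conj_I]
  push_cast
  ring

theorem sum_norm_sq_bilinear_le (N : ℕ) (f : ℤ → ℂ) (hf : ∀ b, ‖f b‖ = 1) (α : ℝ) :
    ∑ c ∈ Finset.Icc (-(N : ℤ)) N, ∑ c' ∈ Finset.Icc (-(N : ℤ)) N,
      ‖∑ b ∈ Finset.Icc (-(N : ℤ)) N, f b * expCirc (-2 * α * (c - c' : ℤ) * b)‖ ^ 2 ≤
    ∑ b ∈ Finset.Icc (-(N : ℤ)) N, ∑ b' ∈ Finset.Icc (-(N : ℤ)) N,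
      ‖∑ c ∈ Finset.Icc (-(N : ℤ)) N, expCirc ((c : ℝ) * (α * (2 * (b - b') : ℤ)))‖ ^ 2 := by
  set I := Finset.Icc (-(N : ℤ)) N with hI
  have key : ((∑ c ∈ I, ∑ c' ∈ I, ‖∑ b ∈ I, f b * expCirc (-2 * α * (c - c' : ℤ) * b)‖ ^ 2 : ℝ) : ℂ)
      = ∑ b ∈ I, ∑ b' ∈ I, f b * (starRingEnd ℂ) (f b') *
        ((starRingEnd ℂ) (∑ c ∈ I, expCirc ((c : ℝ) * (α * (2 * (b - b') : ℤ)))) *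
          ∑ c ∈ I, expCirc ((c : ℝ) * (α * (2 * (b - b') : ℤ)))) := by
    push_cast
    have h1 : ∀ c c' : ℤ, (‖∑ b ∈ I, f b * expCirc (-2 * α * (c - c' : ℤ) * b)‖ : ℂ) ^ 2 =
        ∑ b ∈ I, ∑ b' ∈ I, f b * (starRingEnd ℂ) (f b') *
          ((starRingEnd ℂ) (expCirc ((c : ℝ) * (α * (2 * (b - b') : ℤ)))) *
            expCirc ((c' : ℝ) * (α * (2 * (b - b') : ℤ)))) := by
      intro c c'
      rw [← Complex.mul_conj', map_sum, Finset.sum_mul_sum]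
      refine Finset.sum_congr rfl fun b _ => Finset.sum_congr rfl fun b' _ => ?_
      rw [map_mul, conj_expCirc, conj_expCirc, mul_mul_mul_comm, ← expCirc_add, ← expCirc_add]
      congr 2
      push_cast
      ring
    push_cast at h1
    simp only [h1]
    have h2 : ∀ c ∈ I, ∑ c' ∈ I, ∑ b ∈ I, ∑ b' ∈ I, f b * (starRingEnd ℂ) (f b') *
          ((starRingEnd ℂ) (expCirc ((c : ℝ) * (α * (2 * (b - b'))))) *
            expCirc ((c' : ℝ) * (α * (2 * (b - b'))))) =
        ∑ b ∈ I, ∑ b' ∈ I, f b * (starRingEnd ℂ) (f b') *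
          ((starRingEnd ℂ) (expCirc ((c : ℝ) * (α * (2 * (b - b'))))) *
            ∑ c' ∈ I, expCirc ((c' : ℝ) * (α * (2 * (b - b'))))) := by
      intro c _
      rw [Finset.sum_comm]
      refine Finset.sum_congr rfl fun b _ => ?_
      rw [Finset.sum_comm]
      refine Finset.sum_congr rfl fun b' _ => ?_
      rw [Finset.mul_sum, Finset.mul_sum]
    rw [Finset.sum_congr rfl h2, Finset.sum_comm]
    refine Finset.sum_congr rfl fun b _ => ?_
    rw [Finset.sum_comm]
    refine Finset.sum_congr rfl fun b' _ => ?_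
    rw [← Finset.mul_sum, map_sum, Finset.sum_mul]
  refine ((le_abs_self _).trans_eq (Complex.norm_real _).symm).trans ?_
  rw [key]
  refine (norm_sum_le _ _).trans (Finset.sum_le_sum fun b _ => (norm_sum_le _ _).trans
    (Finset.sum_le_sum fun b' _ => ?_))
  rw [norm_mul, norm_mul, norm_mul, RCLike.norm_conj, RCLike.norm_conj, hf, hf, one_mul, one_mul, ← sq]

theorem norm_sum_sum_expCirc_sq_le (N : ℕ) (α β : ℝ) :
    (N : ℝ) * ‖∑ a ∈ Finset.Icc (-(N : ℤ)) N, ∑ b ∈ Finset.Icc (-(N : ℤ)) N,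
        expCirc (β * (a + b) - α * (a + b) ^ 2)‖ ^ 2 ≤
      (2 * N + 1) ^ 2 * ∑ h ∈ Finset.Icc (-((4 * N : ℕ) : ℤ)) ((4 * N : ℕ) : ℤ),
        ‖∑ c ∈ Finset.Icc (-(N : ℤ)) N, expCirc ((c : ℝ) * (α * h))‖ ^ 2 := by
  set I := Finset.Icc (-(N : ℤ)) N with hI
  have hcard : (I.card : ℝ) = 2 * N + 1 := by
    rw [hI, Int.card_Icc, show ((N : ℤ) + 1 - -N).toNat = 2 * N + 1 by omega]
    push_cast; ring
  set f : ℤ → ℂ := fun b => expCirc (β * b - α * b ^ 2) with hf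
  have hfn : ∀ b, ‖f b‖ = 1 := fun b => norm_expCirc _
  set T : ℤ → ℂ := fun a => ∑ b ∈ I, f b * expCirc (-2 * α * a * b) with hT
  have e1 : ∑ a ∈ I, ∑ b ∈ I, expCirc (β * (a + b) - α * (a + b) ^ 2) = ∑ a ∈ I, f a * T a := by
    refine Finset.sum_congr rfl fun a _ => ?_
    rw [hT, Finset.mul_sum]
    refine Finset.sum_congr rfl fun b _ => ?_
    rw [hf, ← expCirc_add, ← expCirc_add]
    congr 1; ring
  have e2 : ‖∑ a ∈ I, f a * T a‖ ^ 2 ≤ (2 * N + 1) * ∑ a ∈ I, ‖T a‖ ^ 2 := by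
    have : ‖∑ a ∈ I, f a * T a‖ ≤ ∑ a ∈ I, ‖T a‖ := by
      refine (norm_sum_le _ _).trans (Finset.sum_le_sum fun a _ => ?_)
      rw [norm_mul, hfn, one_mul]
    calc _ ≤ (∑ a ∈ I, ‖T a‖) ^ 2 := by gcongr
      _ ≤ _ := by rw [← hcard]; exact sq_sum_le_card_mul_sum_sq
  have e3 := mul_sum_Icc_le_sum_sum_sub N (F := fun a => ‖T a‖ ^ 2) (fun _ => by positivity)
  have e4 := sum_norm_sq_bilinear_le N f hfn α
  set G : ℤ → ℝ := fun h => ‖∑ c ∈ I, expCirc ((c : ℝ) * (α * h))‖ ^ 2 with hG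
  have e5 : ∑ b ∈ I, ∑ b' ∈ I, G (2 * (b - b')) ≤
      (2 * N + 1) * ∑ h ∈ Finset.Icc (-((4 * N : ℕ) : ℤ)) ((4 * N : ℕ) : ℤ), G h := by
    rw [← hcard, ← nsmul_eq_mul]
    refine Finset.sum_le_card_nsmul _ _ _ fun b hb => ?_
    rw [← Finset.sum_image (s := I) (g := fun x => 2 * (b - x)) (f := G)]
    · refine Finset.sum_le_sum_of_subset_of_nonneg ?_ fun _ _ _ => by positivity
      intro y hy
      simp only [Finset.mem_image, hI, Finset.mem_Icc] at hy hb ⊢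
      obtain ⟨x, hx, rfl⟩ := hy
      push_cast
      omega
    · intro x _ y _ h
      simp only at h
      omega
  rw [e1]
  calc (N : ℝ) * ‖∑ a ∈ I, f a * T a‖ ^ 2 ≤ N * ((2 * N + 1) * ∑ a ∈ I, ‖T a‖ ^ 2) := by gcongr
    _ = (2 * N + 1) * (N * ∑ a ∈ I, ‖T a‖ ^ 2) := by ring
    _ ≤ (2 * N + 1) * ((2 * N + 1) *
        ∑ h ∈ Finset.Icc (-((4 * N : ℕ) : ℤ)) ((4 * N : ℕ) : ℤ), G h) := by
        exact mul_le_mul_of_nonneg_left (e3.trans (e4.trans e5)) (by positivity)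
    _ = _ := by ring

/-- A Weyl-type bound for the autocorrelated quadratic exponential sum away from the major arcs. -/
theorem norm_sum_sum_expCirc_sq_le_of_minor {N Q : ℕ} (hQ : 1 ≤ Q) (hQN : Q ≤ N) {α : ℝ}
    (hα : ∀ q : ℕ, 1 ≤ q → q ≤ Q → ∀ a : ℤ, IsCoprime a (q : ℤ) →
      (Q : ℝ) / ((N : ℝ) ^ 2 * q) < |α - a / q|) (β : ℝ) :
    ‖∑ a ∈ Finset.Icc (-(N : ℤ)) N, ∑ b ∈ Finset.Icc (-(N : ℤ)) N,
        expCirc (β * (a + b) - α * (a + b) ^ 2)‖ ^ 2 ≤ 23328 * (N : ℝ) ^ 4 / Q := by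
  have hN : 1 ≤ N := hQ.trans hQN
  have hNR : (1 : ℝ) ≤ N := by exact_mod_cast hN
  have hQNR : (Q : ℝ) ≤ N := by exact_mod_cast hQN
  have hn0 : 0 < N ^ 2 / Q := Nat.div_pos (by nlinarith) (by omega)
  obtain ⟨r, hr1, hr2⟩ := Real.exists_rat_abs_sub_le_and_den_le α hn0
  have hden : (0 : ℝ) < r.den := by exact_mod_cast r.den_pos
  have hn1 : (N : ℝ) ^ 2 ≤ Q * ((N ^ 2 / Q : ℕ) + 1 : ℝ) := by
    have := Nat.lt_mul_div_succ (N ^ 2) (show 0 < Q by omega)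
    exact_mod_cast this.le
  have hn2 : (Q : ℝ) * ((N ^ 2 / Q : ℕ) : ℝ) ≤ (N : ℝ) ^ 2 := by
    exact_mod_cast Nat.mul_div_le (N ^ 2) Q
  have hr2R : (r.den : ℝ) ≤ ((N ^ 2 / Q : ℕ) : ℝ) := by exact_mod_cast hr2
  have hcop : IsCoprime r.num (r.den : ℤ) := by
    rw [Int.isCoprime_iff_nat_coprime]; simpa using r.reduced
  have hrr : ((r.num : ℝ) / r.den) = (r : ℝ) := (Rat.cast_def r).symm
  have hlt : Q < r.den := by
    by_contra! hle
    have h1 := hα r.den r.den_pos hle r.num hcop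
    rw [hrr] at h1
    have h2 := h1.trans_le hr1
    rw [div_lt_div_iff₀ (by positivity) (by positivity)] at h2
    nlinarith
  have hltR : (Q : ℝ) < r.den := by exact_mod_cast hlt
  have happ : |α - r.num / (r.den : ℕ)| ≤ 1 / ((r.den : ℕ) : ℝ) ^ 2 := by
    rw [hrr]
    refine hr1.trans ?_
    rw [div_le_div_iff₀ (by positivity) (by positivity)]
    nlinarith
  have hP : (0 : ℝ) < 2 * N + 1 := by positivity
  have hsum := sum_inv_sq_distInt_le r.den_pos hcop happ hP (4 * N)
  have hD : ∀ h : ℤ, ‖∑ c ∈ Finset.Icc (-(N : ℤ)) N, expCirc ((c : ℝ) * (α * h))‖ ^ 2 ≤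
      4 * (2 * N + 1) ^ 2 * (1 / (1 + (2 * N + 1) * distInt (α * h)) ^ 2) := by
    intro h
    have h0 := norm_sum_Icc_exp_mul_le N (α * h)
    have hd : 0 < 1 + (2 * (N : ℝ) + 1) * distInt (α * h) := by
      have := distInt_nonneg (α * h); positivity
    rw [← le_div_iff₀ hd] at h0
    calc _ ≤ (2 * (2 * (N : ℝ) + 1) / (1 + (2 * N + 1) * distInt (α * h))) ^ 2 :=
          pow_le_pow_left₀ (norm_nonneg _) h0 2
      _ = _ := by rw [div_pow]; ring
  have hmain := norm_sum_sum_expCirc_sq_le N α β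
  set X := ‖∑ a ∈ Finset.Icc (-(N : ℤ)) N, ∑ b ∈ Finset.Icc (-(N : ℤ)) N,
        expCirc (β * (a + b) - α * (a + b) ^ 2)‖ ^ 2
  have hfin : (4 * ((4 * N : ℕ) : ℝ) / r.den + 2) * (2 * (1 + 2 * r.den / (2 * N + 1))) ≤
      72 * N / Q := by
    have a1 : 4 * ((4 * N : ℕ) : ℝ) / r.den ≤ 16 * N / Q := by
      push_cast
      rw [div_le_div_iff₀ hden (by positivity)]
      nlinarith
    have a2 : 2 * (r.den : ℝ) / (2 * N + 1) ≤ N / Q := by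
      rw [div_le_div_iff₀ (by positivity) (by positivity)]
      nlinarith
    have a3 : (1 : ℝ) ≤ N / Q := by rw [le_div_iff₀ (by positivity)]; linarith
    have a4 : 4 * ((4 * N : ℕ) : ℝ) / r.den * (2 * r.den / (2 * N + 1)) ≤ 16 := by
      push_cast
      rw [div_mul_div_comm, div_le_iff₀ (by positivity)]
      nlinarith
    have e : (72 * N / Q : ℝ) = 72 * (N / Q) := by ring
    have e' : (16 * N / Q : ℝ) = 16 * (N / Q) := by ring
    rw [e]; rw [e'] at a1
    nlinarith
  have hS : ∑ h ∈ Finset.Icc (-((4 * N : ℕ) : ℤ)) ((4 * N : ℕ) : ℤ),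
        ‖∑ c ∈ Finset.Icc (-(N : ℤ)) N, expCirc ((c : ℝ) * (α * h))‖ ^ 2 ≤
      4 * (2 * N + 1) ^ 2 * (72 * N / Q) := by
    calc _ ≤ ∑ h ∈ Finset.Icc (-((4 * N : ℕ) : ℤ)) ((4 * N : ℕ) : ℤ),
          4 * (2 * (N : ℝ) + 1) ^ 2 * (1 / (1 + (2 * N + 1) * distInt (α * h)) ^ 2) :=
          Finset.sum_le_sum fun h _ => hD h
      _ ≤ _ := by
          rw [← Finset.mul_sum]
          gcongr
          exact hsum.trans hfin
  have h4 : (2 * (N : ℝ) + 1) ^ 4 ≤ 81 * (N : ℝ) ^ 4 := by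
    calc (2 * (N : ℝ) + 1) ^ 4 ≤ (3 * N) ^ 4 := by gcongr; linarith
      _ = _ := by ring
  have : (N : ℝ) * X ≤ N * (23328 * (N : ℝ) ^ 4 / Q) := by
    calc (N : ℝ) * X ≤ _ := hmain
      _ ≤ (2 * N + 1) ^ 2 * (4 * (2 * N + 1) ^ 2 * (72 * N / Q)) := by gcongr
      _ = 288 * (2 * (N : ℝ) + 1) ^ 4 * (N / Q) := by ring
      _ ≤ 288 * (81 * (N : ℝ) ^ 4) * (N / Q) := by gcongr
      _ = _ := by ring
  exact le_of_mul_le_mul_left this (by positivity)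

theorem stdAddChar_intCast_eq_expCirc {R : ℕ} [NeZero R] (j : ℤ) :
    ZMod.stdAddChar (j : ZMod R) = expCirc ((j : ℝ) / R) := by
  rw [ZMod.stdAddChar_coe, expCirc]
  congr 1
  push_cast
  ring

theorem norm_stdAddChar {R : ℕ} [NeZero R] (j : ZMod R) : ‖ZMod.stdAddChar j‖ = 1 := by
  obtain ⟨t, rfl⟩ := ZMod.intCast_surjective j
  rw [stdAddChar_intCast_eq_expCirc, norm_expCirc]

theorem conj_stdAddChar {R : ℕ} [NeZero R] (j : ZMod R) :
    (starRingEnd ℂ) (ZMod.stdAddChar j) = ZMod.stdAddChar (-j) := by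
  obtain ⟨t, rfl⟩ := ZMod.intCast_surjective j
  rw [← Int.cast_neg, stdAddChar_intCast_eq_expCirc, stdAddChar_intCast_eq_expCirc, conj_expCirc]
  congr 1
  push_cast
  ring

theorem sum_stdAddChar_mul {R : ℕ} [NeZero R] (b : ZMod R) :
    ∑ k : ZMod R, ZMod.stdAddChar (k * b) = if b = 0 then (R : ℂ) else 0 := by
  have := AddChar.sum_mulShift (R := ZMod R) (R' := ℂ) b (ZMod.isPrimitive_stdAddChar R)
  rw [this, ZMod.card]
  split_ifs <;> simp

/-- The Fourier coefficients of the indicator function of a subset of `ZMod R`. -/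
noncomputable def indicatorCoeff {R : ℕ} [NeZero R] (M : Finset (ZMod R)) (k : ZMod R) : ℂ :=
  (R : ℂ)⁻¹ * ∑ j ∈ M, ZMod.stdAddChar (-(k * j))

theorem sum_indicatorCoeff_mul {R : ℕ} [NeZero R] (M : Finset (ZMod R)) (j : ZMod R) :
    ∑ k, indicatorCoeff M k * ZMod.stdAddChar (k * j) = if j ∈ M then 1 else 0 := by
  have hR : (R : ℂ) ≠ 0 := NeZero.ne _
  have h : ∀ k, indicatorCoeff M k * ZMod.stdAddChar (k * j) =
      (R : ℂ)⁻¹ * ∑ i ∈ M, ZMod.stdAddChar (k * (j - i)) := by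
    intro k
    rw [indicatorCoeff, mul_assoc, Finset.sum_mul]
    congr 1
    refine Finset.sum_congr rfl fun i _ => ?_
    rw [← AddChar.map_add_eq_mul]
    congr 1
    ring
  simp only [h]
  rw [← Finset.mul_sum, Finset.sum_comm]
  simp only [sum_stdAddChar_mul, sub_eq_zero]
  rw [Finset.sum_ite_eq]
  split_ifs
  · exact inv_mul_cancel₀ hR
  · simp

/-- The half-width of the major arcs around fractions with denominator `q`. -/
def arcWidth (N Q R q : ℕ) : ℕ := R * Q / (N ^ 2 * q)

/-- The parameters `(q, a, i)` of the points `a R / q + i` of the major arcs. -/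
noncomputable def arcIndex (N Q R : ℕ) : Finset (Σ _ : ℕ, ℕ × ℤ) :=
  (Finset.Icc 1 Q).sigma fun q => ((Finset.range q).filter (Nat.Coprime · q)) ×ˢ
    Finset.Icc (-(arcWidth N Q R q : ℤ)) (arcWidth N Q R q)

/-- The point of the major arcs with parameters `(q, a, i)`. -/
def arcPoint (R : ℕ) (x : Σ _ : ℕ, ℕ × ℤ) : ZMod R :=
  ((x.2.1 * (R / x.1 : ℕ) + x.2.2 : ℤ) : ZMod R)

/-- The major arcs in `ZMod R`. -/
noncomputable def majorArcs (N Q R : ℕ) : Finset (ZMod R) := (arcIndex N Q R).image (arcPoint R)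

theorem arcWidth_le {N Q R q : ℕ} : (arcWidth N Q R q : ℝ) ≤ R * Q / ((N : ℝ) ^ 2 * q) := by
  rw [arcWidth]
  exact_mod_cast Nat.cast_div_le (α := ℝ) (m := R * Q) (n := N ^ 2 * q)

theorem lt_abs_sub_of_notMem_majorArcs {N Q R : ℕ} (hN : 1 ≤ N) (hR : 0 < R)
    (hdiv : ∀ q, 1 ≤ q → q ≤ Q → q ∣ R) {t : ℤ} (ht : (t : ZMod R) ∉ majorArcs N Q R)
    {q : ℕ} (hq : 1 ≤ q) (hqQ : q ≤ Q) {a : ℤ} (ha : IsCoprime a (q : ℤ)) :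
    (Q : ℝ) / ((N : ℝ) ^ 2 * q) < |(t : ℝ) / R - a / q| := by
  by_contra! hle
  apply ht
  obtain ⟨r, hr⟩ := hdiv q hq hqQ
  have hR0 : (0 : ℝ) < R := by exact_mod_cast hR
  have hrq : R / q = r := by rw [hr]; exact Nat.mul_div_cancel_left r hq
  have hRr : (R : ℝ) = q * r := by exact_mod_cast hr
  have hb : |(t : ℝ) - a * r| ≤ R * Q / ((N : ℝ) ^ 2 * q) := by
    have : (t : ℝ) - a * r = R * ((t : ℝ) / R - a / q) := by
      rw [mul_sub, mul_div_cancel₀ _ hR0.ne', hRr]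
      field_simp
    rw [this, abs_mul, abs_of_pos hR0, mul_div_assoc]
    gcongr
  have hb' : |t - a * r| ≤ (arcWidth N Q R q : ℤ) := by
    rw [arcWidth, Int.abs_eq_natAbs]
    norm_cast
    rw [Nat.le_div_iff_mul_le (by positivity)]
    rw [le_div_iff₀ (by positivity)] at hb
    have : (((t - a * r).natAbs * (N ^ 2 * q) : ℕ) : ℝ) ≤ ((R * Q : ℕ) : ℝ) := by
      push_cast
      rw [Nat.cast_natAbs]
      push_cast
      exact hb
    exact_mod_cast this
  have hqz : (0 : ℤ) < q := by exact_mod_cast hq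
  refine Finset.mem_image.2 ⟨⟨q, (a % q).toNat, t - a * r⟩, ?_, ?_⟩
  · have h1 := Int.emod_nonneg a hqz.ne'
    have h2 := Int.emod_lt_of_pos a hqz
    simp only [arcIndex, Finset.mem_sigma, Finset.mem_Icc, Finset.mem_product, Finset.mem_filter,
      Finset.mem_range]
    refine ⟨⟨hq, hqQ⟩, ⟨by omega, ?_⟩, abs_le.1 hb'⟩
    rw [← Nat.isCoprime_iff_coprime, Int.toNat_of_nonneg h1]
    have := IsCoprime.add_mul_left_left_iff (x := a % q) (y := (q : ℤ)) (z := a / q)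
    rw [Int.emod_add_mul_ediv] at this
    exact this.1 ha
  · have h1 := Int.emod_nonneg a hqz.ne'
    simp only [arcPoint]
    rw [hrq, Int.toNat_of_nonneg h1]
    have h3 := Int.emod_add_mul_ediv a q
    have : (a % q * r + (t - a * r) : ℤ) = t - (R : ℤ) * (a / q) := by
      have hRz : (R : ℤ) = q * r := by exact_mod_cast hr
      rw [hRz]
      linear_combination (r : ℤ) * h3
    rw [this]
    push_cast
    simp

theorem arcPoint_injOn {N Q R : ℕ} (hNQ : 2 * Q ^ 2 < N ^ 2) (hR : 0 < R)
    (hdiv : ∀ q, 1 ≤ q → q ≤ Q → q ∣ R) : Set.InjOn (arcPoint R) (arcIndex N Q R) := by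
  rintro ⟨q, a, i⟩ hx ⟨q', a', i'⟩ hy hxy
  simp only [arcIndex, Finset.coe_sigma, Finset.coe_product, Set.mem_sigma_iff, Finset.coe_Icc,
    Set.mem_Icc, Set.mem_prod, Finset.coe_filter, Finset.mem_range, Set.mem_ofPred_eq] at hx hy
  obtain ⟨⟨hq1, hqQ⟩, ⟨haq, hac⟩, hi⟩ := hx
  obtain ⟨⟨hq1', hqQ'⟩, ⟨haq', hac'⟩, hi'⟩ := hy
  obtain ⟨r, hr⟩ := hdiv q hq1 hqQ
  obtain ⟨r', hr'⟩ := hdiv q' hq1' hqQ'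
  have hrq : R / q = r := by rw [hr]; exact Nat.mul_div_cancel_left r hq1
  have hrq' : R / q' = r' := by rw [hr']; exact Nat.mul_div_cancel_left r' hq1'
  simp only [arcPoint, hrq, hrq'] at hxy
  rw [ZMod.intCast_eq_intCast_iff_dvd_sub] at hxy
  obtain ⟨m, hm⟩ := hxy
  have hRz : (R : ℤ) = q * r := by exact_mod_cast hr
  have hRz' : (R : ℤ) = q' * r' := by exact_mod_cast hr'
  set z : ℤ := a' * q - a * q' - m * q * q' with hz
  have hRzz : (R : ℤ) * z = (i - i') * (q * q') := by
    have e1 : (q : ℤ) * q' * (a' * r' + i' - (a * r + i)) = q * q' * (R * m) := by rw [hm]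
    have e2 : (q : ℤ) * q' * (a' * r' + i' - (a * r + i)) =
        q * a' * (q' * r') - q' * a * (q * r) + q * q' * (i' - i) := by ring
    rw [e2, ← hRz, ← hRz'] at e1
    rw [hz]
    linear_combination e1
  have hN0 : (0 : ℝ) < (N : ℝ) ^ 2 := by
    have : 0 < N ^ 2 := by omega
    exact_mod_cast this
  have hR0 : (0 : ℝ) < R := by exact_mod_cast hR
  have hz0 : z = 0 := by
    by_contra hne
    have h1 : (1 : ℝ) ≤ |(z : ℝ)| := by exact_mod_cast Int.one_le_abs hne
    have hii : |((i - i' : ℤ) : ℝ)| ≤ R * Q / ((N : ℝ) ^ 2 * q) + R * Q / ((N : ℝ) ^ 2 * q') := by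
      have b1 : |((i - i' : ℤ) : ℝ)| ≤ (arcWidth N Q R q : ℝ) + arcWidth N Q R q' := by
        have : |i - i'| ≤ (arcWidth N Q R q : ℤ) + arcWidth N Q R q' := by
          rw [abs_le]; constructor <;> linarith [hi.1, hi.2, hi'.1, hi'.2]
        exact_mod_cast this
      exact b1.trans (add_le_add arcWidth_le arcWidth_le)
    have h2 : (R : ℝ) * |(z : ℝ)| = |((i - i' : ℤ) : ℝ)| * (q * q') := by
      have : ((R : ℤ) * z : ℝ) = ((i - i' : ℤ) : ℝ) * (q * q') := by exact_mod_cast hRzz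
      have h := congrArg abs this
      rw [abs_mul, abs_mul] at h
      rw [abs_of_pos (show (0 : ℝ) < q * q' by positivity)] at h
      simpa using h
    have h3 : (R : ℝ) ≤ (R * Q / ((N : ℝ) ^ 2 * q) + R * Q / ((N : ℝ) ^ 2 * q')) * (q * q') := by
      calc (R : ℝ) ≤ R * |(z : ℝ)| := le_mul_of_one_le_right hR0.le h1
        _ = _ := h2
        _ ≤ _ := by gcongr
    have h4 : (R * Q / ((N : ℝ) ^ 2 * q) + R * Q / ((N : ℝ) ^ 2 * q')) * (q * q') =
        R * (Q * (q + q') / (N : ℝ) ^ 2) := by field_simp; ring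
    rw [h4] at h3
    have h5 : 1 ≤ Q * (q + q') / (N : ℝ) ^ 2 := by
      by_contra! h
      nlinarith
    rw [le_div_iff₀ hN0] at h5
    have h6 : (q : ℝ) ≤ Q := by exact_mod_cast hqQ
    have h7 : (q' : ℝ) ≤ Q := by exact_mod_cast hqQ'
    have h8 : 2 * (Q : ℝ) ^ 2 < (N : ℝ) ^ 2 := by exact_mod_cast hNQ
    nlinarith
  have hqq : q = q' := by
    apply Nat.dvd_antisymm
    · have : (q : ℤ) ∣ a * q' := ⟨a' - m * q', by linear_combination -hz0 + hz⟩
      have : q ∣ a * q' := by exact_mod_cast this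
      exact hac.symm.dvd_of_dvd_mul_left this
    · have : (q' : ℤ) ∣ a' * q := ⟨a + m * q, by linear_combination hz0 - hz⟩
      have : q' ∣ a' * q := by exact_mod_cast this
      exact hac'.symm.dvd_of_dvd_mul_left this
  subst hqq
  have hqz : (0 : ℤ) < q := by exact_mod_cast hq1
  have haa : (a' : ℤ) - a - m * q = 0 := by
    have : (q : ℤ) * (a' - a - m * q) = 0 := by linear_combination hz0 - hz
    rcases mul_eq_zero.1 this with h | h
    · omega
    · exact h
  have hm0 : m = 0 := by
    have h1 : |m * q| < 1 * (q : ℤ) := by rw [abs_lt]; constructor <;> omega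
    rw [abs_mul, abs_of_pos hqz] at h1
    have := lt_of_mul_lt_mul_right h1 hqz.le
    exact Int.abs_lt_one_iff.1 this
  have hae : a = a' := by rw [hm0] at haa; omega
  subst hae
  have hie : i = i' := by
    rw [hz0, mul_zero] at hRzz
    have := (mul_eq_zero.1 hRzz.symm).resolve_right (by positivity)
    omega
  rw [hie]

theorem distInt_eq_abs {x : ℝ} (hx : |x| ≤ 1 / 2) : distInt x = |x| := by
  refine le_antisymm ?_ ?_
  · have := round_le x 0
    simpa [distInt] using this
  · rw [distInt]
    by_cases h : round x = 0
    · simp [h]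
    · have h1 : (1 : ℝ) ≤ |((round x : ℤ) : ℝ)| := by exact_mod_cast Int.one_le_abs h
      have h2 := abs_sub_abs_le_abs_sub ((round x : ℤ) : ℝ) x
      rw [abs_sub_comm] at h2
      linarith

theorem sum_majorArcs_eq {N Q R : ℕ} (hNQ : 2 * Q ^ 2 < N ^ 2) (hR : 0 < R)
    (hdiv : ∀ q, 1 ≤ q → q ≤ Q → q ∣ R) (f : ZMod R → ℂ) :
    ∑ j ∈ majorArcs N Q R, f j = ∑ q ∈ Finset.Icc 1 Q,
      ∑ a ∈ (Finset.range q).filter (Nat.Coprime · q),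
      ∑ i ∈ Finset.Icc (-(arcWidth N Q R q : ℤ)) (arcWidth N Q R q),
        f ((a * (R / q : ℕ) + i : ℤ) : ZMod R) := by
  rw [majorArcs, Finset.sum_image (arcPoint_injOn hNQ hR hdiv), arcIndex, Finset.sum_sigma]
  refine Finset.sum_congr rfl fun q _ => ?_
  rw [Finset.sum_product]
  rfl

theorem norm_indicatorCoeff_majorArcs_le_sum {N Q R : ℕ} [NeZero R] (hNQ : 2 * Q ^ 2 < N ^ 2)
    (hdiv : ∀ q, 1 ≤ q → q ≤ Q → q ∣ R) (k : ℤ) :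
    ‖indicatorCoeff (majorArcs N Q R) (k : ZMod R)‖ ≤ ∑ q ∈ Finset.Icc 1 Q,
      (∑ d ∈ q.divisors.filter (fun d : ℕ => (d : ℤ) ∣ k), (d : ℝ)) *
      ((R : ℝ)⁻¹ * ‖∑ i ∈ Finset.Icc (-(arcWidth N Q R q : ℤ)) (arcWidth N Q R q),
        expCirc ((i : ℝ) * (k / R))‖) := by
  have hR : 0 < R := NeZero.pos R
  have hR0 : (R : ℝ) ≠ 0 := by exact_mod_cast hR.ne'
  rw [indicatorCoeff, sum_majorArcs_eq hNQ hR hdiv, norm_mul, norm_inv, Complex.norm_natCast]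
  calc _ ≤ (R : ℝ)⁻¹ * ∑ q ∈ Finset.Icc 1 Q,
      (∑ d ∈ q.divisors.filter (fun d : ℕ => (d : ℤ) ∣ k), (d : ℝ)) *
      ‖∑ i ∈ Finset.Icc (-(arcWidth N Q R q : ℤ)) (arcWidth N Q R q),
        expCirc ((i : ℝ) * (k / R))‖ := ?_
    _ = _ := by
      rw [Finset.mul_sum]
      refine Finset.sum_congr rfl fun q _ => ?_
      ring
  gcongr
  refine (norm_sum_le _ _).trans (Finset.sum_le_sum fun q hq => ?_)
  obtain ⟨hq1, hqQ⟩ := Finset.mem_Icc.1 hq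
  obtain ⟨r, hr⟩ := hdiv q hq1 hqQ
  have hrq : R / q = r := by rw [hr]; exact Nat.mul_div_cancel_left r hq1
  have hRr : (R : ℝ) = q * r := by exact_mod_cast hr
  have hr0 : (r : ℝ) ≠ 0 := by
    intro h; rw [h, mul_zero] at hRr; exact hR0 hRr
  have hfac : ∑ a ∈ (Finset.range q).filter (Nat.Coprime · q),
      ∑ i ∈ Finset.Icc (-(arcWidth N Q R q : ℤ)) (arcWidth N Q R q),
        ZMod.stdAddChar (-((k : ZMod R) * ((a * (R / q : ℕ) + i : ℤ) : ZMod R))) =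
      (starRingEnd ℂ) ((∑ a ∈ (Finset.range q).filter (Nat.Coprime · q),
        Complex.exp (2 * π * Complex.I * (k * a / q : ℝ))) *
        ∑ i ∈ Finset.Icc (-(arcWidth N Q R q : ℤ)) (arcWidth N Q R q),
        expCirc ((i : ℝ) * (k / R))) := by
    rw [Finset.sum_mul_sum, map_sum]
    refine Finset.sum_congr rfl fun a _ => ?_
    rw [map_sum]
    refine Finset.sum_congr rfl fun i _ => ?_
    have : Complex.exp (2 * π * Complex.I * (k * a / q : ℝ)) = expCirc (k * a / q) := rfl
    rw [this, ← expCirc_add, conj_expCirc, ← Int.cast_mul, ← Int.cast_neg,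
      stdAddChar_intCast_eq_expCirc, hrq]
    congr 1
    push_cast
    rw [hRr]
    field_simp
  rw [hfac, RCLike.norm_conj, norm_mul]
  exact mul_le_mul_of_nonneg_right (norm_sum_coprime_pow_le q hq1 k) (norm_nonneg _)

theorem arcWidth_sum_le {N Q R q : ℕ} (hN : 1 ≤ N) (hq : 1 ≤ q) (hqQ : q ≤ Q) (hR : N ^ 2 ≤ R) :
    (2 * (arcWidth N Q R q : ℝ) + 1) / R ≤ Q / q * (3 / (N : ℝ) ^ 2) := by
  have h1 : (arcWidth N Q R q : ℝ) ≤ R * Q / ((N : ℝ) ^ 2 * q) := arcWidth_le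
  have hN0 : (0 : ℝ) < (N : ℝ) ^ 2 := by positivity
  have hRN : (N : ℝ) ^ 2 ≤ R := by exact_mod_cast hR
  have h2 : 1 ≤ R * Q / ((N : ℝ) ^ 2 * q) := by
    rw [le_div_iff₀ (by positivity), one_mul]
    gcongr
  rw [div_le_iff₀ (by linarith)]
  calc _ ≤ 3 * (R * Q / ((N : ℝ) ^ 2 * q)) := by linarith
    _ = _ := by field_simp

theorem norm_sum_arc_le {N Q R q : ℕ} (hN : 1 ≤ N) (hq : 1 ≤ q) (hqQ : q ≤ Q) (hR : N ^ 2 ≤ R)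
    {k : ℤ} (hk : 2 * |(k : ℝ)| ≤ R) :
    (R : ℝ)⁻¹ * ‖∑ i ∈ Finset.Icc (-(arcWidth N Q R q : ℤ)) (arcWidth N Q R q),
        expCirc ((i : ℝ) * (k / R))‖ ≤
      2 * Q * (3 / (N : ℝ) ^ 2) / (1 + 3 / (N : ℝ) ^ 2 * |(k : ℝ)|) * (q : ℝ)⁻¹ := by
  have hq0 : (0 : ℝ) < q := by exact_mod_cast hq
  have hN0 : (0 : ℝ) < (N : ℝ) ^ 2 := by positivity
  have hRN : (N : ℝ) ^ 2 ≤ R := by exact_mod_cast hR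
  have hqQR : (q : ℝ) ≤ Q := by exact_mod_cast hqQ
  have hR0 : (0 : ℝ) < R := by linarith
  have h1 := norm_sum_Icc_exp_mul_le (arcWidth N Q R q) ((k : ℝ) / R)
  have hd : distInt ((k : ℝ) / R) = |(k : ℝ)| / R := by
    rw [distInt_eq_abs, abs_div, abs_of_pos hR0]
    rw [abs_div, abs_of_pos hR0, div_le_div_iff₀ hR0 (by norm_num)]
    linarith
  rw [hd] at h1
  set X := ‖∑ i ∈ Finset.Icc (-(arcWidth N Q R q : ℤ)) (arcWidth N Q R q),
        expCirc ((i : ℝ) * (k / R))‖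
  set W : ℝ := 2 * (arcWidth N Q R q : ℝ) + 1
  have hW := arcWidth_sum_le hN hq hqQ hR
  have hX : X * (1 + W * (|(k : ℝ)| / R)) ≤ 2 * W := h1
  set w : ℝ := 3 / (N : ℝ) ^ 2
  have hw : 0 < w := by positivity
  have hX' : (R : ℝ)⁻¹ * X * (1 + W / R * |(k : ℝ)|) ≤ 2 * (W / R) := by
    calc _ = (R : ℝ)⁻¹ * (X * (1 + W * (|(k : ℝ)| / R))) := by field_simp
      _ ≤ (R : ℝ)⁻¹ * (2 * W) := by gcongr
      _ = _ := by field_simp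
  set Y := (R : ℝ)⁻¹ * X
  set u := W / (R : ℝ)
  have hu : 0 < u := by positivity
  set K := |(k : ℝ)|
  have hK : 0 ≤ K := abs_nonneg _
  have hQq : 1 ≤ (Q : ℝ) / q := by rw [le_div_iff₀ hq0]; linarith
  have e : 2 * Q * w / (1 + w * K) * (q : ℝ)⁻¹ = 2 * (Q / q * w) / (1 + w * K) := by
    field_simp
  rw [e, le_div_iff₀ (by positivity)]
  have h3 : Y ≤ 2 * u / (1 + u * K) := by rw [le_div_iff₀ (by positivity)]; exact hX'
  refine (mul_le_mul_of_nonneg_right h3 (by positivity)).trans ?_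
  rw [div_mul_eq_mul_div, div_le_iff₀ (by positivity)]
  nlinarith [mul_nonneg hK hw.le, mul_nonneg hK hu.le, mul_nonneg (mul_nonneg hK hw.le) hu.le]

theorem sum_sum_divisors_le (Q : ℕ) (k : ℤ) :
    ∑ q ∈ Finset.Icc 1 Q, (∑ d ∈ q.divisors.filter (fun d : ℕ => (d : ℤ) ∣ k), (d : ℝ)) * (q : ℝ)⁻¹
      ≤ #((Finset.Icc 1 Q).filter fun d : ℕ => (d : ℤ) ∣ k) * ∑ e ∈ Finset.Icc 1 Q, (e : ℝ)⁻¹ := by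
  rw [← nsmul_eq_mul, ← Finset.sum_const]
  calc _ = ∑ q ∈ Finset.Icc 1 Q, ∑ d ∈ (Finset.Icc 1 Q).filter (fun d : ℕ => (d : ℤ) ∣ k),
        if d ∣ q then (d : ℝ) * (q : ℝ)⁻¹ else 0 := by
        refine Finset.sum_congr rfl fun q hq => ?_
        rw [Finset.sum_mul, ← Finset.sum_filter]
        refine Finset.sum_congr ?_ fun _ _ => rfl
        ext d
        simp only [Finset.mem_filter, Nat.mem_divisors, Finset.mem_Icc] at hq ⊢
        constructor
        · rintro ⟨⟨h1, h2⟩, h3⟩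
          exact ⟨⟨⟨Nat.pos_of_dvd_of_pos h1 hq.1, (Nat.le_of_dvd hq.1 h1).trans hq.2⟩, h3⟩, h1⟩
        · rintro ⟨⟨_, h3⟩, h1⟩
          exact ⟨⟨h1, by omega⟩, h3⟩
    _ = ∑ d ∈ (Finset.Icc 1 Q).filter (fun d : ℕ => (d : ℤ) ∣ k), ∑ q ∈ Finset.Icc 1 Q with d ∣ q,
        (d : ℝ) * (q : ℝ)⁻¹ := by
        rw [Finset.sum_comm]
        simp only [Finset.sum_filter]
    _ ≤ _ := by
        refine Finset.sum_le_sum fun d hd => ?_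
        have hd1 : 1 ≤ d := (Finset.mem_Icc.1 (Finset.mem_filter.1 hd).1).1
        have hd0 : (d : ℝ) ≠ 0 := by exact_mod_cast (show d ≠ 0 by omega)
        calc _ = ∑ q ∈ Finset.Icc 1 Q with d ∣ q, ((q / d : ℕ) : ℝ)⁻¹ := by
              refine Finset.sum_congr rfl fun q hq => ?_
              rw [Nat.cast_div (Finset.mem_filter.1 hq).2 hd0, inv_div, div_eq_mul_inv]
          _ = ∑ e ∈ ((Finset.Icc 1 Q).filter (d ∣ ·)).image (fun q => q / d), (e : ℝ)⁻¹ := by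
              rw [Finset.sum_image]
              intro x hx y hy hxy
              have h1 : d ∣ x := (Finset.mem_filter.1 hx).2
              have h2 : d ∣ y := (Finset.mem_filter.1 hy).2
              rw [← Nat.mul_div_cancel' h1, ← Nat.mul_div_cancel' h2]
              exact congrArg _ hxy
          _ ≤ _ := by
              refine Finset.sum_le_sum_of_subset_of_nonneg ?_ fun _ _ _ => by positivity
              intro e he
              obtain ⟨q, hq, rfl⟩ := Finset.mem_image.1 he
              obtain ⟨hq, hdq⟩ := Finset.mem_filter.1 hq
              rw [Finset.mem_Icc] at hq ⊢
              exact ⟨Nat.div_pos (Nat.le_of_dvd hq.1 hdq) hd1, (Nat.div_le_self _ _).trans hq.2⟩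

theorem norm_indicatorCoeff_majorArcs_le {N Q R : ℕ} [NeZero R] (hN : 1 ≤ N)
    (hNQ : 2 * Q ^ 2 < N ^ 2) (hdiv : ∀ q, 1 ≤ q → q ≤ Q → q ∣ R) (hR : N ^ 2 ≤ R)
    {k : ℤ} (hk : 2 * |(k : ℝ)| ≤ R) :
    ‖indicatorCoeff (majorArcs N Q R) (k : ZMod R)‖ ≤
      2 * Q * (3 / (N : ℝ) ^ 2) * (∑ e ∈ Finset.Icc 1 Q, (e : ℝ)⁻¹) *
        #((Finset.Icc 1 Q).filter fun d : ℕ => (d : ℤ) ∣ k) / (1 + 3 / (N : ℝ) ^ 2 * |(k : ℝ)|) := by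
  refine (norm_indicatorCoeff_majorArcs_le_sum hNQ hdiv k).trans ?_
  calc _ ≤ ∑ q ∈ Finset.Icc 1 Q,
        (∑ d ∈ q.divisors.filter (fun d : ℕ => (d : ℤ) ∣ k), (d : ℝ)) *
        (2 * Q * (3 / (N : ℝ) ^ 2) / (1 + 3 / (N : ℝ) ^ 2 * |(k : ℝ)|) * (q : ℝ)⁻¹) := by
        refine Finset.sum_le_sum fun q hq => ?_
        obtain ⟨hq1, hqQ⟩ := Finset.mem_Icc.1 hq
        exact mul_le_mul_of_nonneg_left (norm_sum_arc_le hN hq1 hqQ hR hk) (by positivity)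
    _ = 2 * Q * (3 / (N : ℝ) ^ 2) / (1 + 3 / (N : ℝ) ^ 2 * |(k : ℝ)|) * ∑ q ∈ Finset.Icc 1 Q,
        (∑ d ∈ q.divisors.filter (fun d : ℕ => (d : ℤ) ∣ k), (d : ℝ)) * (q : ℝ)⁻¹ := by
        rw [Finset.mul_sum]
        refine Finset.sum_congr rfl fun q _ => ?_
        ring
    _ ≤ _ := mul_le_mul_of_nonneg_left (sum_sum_divisors_le Q k) (by positivity)
    _ = _ := by ring

theorem norm_indicatorCoeff_majorArcs_zero_le {N Q R : ℕ} [NeZero R] (hN : 1 ≤ N)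
    (hNQ : 12 * Q ^ 2 ≤ N ^ 2) (hR : N ^ 2 ≤ R) :
    ‖indicatorCoeff (majorArcs N Q R) 0‖ ≤ 1 / 4 := by
  have hR0 : (0 : ℝ) < R := by exact_mod_cast NeZero.pos R
  have hN0 : (0 : ℝ) < (N : ℝ) ^ 2 := by positivity
  rw [indicatorCoeff, norm_mul, norm_inv, Complex.norm_natCast, inv_mul_le_iff₀ hR0]
  have h1 : ‖∑ j ∈ majorArcs N Q R, ZMod.stdAddChar (-((0 : ZMod R) * j))‖ ≤
      (majorArcs N Q R).card := by
    simp
  have h2 : ((majorArcs N Q R).card : ℝ) ≤ ((arcIndex N Q R).card : ℝ) := by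
    exact_mod_cast Finset.card_image_le
  have h3 : ((arcIndex N Q R).card : ℝ) ≤ ∑ q ∈ Finset.Icc 1 Q, R * (Q * (3 / (N : ℝ) ^ 2)) := by
    rw [arcIndex, Finset.card_sigma]
    push_cast
    refine Finset.sum_le_sum fun q hq => ?_
    obtain ⟨hq1, hqQ⟩ := Finset.mem_Icc.1 hq
    have hW := arcWidth_sum_le hN hq1 hqQ hR
    rw [div_le_iff₀ hR0] at hW
    rw [Finset.card_product, Int.card_Icc,
      show ((arcWidth N Q R q : ℤ) + 1 - -(arcWidth N Q R q : ℤ)).toNat =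
        2 * arcWidth N Q R q + 1 by omega]
    have h4 : (((Finset.range q).filter (Nat.Coprime · q)).card : ℝ) ≤ q := by
      have := Finset.card_filter_le (Finset.range q) (Nat.Coprime · q)
      rw [Finset.card_range] at this
      exact_mod_cast this
    push_cast
    calc _ ≤ (q : ℝ) * (Q / q * (3 / (N : ℝ) ^ 2) * R) := by gcongr
      _ = _ := by field_simp
  rw [Finset.sum_const, nsmul_eq_mul, Nat.card_Icc] at h3
  have h5 : 12 * (Q : ℝ) ^ 2 ≤ (N : ℝ) ^ 2 := by exact_mod_cast hNQ
  refine (h1.trans (h2.trans h3)).trans ?_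
  push_cast [Nat.add_sub_cancel]
  calc _ = (R : ℝ) * (3 * Q ^ 2 / (N : ℝ) ^ 2) := by ring
    _ ≤ _ := by
      refine mul_le_mul_of_nonneg_left ?_ hR0.le
      rw [div_le_div_iff₀ hN0 (by norm_num)]
      linarith

theorem sum_natAbs_valMinAbs_le {R : ℕ} [NeZero R] {g : ℕ → ℝ} (hg : ∀ m, 0 ≤ g m) :
    ∑ k ∈ (Finset.univ : Finset (ZMod R)).filter (· ≠ 0), g k.valMinAbs.natAbs ≤
      2 * ∑ m ∈ Finset.Icc 1 R, g m := by
  rw [← Finset.sum_fiberwise_of_maps_to (s := (Finset.univ : Finset (ZMod R)).filter (· ≠ 0))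
    (t := Finset.Icc 1 R) (g := fun k => k.valMinAbs.natAbs), Finset.mul_sum]
  · refine Finset.sum_le_sum fun m _ => ?_
    rw [Finset.sum_congr rfl (g := fun _ => g m) (fun k hk => by rw [(Finset.mem_filter.1 hk).2]),
      Finset.sum_const, nsmul_eq_mul]
    refine mul_le_mul_of_nonneg_right ?_ (hg m)
    have hsub : ({k ∈ (Finset.univ : Finset (ZMod R)).filter (· ≠ 0) | k.valMinAbs.natAbs = m} :
        Finset (ZMod R)) ⊆ {(m : ZMod R), (-m : ZMod R)} := by
      intro k hk
      have h := (Finset.mem_filter.1 hk).2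
      rw [Finset.mem_insert, Finset.mem_singleton, ← ZMod.coe_valMinAbs k, ← h]
      rcases Int.natAbs_eq k.valMinAbs with h' | h'
      · left; simpa using congrArg (Int.cast : ℤ → ZMod R) h'
      · right; simpa using congrArg (Int.cast : ℤ → ZMod R) h'
    exact_mod_cast (Finset.card_le_card hsub).trans Finset.card_le_two
  · intro k hk
    rw [Finset.mem_Icc]
    constructor
    · have : k.valMinAbs ≠ 0 := by
        rw [Ne, ZMod.valMinAbs_eq_zero]; exact (Finset.mem_filter.1 hk).2
      exact Nat.pos_of_ne_zero (Int.natAbs_ne_zero.2 this)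
    · exact (ZMod.natAbs_valMinAbs_le k).trans (Nat.div_le_self _ _)

theorem sum_card_divisors_div_sq_le {w : ℝ} (hw : 0 < w) (R T : ℕ) :
    ∑ m ∈ Finset.Icc 1 R, (#{L ∈ Finset.Icc 1 T | L ∣ m} : ℝ) * (1 / (1 + w * m) ^ 2) ≤
      w⁻¹ * ∑ L ∈ Finset.Icc 1 T, (L : ℝ)⁻¹ := by
  calc _ = ∑ L ∈ Finset.Icc 1 T, ∑ m ∈ Finset.Icc 1 R with L ∣ m, 1 / (1 + w * (m : ℝ)) ^ 2 := by
        simp only [← nsmul_eq_mul, ← Finset.sum_const]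
        simp only [Finset.sum_filter]
        rw [Finset.sum_comm]
    _ ≤ _ := by
        rw [Finset.mul_sum]
        refine Finset.sum_le_sum fun L hL => ?_
        have hL1 : 1 ≤ L := (Finset.mem_Icc.1 hL).1
        have := sum_range_inv_sq_le (c := w * L) (by positivity) R
        rw [one_div, mul_inv] at this
        refine le_trans ?_ this
        calc _ = ∑ m ∈ Finset.Icc 1 R with L ∣ m,
              1 / (1 + w * L * (((m / L - 1 : ℕ) : ℝ) + 1)) ^ 2 := by
              refine Finset.sum_congr rfl fun m hm => ?_
              obtain ⟨hm, v, rfl⟩ := Finset.mem_filter.1 hm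
              have hv : 1 ≤ v := by
                rcases Nat.eq_zero_or_pos v with h | h
                · simp [h] at hm
                · exact h
              rw [Nat.mul_div_cancel_left v hL1]
              push_cast [hv]
              rw [sub_add_cancel, mul_assoc]
          _ = ∑ v ∈ ((Finset.Icc 1 R).filter (L ∣ ·)).image (fun m => m / L - 1),
              1 / (1 + w * L * ((v : ℝ) + 1)) ^ 2 := by
              rw [Finset.sum_image]
              intro x hx y hy hxy
              obtain ⟨hx, v, rfl⟩ := Finset.mem_filter.1 hx
              obtain ⟨hy, u, rfl⟩ := Finset.mem_filter.1 hy
              have hv : 1 ≤ v := Nat.pos_of_ne_zero (by rintro rfl; simp at hx)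
              have hu : 1 ≤ u := Nat.pos_of_ne_zero (by rintro rfl; simp at hy)
              simp only [Nat.mul_div_cancel_left _ hL1] at hxy
              rw [show v = u by omega]
          _ ≤ _ := by
              refine Finset.sum_le_sum_of_subset_of_nonneg ?_ fun _ _ _ => by positivity
              intro v hv
              obtain ⟨m, hm, rfl⟩ := Finset.mem_image.1 hv
              obtain ⟨hm, _⟩ := Finset.mem_filter.1 hm
              rw [Finset.mem_Icc] at hm
              rw [Finset.mem_range]
              have := Nat.div_le_self m L
              omega

theorem exists_sum_norm_indicatorCoeff_pow_le {B : ℕ} (hB : 2 ≤ B) :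
    ∃ C : ℝ, 1 ≤ C ∧ ∀ N Q R : ℕ, 1 ≤ Q → 12 * Q ^ 2 ≤ N ^ 2 → N ^ 2 ≤ R →
      (∀ q, 1 ≤ q → q ≤ Q → q ∣ R) → ∀ [NeZero R],
      ∑ k ∈ (Finset.univ : Finset (ZMod R)).filter (· ≠ 0),
        ‖indicatorCoeff (majorArcs N Q R) k‖ ^ B ≤
        C * (Q : ℝ) ^ (B + 3) * (3 / (N : ℝ) ^ 2) ^ (B - 1) := by
  obtain ⟨C, hC1, hC⟩ := exists_card_divisors_pow_le B (by omega)
  refine ⟨2 * C * 2 ^ B * (1 + B) ^ (B + 1), ?_, ?_⟩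
  · have h2 : (1 : ℝ) ≤ 2 ^ B := one_le_pow₀ (by norm_num)
    have h3 : (1 : ℝ) ≤ (1 + B) ^ (B + 1) := one_le_pow₀ (by simp)
    nlinarith [mul_le_mul hC1 h2 zero_le_one (by positivity), mul_nonneg (by positivity : 0 ≤ C) (by positivity : (0:ℝ) ≤ 2 ^ B)]
  intro N Q R hQ hNQ hR hdiv _
  have hN : 1 ≤ N := by
    rcases Nat.eq_zero_or_pos N with h | h
    · subst h; nlinarith
    · exact h
  have hNQ' : 2 * Q ^ 2 < N ^ 2 := by nlinarith
  have hBR : (0 : ℝ) < B := by exact_mod_cast (show 0 < B by omega)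
  set w : ℝ := 3 / (N : ℝ) ^ 2 with hw
  have hw0 : 0 < w := by positivity
  set H : ℝ := ∑ e ∈ Finset.Icc 1 Q, (e : ℝ)⁻¹ with hH
  have hH0 : 0 ≤ H := by positivity
  have hHB : H ^ B ≤ (1 + B) ^ B * Q := by
    have h := sum_inv_le_rpow B (by omega) Q hQ
    calc H ^ B ≤ ((1 + B) * (Q : ℝ) ^ (1 / (B : ℝ))) ^ B := pow_le_pow_left₀ hH0 h B
      _ = _ := by
        rw [mul_pow, ← Real.rpow_natCast ((Q : ℝ) ^ (1 / (B : ℝ))), ← Real.rpow_mul (by positivity),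
          one_div, inv_mul_cancel₀ hBR.ne', Real.rpow_one]
  have hHT : ∑ L ∈ Finset.Icc 1 (Q ^ B), (L : ℝ)⁻¹ ≤ (1 + B) * Q := by
    have h := sum_inv_le_rpow B (by omega) (Q ^ B) (Nat.one_le_pow _ _ hQ)
    refine h.trans_eq ?_
    push_cast
    rw [← Real.rpow_natCast, ← Real.rpow_mul (by positivity), mul_one_div_cancel hBR.ne',
      Real.rpow_one]
  set g : ℕ → ℝ := fun m => (2 * Q * w * H) ^ B * (C * Q) *
    (#{L ∈ Finset.Icc 1 (Q ^ B) | L ∣ m} * (1 / (1 + w * m) ^ 2)) with hg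
  have hpt : ∀ k ∈ (Finset.univ : Finset (ZMod R)).filter (· ≠ 0),
      ‖indicatorCoeff (majorArcs N Q R) k‖ ^ B ≤ g k.valMinAbs.natAbs := by
    intro k hk
    set κ := k.valMinAbs with hκ
    have hκ0 : κ ≠ 0 := by
      rw [Ne, ZMod.valMinAbs_eq_zero]; exact (Finset.mem_filter.1 hk).2
    have hκR : 2 * |(κ : ℝ)| ≤ R := by
      have h1 := ZMod.natAbs_valMinAbs_le k
      have h2 : 2 * κ.natAbs ≤ R := by omega
      have h3 : ((2 * κ.natAbs : ℕ) : ℝ) ≤ R := by exact_mod_cast h2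
      push_cast [Nat.cast_natAbs] at h3
      exact h3
    have hb := norm_indicatorCoeff_majorArcs_le hN hNQ' hdiv hR hκR
    rw [hκ, ZMod.coe_valMinAbs, ← hκ] at hb
    have hcast : |(κ : ℝ)| = (κ.natAbs : ℝ) := by rw [Nat.cast_natAbs]; push_cast; rfl
    have hdv : ((Finset.Icc 1 Q).filter fun d : ℕ => (d : ℤ) ∣ κ) =
        (Finset.Icc 1 Q).filter fun d => d ∣ κ.natAbs :=
      Finset.filter_congr fun d _ => Int.natCast_dvd
    rw [hdv, hcast] at hb
    have hD := hC Q hQ κ.natAbs (Int.natAbs_ne_zero.2 hκ0)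
    set m := κ.natAbs
    have hm1 : 1 ≤ 1 + w * (m : ℝ) := by
      have : 0 ≤ w * (m : ℝ) := by positivity
      linarith
    calc _ ≤ (2 * Q * w * H * #{d ∈ Finset.Icc 1 Q | d ∣ m} / (1 + w * m)) ^ B :=
          pow_le_pow_left₀ (norm_nonneg _) hb B
      _ = (2 * Q * w * H) ^ B * (#{d ∈ Finset.Icc 1 Q | d ∣ m} : ℝ) ^ B *
          (1 / (1 + w * m) ^ B) := by rw [div_pow, mul_pow]; ring
      _ ≤ (2 * Q * w * H) ^ B * (C * Q * #{L ∈ Finset.Icc 1 (Q ^ B) | L ∣ m}) *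
          (1 / (1 + w * m) ^ 2) := by
          gcongr
      _ = _ := by rw [hg]; ring
  calc _ ≤ _ := Finset.sum_le_sum hpt
    _ ≤ 2 * ∑ m ∈ Finset.Icc 1 R, g m := sum_natAbs_valMinAbs_le fun m => by positivity
    _ = 2 * ((2 * Q * w * H) ^ B * (C * Q) * ∑ m ∈ Finset.Icc 1 R,
        (#{L ∈ Finset.Icc 1 (Q ^ B) | L ∣ m} : ℝ) * (1 / (1 + w * m) ^ 2)) := by
        rw [hg, ← Finset.mul_sum]
    _ ≤ 2 * ((2 * Q * w * H) ^ B * (C * Q) * (w⁻¹ * ((1 + B) * Q))) := by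
        gcongr
        exact (sum_card_divisors_div_sq_le hw0 R (Q ^ B)).trans (by gcongr)
    _ = 2 * ((2 * Q) ^ B * H ^ B * (C * Q) * ((1 + B) * Q) * (w ^ B * w⁻¹)) := by
        rw [mul_pow, mul_pow _ w]; ring
    _ ≤ 2 * ((2 * Q) ^ B * ((1 + B) ^ B * Q) * (C * Q) * ((1 + B) * Q) * (w ^ B * w⁻¹)) := by
        gcongr
    _ = _ := by
        have : w ^ B * w⁻¹ = w ^ (B - 1) := by
          rw [← pow_sub_one_mul (show B ≠ 0 by omega) w, mul_assoc, mul_inv_cancel₀ hw0.ne', mul_one]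
        rw [this, mul_pow]
        ring

/-- The major arcs carry all the points where the autocorrelated quadratic exponential sums are
large, and their indicator function has Fourier coefficients which are uniformly small up to an
error that is negligible in `ℓ¹`. -/
theorem exists_majorArcs_decomposition {s ε : ℝ} (hε : 0 < ε) :
    ∃ C : ℝ, 1 ≤ C ∧ ∀ N Q R : ℕ, 1 ≤ Q → 12 * Q ^ 2 ≤ N ^ 2 → N ^ 2 ≤ R →
      (∀ q, 1 ≤ q → q ≤ Q → q ∣ R) → ∀ [NeZero R],
      ∃ (M : Finset (ZMod R)) (ν : ZMod R → ℝ),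
        (∀ j ∉ M, ∀ m : ZMod R,
          ‖∑ a ∈ Finset.Icc (-(N : ℤ)) N, ∑ b ∈ Finset.Icc (-(N : ℤ)) N,
            ZMod.stdAddChar (m * ((a + b : ℤ) : ZMod R) - j * ((a + b : ℤ) : ZMod R) ^ 2)‖ ^ 2 ≤
          23328 * (N : ℝ) ^ 4 / Q) ∧
        ‖indicatorCoeff M 0‖ ≤ 1 / 4 ∧
        (∀ k ≠ 0, ‖indicatorCoeff M k‖ ≤ 3 * (Q : ℝ) ^ (1 + ε) / (N : ℝ) ^ 2 + ν k) ∧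
        (∀ k, 0 ≤ ν k) ∧ ∑ k, ν k ≤ C * (Q : ℝ) ^ (-s) := by
  obtain ⟨B', hB'⟩ := exists_nat_ge ((4 + s) / ε)
  set B := B' + 2 with hBdef
  obtain ⟨C, hC1, hC⟩ := exists_sum_norm_indicatorCoeff_pow_le (B := B) (by omega)
  refine ⟨C, hC1, fun N Q R hQ hNQ hR hdiv _ => ?_⟩
  have hN : 1 ≤ N := by
    rcases Nat.eq_zero_or_pos N with h | h
    · subst h; nlinarith
    · exact h
  have hQR : (1 : ℝ) ≤ Q := by exact_mod_cast hQ
  set M := majorArcs N Q R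
  set A : ℝ := 3 * (Q : ℝ) ^ (1 + ε) / (N : ℝ) ^ 2 with hA
  have hA0 : 0 < A := by positivity
  refine ⟨M, fun k => if k ≠ 0 then ‖indicatorCoeff M k‖ ^ B / A ^ (B - 1) else 0, ?_, ?_, ?_, ?_, ?_⟩
  · intro j hj m
    obtain ⟨t, rfl⟩ := ZMod.intCast_surjective j
    obtain ⟨y, rfl⟩ := ZMod.intCast_surjective m
    have h := norm_sum_sum_expCirc_sq_le_of_minor hQ (by nlinarith)
      (fun q hq hqQ a ha => lt_abs_sub_of_notMem_majorArcs hN (NeZero.pos R) hdiv hj hq hqQ ha)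
      ((y : ℝ) / R)
    convert h using 6 with a _ b _
    rw [← Int.cast_pow, ← Int.cast_mul, ← Int.cast_mul, ← Int.cast_sub,
      stdAddChar_intCast_eq_expCirc]
    congr 1
    push_cast
    ring
  · exact norm_indicatorCoeff_majorArcs_zero_le hN hNQ hR
  · intro k hk
    simp only [if_pos hk]
    rcases le_or_gt ‖indicatorCoeff M k‖ A with h | h
    · have : 0 ≤ ‖indicatorCoeff M k‖ ^ B / A ^ (B - 1) := by positivity
      linarith
    · have : ‖indicatorCoeff M k‖ ≤ ‖indicatorCoeff M k‖ ^ B / A ^ (B - 1) := by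
        rw [le_div_iff₀ (by positivity)]
        calc _ ≤ ‖indicatorCoeff M k‖ * ‖indicatorCoeff M k‖ ^ (B - 1) := by gcongr
          _ = _ := by rw [← pow_succ', Nat.sub_add_cancel (by omega)]
      linarith
  · intro k
    dsimp only
    split_ifs <;> positivity
  · rw [← Finset.sum_filter, ← Finset.sum_div]
    refine (div_le_div_of_nonneg_right (hC N Q R hQ hNQ hR hdiv) (by positivity)).trans ?_
    have hAe : A = (Q : ℝ) ^ (1 + ε) * (3 / (N : ℝ) ^ 2) := by rw [hA]; ring
    rw [hAe, mul_pow, mul_div_mul_right _ _ (by positivity), mul_div_assoc]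
    refine mul_le_mul_of_nonneg_left ?_ (by linarith)
    rw [← Real.rpow_natCast, ← Real.rpow_natCast, ← Real.rpow_mul (by positivity),
      ← Real.rpow_sub (by positivity)]
    refine Real.rpow_le_rpow_of_exponent_le hQR ?_
    rw [div_le_iff₀ hε] at hB'
    rw [hBdef, show B' + 2 - 1 = B' + 1 by omega]
    push_cast
    nlinarith

theorem stdAddChar_sum {R : ℕ} [NeZero R] {ι : Type*} (s : Finset ι) (f : ι → ZMod R) :
    ZMod.stdAddChar (∑ i ∈ s, f i) = ∏ i ∈ s, ZMod.stdAddChar (f i) := by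
  classical
  induction s using Finset.induction_on with
  | empty => simp
  | insert a s ha ih =>
    rw [Finset.sum_insert ha, Finset.prod_insert ha, AddChar.map_add_eq_mul, ih]

/-- The characters of the finite space-time grid `ZMod R × (Fin n → ZMod R)`. -/
noncomputable def gridChar {n R : ℕ} [NeZero R] (h g : ZMod R × (Fin n → ZMod R)) : ℂ :=
  ZMod.stdAddChar (h.1 * g.1 + ∑ i, h.2 i * g.2 i)

section GridChar

variable {n R : ℕ} [NeZero R]

theorem norm_gridChar (h g : ZMod R × (Fin n → ZMod R)) : ‖gridChar h g‖ = 1 :=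
  norm_stdAddChar _

theorem gridChar_add_left (h h' g : ZMod R × (Fin n → ZMod R)) :
    gridChar (h + h') g = gridChar h g * gridChar h' g := by
  rw [gridChar, gridChar, gridChar, ← AddChar.map_add_eq_mul]
  congr 1
  simp only [Prod.fst_add, Prod.snd_add, Pi.add_apply, add_mul, Finset.sum_add_distrib]
  ring

theorem gridChar_comm (h g : ZMod R × (Fin n → ZMod R)) : gridChar h g = gridChar g h := by
  simp only [gridChar, mul_comm]

theorem gridChar_add_right (h g g' : ZMod R × (Fin n → ZMod R)) :
    gridChar h (g + g') = gridChar h g * gridChar h g' := by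
  rw [gridChar_comm, gridChar_add_left, gridChar_comm g, gridChar_comm g']

theorem conj_gridChar (h g : ZMod R × (Fin n → ZMod R)) :
    (starRingEnd ℂ) (gridChar h g) = gridChar h (-g) := by
  rw [gridChar, gridChar, conj_stdAddChar]
  congr 1
  simp only [Prod.fst_neg, Prod.snd_neg, Pi.neg_apply, mul_neg, Finset.sum_neg_distrib]
  ring

theorem gridChar_mul_conj (h g g' : ZMod R × (Fin n → ZMod R)) :
    gridChar h g * (starRingEnd ℂ) (gridChar h g') = gridChar h (g - g') := by
  rw [conj_gridChar, ← gridChar_add_right, sub_eq_add_neg]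

theorem gridChar_zero_left (g : ZMod R × (Fin n → ZMod R)) : gridChar 0 g = 1 := by
  simp [gridChar]

theorem gridChar_sum_left {ι : Type*} (s : Finset ι) (h : ι → ZMod R × (Fin n → ZMod R))
    (g : ZMod R × (Fin n → ZMod R)) :
    gridChar (∑ i ∈ s, h i) g = ∏ i ∈ s, gridChar (h i) g := by
  classical
  induction s using Finset.induction_on with
  | empty => simp [gridChar_zero_left]
  | insert a s ha ih => rw [Finset.sum_insert ha, Finset.prod_insert ha, gridChar_add_left, ih]

theorem sum_gridChar (g : ZMod R × (Fin n → ZMod R)) :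
    ∑ h, gridChar h g = if g = 0 then (R : ℂ) ^ (n + 1) else 0 := by
  have h1 : ∑ h, gridChar h g =
      (∑ x : ZMod R, ZMod.stdAddChar (x * g.1)) * ∏ i, ∑ x : ZMod R, ZMod.stdAddChar (x * g.2 i) := by
    rw [Finset.prod_univ_sum, Fintype.piFinset_univ, Finset.sum_mul_sum, Fintype.sum_prod_type]
    refine Finset.sum_congr rfl fun x _ => Finset.sum_congr rfl fun y _ => ?_
    rw [gridChar, AddChar.map_add_eq_mul, stdAddChar_sum]
  rw [h1]
  simp only [sum_stdAddChar_mul]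
  split_ifs with h h' h'
  · subst h'
    simp [pow_succ']
  · have : ∃ i, g.2 i ≠ 0 := by
      by_contra! hc
      exact h' (Prod.ext h (funext hc))
    obtain ⟨i, hi⟩ := this
    rw [Finset.prod_eq_zero (Finset.mem_univ i) (if_neg hi), mul_zero]
  · exact absurd (congrArg Prod.fst h') h
  · simp

/-- The Fourier transform on the finite space-time grid. -/
noncomputable def gridFourier (f : ZMod R × (Fin n → ZMod R) → ℂ)
    (h : ZMod R × (Fin n → ZMod R)) : ℂ := ∑ g, f g * gridChar h g

theorem norm_gridFourier_sq (f : ZMod R × (Fin n → ZMod R) → ℂ)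
    (h : ZMod R × (Fin n → ZMod R)) :
    ((‖gridFourier f h‖ ^ 2 : ℝ) : ℂ) =
      ∑ g, ∑ g', f g * (starRingEnd ℂ) (f g') * gridChar h (g - g') := by
  rw [Complex.ofReal_pow, ← Complex.mul_conj', gridFourier, map_sum, Finset.sum_mul_sum]
  refine Finset.sum_congr rfl fun g _ => Finset.sum_congr rfl fun g' _ => ?_
  rw [map_mul, mul_mul_mul_comm, gridChar_mul_conj]

theorem sum_norm_gridFourier_sq (f : ZMod R × (Fin n → ZMod R) → ℂ) :
    ∑ h, ‖gridFourier f h‖ ^ 2 = (R : ℝ) ^ (n + 1) * ∑ g, ‖f g‖ ^ 2 := by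
  apply Complex.ofReal_injective
  rw [Complex.ofReal_sum]
  simp only [norm_gridFourier_sq]
  rw [Finset.sum_comm]
  push_cast
  rw [Finset.mul_sum]
  refine Finset.sum_congr rfl fun g _ => ?_
  rw [Finset.sum_comm]
  simp only [← Finset.mul_sum, sum_gridChar, sub_eq_zero]
  simp only [mul_ite, mul_zero, Finset.sum_ite_eq, Finset.mem_univ, if_true]
  rw [Complex.mul_conj']
  ring

end GridChar

/-- The point of the discrete paraboloid over `ξ`. -/
def parabPoint (n R : ℕ) (ξ : Fin n → ℤ) : ZMod R × (Fin n → ZMod R) :=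
  (-∑ i, (ξ i : ZMod R) ^ 2, fun i => (ξ i : ZMod R))

/-- The lattice points of a cube. -/
noncomputable def latticeBox (n N : ℕ) : Finset (Fin n → ℤ) :=
  Fintype.piFinset fun _ => Finset.Icc (-(N : ℤ)) N

theorem card_latticeBox (n N : ℕ) : (latticeBox n N).card = (2 * N + 1) ^ n := by
  rw [latticeBox, Fintype.card_piFinset]
  simp only [Int.card_Icc, Finset.prod_const, Finset.card_univ, Fintype.card_fin]
  congr 1
  omega

theorem mem_latticeBox {n N : ℕ} {ξ : Fin n → ℤ} :
    ξ ∈ latticeBox n N ↔ ∀ i, -(N : ℤ) ≤ ξ i ∧ ξ i ≤ N := by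
  simp [latticeBox]

theorem pow_mul_sum_latticeBox_le {n : ℕ} (N : ℕ) {F : (Fin n → ℤ) → ℝ} (hF : ∀ x, 0 ≤ F x) :
    (N : ℝ) ^ n * ∑ x ∈ latticeBox n N, F x ≤
      ∑ α ∈ latticeBox n N, ∑ β ∈ latticeBox n N, F (α + β) := by
  calc (N : ℝ) ^ n * ∑ x ∈ latticeBox n N, F x
      ≤ ∑ x ∈ latticeBox n N, ∑ α ∈ latticeBox n N with x - α ∈ latticeBox n N, F x := by
        rw [Finset.mul_sum]
        refine Finset.sum_le_sum fun x hx => ?_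
        rw [Finset.sum_const, nsmul_eq_mul]
        refine mul_le_mul_of_nonneg_right ?_ (hF x)
        have h1 : (Fintype.piFinset fun i : Fin n =>
            (Finset.Icc (-(N : ℤ)) N).filter fun a => x i - a ∈ Finset.Icc (-(N : ℤ)) N) ⊆
            ({α ∈ latticeBox n N | x - α ∈ latticeBox n N} : Finset (Fin n → ℤ)) := by
          intro α hα
          simp only [Fintype.mem_piFinset, Finset.mem_filter, latticeBox] at hα ⊢
          exact ⟨fun i => (hα i).1, fun i => (hα i).2⟩
        have h2 := Finset.card_le_card h1
        rw [Fintype.card_piFinset] at h2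
        have h3 : N ^ n ≤ ∏ i : Fin n, #((Finset.Icc (-(N : ℤ)) N).filter
            fun a => x i - a ∈ Finset.Icc (-(N : ℤ)) N) := by
          calc N ^ n = ∏ _i : Fin n, N := by simp
            _ ≤ _ := Finset.prod_le_prod' fun i _ =>
              card_Icc_sum_representations (Fintype.mem_piFinset.1 hx i)
        exact_mod_cast h3.trans h2
    _ = ∑ α ∈ latticeBox n N, ∑ x ∈ latticeBox n N with x - α ∈ latticeBox n N, F x := by
        simp only [Finset.sum_filter]
        rw [Finset.sum_comm]
    _ ≤ _ := by
        refine Finset.sum_le_sum fun α _ => ?_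
        calc _ = ∑ x ∈ latticeBox n N with x - α ∈ latticeBox n N, F (α + (x - α)) := by
              simp only [add_sub_cancel]
          _ = ∑ y ∈ ((latticeBox n N).filter fun x => x - α ∈ latticeBox n N).image
                (fun x => x - α), F (α + y) := by
              rw [Finset.sum_image]
              intro x _ y _ h
              simpa using h
          _ ≤ _ := by
              refine Finset.sum_le_sum_of_subset_of_nonneg ?_ fun _ _ _ => hF _
              intro y hy
              obtain ⟨x, hx, rfl⟩ := Finset.mem_image.1 hy
              exact (Finset.mem_filter.1 hx).2

theorem gridChar_parabPoint {n R : ℕ} [NeZero R] (ξ : Fin n → ℤ)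
    (g : ZMod R × (Fin n → ZMod R)) :
    gridChar (parabPoint n R ξ) g =
      ∏ i, ZMod.stdAddChar (g.2 i * (ξ i : ZMod R) - g.1 * (ξ i : ZMod R) ^ 2) := by
  rw [← stdAddChar_sum, gridChar, parabPoint]
  congr 1
  simp only [Finset.sum_sub_distrib, ← Finset.mul_sum]
  rw [Finset.sum_congr rfl fun i _ => mul_comm (ξ i : ZMod R) (g.2 i)]
  ring

theorem sum_sum_gridChar_parabPoint {n R : ℕ} [NeZero R] (N : ℕ)
    (g : ZMod R × (Fin n → ZMod R)) :
    ∑ α ∈ latticeBox n N, ∑ β ∈ latticeBox n N, gridChar (parabPoint n R (α + β)) g =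
      ∏ i, ∑ a ∈ Finset.Icc (-(N : ℤ)) N, ∑ b ∈ Finset.Icc (-(N : ℤ)) N,
        ZMod.stdAddChar (g.2 i * ((a + b : ℤ) : ZMod R) - g.1 * ((a + b : ℤ) : ZMod R) ^ 2) := by
  rw [Finset.prod_univ_sum]
  refine Finset.sum_congr rfl fun α _ => ?_
  rw [Finset.prod_univ_sum]
  refine Finset.sum_congr rfl fun β _ => ?_
  rw [gridChar_parabPoint]
  rfl

theorem sum_norm_gridFourier_parabPoint_le {n R N : ℕ} [NeZero R] (hNR : 2 * N < R)
    (f : ZMod R × (Fin n → ZMod R) → ℂ) :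
    ∑ k : ZMod R, ∑ α ∈ latticeBox n N, ∑ β ∈ latticeBox n N,
      ‖gridFourier f (parabPoint n R (α + β) + (k, 0))‖ ^ 2 ≤
    (2 * N + 1) ^ n * ((R : ℝ) ^ (n + 1) * ∑ g, ‖f g‖ ^ 2) := by
  rw [Finset.sum_comm]
  have hcard : ((2 * N + 1) ^ n : ℝ) = ((latticeBox n N).card : ℝ) := by
    rw [card_latticeBox]; push_cast; rfl
  rw [hcard, ← nsmul_eq_mul]
  refine Finset.sum_le_card_nsmul _ _ _ fun α _ => ?_
  rw [← sum_norm_gridFourier_sq, ← Finset.sum_product',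
    ← Finset.sum_image (s := Finset.univ ×ˢ latticeBox n N)
      (g := fun x : ZMod R × (Fin n → ℤ) => parabPoint n R (α + x.2) + (x.1, 0))
      (f := fun h => ‖gridFourier f h‖ ^ 2)]
  · exact Finset.sum_le_sum_of_subset_of_nonneg (Finset.subset_univ _) fun _ _ _ => by positivity
  · rintro ⟨k, β⟩ hx ⟨k', β'⟩ hy h
    have hβ := mem_latticeBox.1 (Finset.mem_product.1 hx).2
    have hβ' := mem_latticeBox.1 (Finset.mem_product.1 hy).2
    simp only [parabPoint, Prod.mk_add_mk, add_zero, Prod.mk.injEq] at h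
    have hb : β = β' := by
      funext i
      have h2 := congrFun h.2 i
      simp only [Pi.add_apply, Int.cast_add, add_right_inj] at h2
      rw [ZMod.intCast_eq_intCast_iff_dvd_sub] at h2
      have := Int.eq_zero_of_abs_lt_dvd h2 (by
        rw [abs_lt]; constructor <;> linarith [hβ i, hβ' i, (show (2 * N : ℤ) < R by exact_mod_cast hNR), (hβ i).1, (hβ i).2, (hβ' i).1, (hβ' i).2])
      omega
    subst hb
    simpa using h.1

set_option maxHeartbeats 1000000 in
theorem sum_latticeBox_kernel_le {n : ℕ} {ε : ℝ} (hε : 0 < ε) :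
    ∃ C : ℝ, 1 ≤ C ∧ ∀ N Q R : ℕ, 1 ≤ Q → 12 * Q ^ 2 ≤ N ^ 2 → N ^ 2 ≤ R → 2 * N < R →
      (∀ q, 1 ≤ q → q ≤ Q → q ∣ R) → ∀ [NeZero R], ∀ (E : Finset (ZMod R × (Fin n → ZMod R)))
      (f : ZMod R × (Fin n → ZMod R) → ℂ), (∀ g ∈ E, ‖f g‖ ≤ 1) → (∀ g ∉ E, f g = 0) →
      ∑ α ∈ latticeBox n N, ∑ β ∈ latticeBox n N, ‖gridFourier f (parabPoint n R (α + β))‖ ^ 2 ≤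
        C * (N : ℝ) ^ (2 * n) * (Q : ℝ) ^ (-(n / 2 : ℝ)) * (E.card : ℝ) ^ 2 +
        C * (N : ℝ) ^ n * ((Q : ℝ) ^ (1 + ε) / (N : ℝ) ^ 2) * (R : ℝ) ^ (n + 1) * E.card := by
  obtain ⟨C, hC1, hC⟩ := exists_majorArcs_decomposition (s := n / 2) hε
  refine ⟨4 / 3 * (23328 ^ n + 9 ^ n * C + 3 * 3 ^ n), ?_, ?_⟩
  · have : (1 : ℝ) ≤ 23328 ^ n := one_le_pow₀ (by norm_num)
    have : (0 : ℝ) ≤ 9 ^ n * C := by positivity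
    have : (0 : ℝ) ≤ 3 * 3 ^ n := by positivity
    linarith
  intro N Q R hQ hNQ hR hNR hdiv _ E f hf1 hf0
  obtain ⟨M, ν, hminor, hμ0, hμ, hν0, hν⟩ := hC N Q R hQ hNQ hR hdiv
  have hN : 1 ≤ N := by
    rcases Nat.eq_zero_or_pos N with h | h
    · subst h; nlinarith
    · exact h
  have hN1 : (1 : ℝ) ≤ N := by exact_mod_cast hN
  have hfs : ∑ g, ‖f g‖ ^ 2 ≤ E.card := by
    rw [← Finset.sum_subset (Finset.subset_univ E) (fun g _ hg => by simp [hf0 g hg])]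
    rw [← nsmul_one]
    refine Finset.sum_le_card_nsmul _ _ _ fun g hg => pow_le_one₀ (norm_nonneg _) (hf1 g hg)
  have hfn : ∑ g, ‖f g‖ ≤ E.card := by
    rw [← Finset.sum_subset (Finset.subset_univ E) (fun g _ hg => by simp [hf0 g hg])]
    rw [← nsmul_one]
    exact Finset.sum_le_card_nsmul _ _ _ fun g hg => hf1 g hg
  set T : ZMod R → ℝ := fun k => ∑ α ∈ latticeBox n N, ∑ β ∈ latticeBox n N,
      ‖gridFourier f (parabPoint n R (α + β) + (k, 0))‖ ^ 2 with hT
  set K : ZMod R × (Fin n → ZMod R) → ℂ := fun g =>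
    ∑ α ∈ latticeBox n N, ∑ β ∈ latticeBox n N, gridChar (parabPoint n R (α + β)) g with hK
  have hT0 : ∀ k, 0 ≤ T k := fun k => by positivity
  have hTK : ∀ k, (T k : ℂ) = ∑ g, ∑ g', f g * (starRingEnd ℂ) (f g') *
      (K (g - g') * ZMod.stdAddChar (k * (g.1 - g'.1))) := by
    intro k
    rw [hT]
    simp only
    rw [Complex.ofReal_sum]
    simp only [Complex.ofReal_sum, norm_gridFourier_sq, hK, Finset.sum_mul, Finset.mul_sum]
    have h1 : ∀ α ∈ latticeBox n N, ∑ β ∈ latticeBox n N, ∑ g, ∑ g', f g * (starRingEnd ℂ) (f g') *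
        gridChar (parabPoint n R (α + β) + (k, 0)) (g - g') = ∑ g, ∑ g', ∑ β ∈ latticeBox n N,
        f g * (starRingEnd ℂ) (f g') *
        gridChar (parabPoint n R (α + β) + (k, 0)) (g - g') := by
      intro α _
      rw [Finset.sum_comm]
      exact Finset.sum_congr rfl fun g _ => Finset.sum_comm
    rw [Finset.sum_congr rfl h1, Finset.sum_comm]
    refine Finset.sum_congr rfl fun g _ => ?_
    rw [Finset.sum_comm]
    refine Finset.sum_congr rfl fun g' _ => Finset.sum_congr rfl fun α _ =>
      Finset.sum_congr rfl fun β _ => ?_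
    rw [gridChar_add_left]
    congr 2
    simp [gridChar]
  have hTzero : T 0 = ∑ α ∈ latticeBox n N, ∑ β ∈ latticeBox n N,
      ‖gridFourier f (parabPoint n R (α + β))‖ ^ 2 := by
    simp only [hT]
    have : ((0 : ZMod R), (0 : Fin n → ZMod R)) = 0 := rfl
    simp only [this, add_zero]
  have hKM : ∀ g : ZMod R × (Fin n → ZMod R), g.1 ∉ M →
      ‖K g‖ ≤ 23328 ^ n * (N : ℝ) ^ (2 * n) * (Q : ℝ) ^ (-(n / 2 : ℝ)) := by
    intro g hg
    rw [hK]
    simp only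
    rw [sum_sum_gridChar_parabPoint, norm_prod]
    have hX : ∀ i, ‖∑ a ∈ Finset.Icc (-(N : ℤ)) N, ∑ b ∈ Finset.Icc (-(N : ℤ)) N,
        ZMod.stdAddChar (g.2 i * ((a + b : ℤ) : ZMod R) - g.1 * ((a + b : ℤ) : ZMod R) ^ 2)‖ ≤
        23328 * (N : ℝ) ^ 2 * (Q : ℝ) ^ (-(1 / 2 : ℝ)) := by
      intro i
      refine le_of_sq_le_sq ?_ (by positivity)
      refine (hminor g.1 hg (g.2 i)).trans ?_
      have : ((Q : ℝ) ^ (-(1 / 2 : ℝ))) ^ 2 = (Q : ℝ)⁻¹ := by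
        rw [← Real.rpow_natCast, ← Real.rpow_mul (by positivity)]
        norm_num
        exact Real.rpow_neg_one _
      rw [mul_pow, mul_pow, this, div_eq_mul_inv]
      gcongr
      · norm_num
      · exact (show (N : ℝ) ^ 4 = ((N : ℝ) ^ 2) ^ 2 by ring).le
    refine (Finset.prod_le_prod (fun i _ => norm_nonneg _) fun i _ => hX i).trans_eq ?_
    rw [Finset.prod_const, Finset.card_univ, Fintype.card_fin, mul_pow, mul_pow, ← pow_mul,
      ← Real.rpow_natCast ((Q : ℝ) ^ (-(1 / 2 : ℝ))), ← Real.rpow_mul (by positivity)]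
    congr 2
    ring
  have hsplit : (T 0 : ℂ) = ∑ g, ∑ g', f g * (starRingEnd ℂ) (f g') *
      (if g.1 - g'.1 ∈ M then 0 else K (g - g')) + ∑ k, indicatorCoeff M k * T k := by
    have h1 : ∑ k, indicatorCoeff M k * T k = ∑ g, ∑ g', f g * (starRingEnd ℂ) (f g') *
        (K (g - g') * if g.1 - g'.1 ∈ M then 1 else 0) := by
      simp only [hTK, Finset.mul_sum]
      rw [Finset.sum_comm]
      refine Finset.sum_congr rfl fun g _ => ?_
      rw [Finset.sum_comm]
      refine Finset.sum_congr rfl fun g' _ => ?_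
      rw [← sum_indicatorCoeff_mul, Finset.mul_sum, Finset.mul_sum]
      refine Finset.sum_congr rfl fun k _ => ?_
      ring
    rw [h1, hTK, ← Finset.sum_add_distrib]
    refine Finset.sum_congr rfl fun g _ => ?_
    rw [← Finset.sum_add_distrib]
    refine Finset.sum_congr rfl fun g' _ => ?_
    split_ifs <;> simp
  have hI : ‖∑ g, ∑ g', f g * (starRingEnd ℂ) (f g') *
      (if g.1 - g'.1 ∈ M then 0 else K (g - g'))‖ ≤
      23328 ^ n * (N : ℝ) ^ (2 * n) * (Q : ℝ) ^ (-(n / 2 : ℝ)) * (E.card : ℝ) ^ 2 := by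
    set Z := 23328 ^ n * (N : ℝ) ^ (2 * n) * (Q : ℝ) ^ (-(n / 2 : ℝ)) with hZ
    have hZ0 : 0 ≤ Z := by positivity
    calc _ ≤ ∑ g, ∑ g', ‖f g‖ * ‖f g'‖ * Z := by
          refine (norm_sum_le _ _).trans (Finset.sum_le_sum fun g _ => (norm_sum_le _ _).trans
            (Finset.sum_le_sum fun g' _ => ?_))
          rw [norm_mul, norm_mul, RCLike.norm_conj]
          refine mul_le_mul_of_nonneg_left ?_ (by positivity)
          split_ifs with h
          · simpa using hZ0
          · exact hKM (g - g') h
      _ = Z * ((∑ g, ‖f g‖) * ∑ g, ‖f g‖) := by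
          rw [Finset.sum_mul_sum, Finset.mul_sum]
          refine Finset.sum_congr rfl fun g _ => ?_
          rw [Finset.mul_sum]
          refine Finset.sum_congr rfl fun g' _ => by ring
      _ ≤ Z * ((E.card : ℝ) * E.card) := by gcongr
      _ = _ := by ring
  have hTsum : ∑ k, T k ≤ 3 ^ n * (N : ℝ) ^ n * ((R : ℝ) ^ (n + 1) * E.card) := by
    refine (sum_norm_gridFourier_parabPoint_le hNR f).trans ?_
    rw [← mul_pow]
    gcongr
    linarith
  have hTsup : ∀ k, T k ≤ 9 ^ n * (N : ℝ) ^ (2 * n) * (E.card : ℝ) ^ 2 := by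
    intro k
    have hF : ∀ h, ‖gridFourier f h‖ ^ 2 ≤ (E.card : ℝ) ^ 2 := by
      intro h
      refine pow_le_pow_left₀ (norm_nonneg _) (le_trans ?_ hfn) 2
      refine (norm_sum_le _ _).trans_eq (Finset.sum_congr rfl fun g _ => ?_)
      rw [norm_mul, norm_gridChar, mul_one]
    calc T k ≤ ∑ α ∈ latticeBox n N, ∑ β ∈ latticeBox n N, (E.card : ℝ) ^ 2 :=
          Finset.sum_le_sum fun α _ => Finset.sum_le_sum fun β _ => hF _
      _ = ((2 * N + 1 : ℝ) ^ n) ^ 2 * (E.card : ℝ) ^ 2 := by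
          simp only [Finset.sum_const, nsmul_eq_mul, card_latticeBox]
          push_cast
          ring
      _ ≤ ((3 * N : ℝ) ^ n) ^ 2 * (E.card : ℝ) ^ 2 := by
          gcongr
          linarith
      _ = _ := by
          rw [mul_pow, mul_pow, ← pow_mul, ← pow_mul, mul_comm n 2, pow_mul 3 2 n]
          norm_num
  have hII : ‖∑ k, indicatorCoeff M k * T k‖ ≤ 1 / 4 * T 0 +
      (3 * (Q : ℝ) ^ (1 + ε) / (N : ℝ) ^ 2) * ∑ k, T k +
      (∑ k, ν k) * (9 ^ n * (N : ℝ) ^ (2 * n) * (E.card : ℝ) ^ 2) := by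
    rw [← Finset.add_sum_erase _ _ (Finset.mem_univ (0 : ZMod R)), add_assoc]
    refine (norm_add_le _ _).trans (add_le_add ?_ ?_)
    · rw [norm_mul, Complex.norm_real, Real.norm_of_nonneg (hT0 0)]
      exact mul_le_mul_of_nonneg_right hμ0 (hT0 0)
    · rw [Finset.mul_sum, Finset.sum_mul, ← Finset.sum_add_distrib]
      refine (norm_sum_le _ _).trans ?_
      calc _ ≤ ∑ k ∈ Finset.univ.erase (0 : ZMod R),
            ((3 * (Q : ℝ) ^ (1 + ε) / (N : ℝ) ^ 2) * T k +
              ν k * (9 ^ n * (N : ℝ) ^ (2 * n) * (E.card : ℝ) ^ 2)) := by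
            refine Finset.sum_le_sum fun k hk => ?_
            rw [norm_mul, Complex.norm_real, Real.norm_of_nonneg (hT0 k)]
            refine (mul_le_mul_of_nonneg_right (hμ k (Finset.mem_erase.1 hk).1) (hT0 k)).trans ?_
            rw [add_mul]
            exact add_le_add le_rfl (mul_le_mul_of_nonneg_left (hTsup k) (hν0 k))
        _ ≤ _ := by
            refine Finset.sum_le_sum_of_subset_of_nonneg (Finset.subset_univ _) fun k _ _ => ?_
            have := hT0 k
            have := hν0 k
            positivity
  have hfin := (norm_add_le _ _).trans (add_le_add hI hII)
  rw [← hsplit, Complex.norm_real, Real.norm_of_nonneg (hT0 0)] at hfin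
  rw [← hTzero]
  have hA : (3 * (Q : ℝ) ^ (1 + ε) / (N : ℝ) ^ 2) * ∑ k, T k ≤
      (3 * (Q : ℝ) ^ (1 + ε) / (N : ℝ) ^ 2) * (3 ^ n * (N : ℝ) ^ n * ((R : ℝ) ^ (n + 1) * E.card)) :=
    mul_le_mul_of_nonneg_left hTsum (by positivity)
  have hB : (∑ k, ν k) * (9 ^ n * (N : ℝ) ^ (2 * n) * (E.card : ℝ) ^ 2) ≤
      (C * (Q : ℝ) ^ (-(n / 2 : ℝ))) * (9 ^ n * (N : ℝ) ^ (2 * n) * (E.card : ℝ) ^ 2) :=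
    mul_le_mul_of_nonneg_right hν (by positivity)
  set X := (N : ℝ) ^ (2 * n) * (Q : ℝ) ^ (-(n / 2 : ℝ)) * (E.card : ℝ) ^ 2 with hX
  set Y := (N : ℝ) ^ n * ((Q : ℝ) ^ (1 + ε) / (N : ℝ) ^ 2) * (R : ℝ) ^ (n + 1) * E.card with hY
  have hX0 : 0 ≤ X := by positivity
  have hY0 : 0 ≤ Y := by positivity
  have hfin' : 3 / 4 * T 0 ≤ 23328 ^ n * X + 3 * 3 ^ n * Y + 9 ^ n * C * X := by
    have e1 : (3 * (Q : ℝ) ^ (1 + ε) / (N : ℝ) ^ 2) *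
        (3 ^ n * (N : ℝ) ^ n * ((R : ℝ) ^ (n + 1) * E.card)) = 3 * 3 ^ n * Y := by rw [hY]; ring
    have e2 : (C * (Q : ℝ) ^ (-(n / 2 : ℝ))) * (9 ^ n * (N : ℝ) ^ (2 * n) * (E.card : ℝ) ^ 2) =
        9 ^ n * C * X := by rw [hX]; ring
    have e3 : 23328 ^ n * (N : ℝ) ^ (2 * n) * (Q : ℝ) ^ (-(n / 2 : ℝ)) * (E.card : ℝ) ^ 2 =
        23328 ^ n * X := by rw [hX]; ring
    rw [e1] at hA
    rw [e2] at hB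
    rw [e3] at hfin
    linarith
  have p1 : (0 : ℝ) ≤ 23328 ^ n := by positivity
  have p2 : (0 : ℝ) ≤ 9 ^ n * C := by positivity
  have p3 : (0 : ℝ) ≤ 3 * 3 ^ n := by positivity
  calc T 0 ≤ 4 / 3 * ((23328 ^ n + 9 ^ n * C) * X + 3 * 3 ^ n * Y) := by linarith
    _ ≤ 4 / 3 * ((23328 ^ n + 9 ^ n * C + 3 * 3 ^ n) * X +
        (23328 ^ n + 9 ^ n * C + 3 * 3 ^ n) * Y) := by
      have := mul_nonneg p3 hX0
      have := mul_nonneg (add_nonneg p1 p2) hY0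
      linarith
    _ = _ := by rw [hX, hY]; ring

noncomputable section

/-- The trigonometric sum over the lattice box with coefficients `b`, sampled on the grid
`(ℤ/R)^(n+1)` and lifted to the paraboloid. -/
def gridWave (n R N : ℕ) [NeZero R] (b : (Fin n → ℤ) → ℂ) (g : ZMod R × (Fin n → ZMod R)) : ℂ :=
  ∑ ξ ∈ latticeBox n N, b ξ * gridChar (parabPoint n R ξ) g

end

theorem norm_gridWave_sq_le {n R N : ℕ} [NeZero R] (hN : 1 ≤ N) {b : (Fin n → ℤ) → ℂ}
    (hb : ∑ ξ ∈ latticeBox n N, ‖b ξ‖ ^ 2 ≤ 1) (g : ZMod R × (Fin n → ZMod R)) :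
    ‖gridWave n R N b g‖ ^ 2 ≤ (3 * N : ℝ) ^ n := by
  have hN1 : (1 : ℝ) ≤ N := by exact_mod_cast hN
  have h1 : ‖gridWave n R N b g‖ ≤ ∑ ξ ∈ latticeBox n N, ‖b ξ‖ * 1 :=
    (norm_sum_le _ _).trans_eq (Finset.sum_congr rfl fun ξ _ => by rw [norm_mul, norm_gridChar])
  calc ‖gridWave n R N b g‖ ^ 2 ≤ (∑ ξ ∈ latticeBox n N, ‖b ξ‖ * 1) ^ 2 := by gcongr
    _ ≤ (∑ ξ ∈ latticeBox n N, ‖b ξ‖ ^ 2) * ∑ ξ ∈ latticeBox n N, (1 : ℝ) ^ 2 :=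
      Finset.sum_mul_sq_le_sq_mul_sq _ _ _
    _ ≤ 1 * (2 * N + 1 : ℝ) ^ n := by
      gcongr
      simp [card_latticeBox]
    _ ≤ (3 * N : ℝ) ^ n := by
      rw [one_mul]
      gcongr
      linarith

theorem exists_sq_mul_card_le {n : ℕ} {ε : ℝ} (hε : 0 < ε) :
    ∃ C : ℝ, 1 ≤ C ∧ ∀ N Q R : ℕ, 1 ≤ Q → 12 * Q ^ 2 ≤ N ^ 2 → N ^ 2 ≤ R → 2 * N < R →
      (∀ q, 1 ≤ q → q ≤ Q → q ∣ R) → ∀ [NeZero R], ∀ (E : Finset (ZMod R × (Fin n → ZMod R)))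
      (b : (Fin n → ℤ) → ℂ) (t : ℝ), ∑ ξ ∈ latticeBox n N, ‖b ξ‖ ^ 2 ≤ 1 → 0 ≤ t →
      (∀ g ∈ E, t ≤ ‖gridWave n R N b g‖) →
      t ^ 2 * E.card ≤ C * (N : ℝ) ^ n * (Q : ℝ) ^ (-(n / 2 : ℝ)) * E.card +
        C * ((Q : ℝ) ^ (1 + ε) / (N : ℝ) ^ 2) * (R : ℝ) ^ (n + 1) := by
  obtain ⟨C, hC1, hC⟩ := sum_latticeBox_kernel_le (n := n) hε
  refine ⟨C, hC1, fun N Q R hQ hNQ hR hNR hdiv _ E b t hb ht hE => ?_⟩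
  rcases E.eq_empty_or_nonempty with rfl | hne
  · simp only [Finset.card_empty, Nat.cast_zero, mul_zero, zero_add]
    positivity
  have hN : 1 ≤ N := by
    rcases Nat.eq_zero_or_pos N with h | h
    · subst h; nlinarith
    · exact h
  classical
  set f : ZMod R × (Fin n → ZMod R) → ℂ := fun g =>
    if g ∈ E then (starRingEnd ℂ) (gridWave n R N b g) / ‖gridWave n R N b g‖ else 0 with hf
  have hf1 : ∀ g ∈ E, ‖f g‖ ≤ 1 := by
    intro g hg
    simp only [hf, hg, if_true, norm_div, RCLike.norm_conj, Complex.norm_real, norm_norm]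
    exact div_self_le_one _
  have hf0 : ∀ g ∉ E, f g = 0 := fun g hg => by simp [hf, hg]
  have hfU : ∑ g, f g * gridWave n R N b g = ((∑ g ∈ E, ‖gridWave n R N b g‖ : ℝ) : ℂ) := by
    rw [← Finset.sum_subset (Finset.subset_univ E) fun g _ hg => by rw [hf0 g hg, zero_mul]]
    push_cast
    refine Finset.sum_congr rfl fun g hg => ?_
    simp only [hf, hg, if_true]
    rw [div_mul_eq_mul_div, mul_comm, Complex.mul_conj, Complex.normSq_eq_norm_sq]
    push_cast
    rw [pow_two, mul_self_div_self]
  have hdual : ∑ g, f g * gridWave n R N b g =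
      ∑ ξ ∈ latticeBox n N, b ξ * gridFourier f (parabPoint n R ξ) := by
    simp only [gridWave, gridFourier, Finset.mul_sum]
    rw [Finset.sum_comm]
    exact Finset.sum_congr rfl fun ξ _ => Finset.sum_congr rfl fun g _ => by ring
  have h1 : t * E.card ≤ ∑ ξ ∈ latticeBox n N, ‖b ξ‖ * ‖gridFourier f (parabPoint n R ξ)‖ := by
    calc t * E.card = ∑ g ∈ E, t := by rw [Finset.sum_const, nsmul_eq_mul, mul_comm]
      _ ≤ ∑ g ∈ E, ‖gridWave n R N b g‖ := Finset.sum_le_sum hE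
      _ = ‖((∑ g ∈ E, ‖gridWave n R N b g‖ : ℝ) : ℂ)‖ := by
        rw [Complex.norm_real, Real.norm_of_nonneg (by positivity)]
      _ ≤ _ := by
        rw [← hfU, hdual]
        exact (norm_sum_le _ _).trans_eq (Finset.sum_congr rfl fun ξ _ => norm_mul _ _)
  have h2 : (t * E.card) ^ 2 ≤ ∑ ξ ∈ latticeBox n N, ‖gridFourier f (parabPoint n R ξ)‖ ^ 2 := by
    calc (t * E.card) ^ 2 ≤ _ := pow_le_pow_left₀ (by positivity) h1 2
      _ ≤ (∑ ξ ∈ latticeBox n N, ‖b ξ‖ ^ 2) *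
          ∑ ξ ∈ latticeBox n N, ‖gridFourier f (parabPoint n R ξ)‖ ^ 2 :=
        Finset.sum_mul_sq_le_sq_mul_sq _ _ _
      _ ≤ 1 * ∑ ξ ∈ latticeBox n N, ‖gridFourier f (parabPoint n R ξ)‖ ^ 2 := by gcongr
      _ = _ := one_mul _
  have h3 := pow_mul_sum_latticeBox_le (n := n) N
    (F := fun ξ => ‖gridFourier f (parabPoint n R ξ)‖ ^ 2) fun ξ => by positivity
  have h4 := hC N Q R hQ hNQ hR hNR hdiv E f hf1 hf0
  have h5 : (N : ℝ) ^ n * (t * E.card) ^ 2 ≤ _ :=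
    ((mul_le_mul_of_nonneg_left h2 (by positivity)).trans h3).trans h4
  have hpos : (0 : ℝ) < (N : ℝ) ^ n * E.card := by positivity
  refine le_of_mul_le_mul_left ?_ hpos
  calc _ = (N : ℝ) ^ n * (t * E.card) ^ 2 := by ring
    _ ≤ _ := h5
    _ = _ := by ring

theorem exists_card_superlevel_le {n : ℕ} (hn : 1 ≤ n) {ε : ℝ} (hε : 0 < ε) :
    ∃ C : ℝ, 1 ≤ C ∧ ∀ N R : ℕ, 1 ≤ N → N ^ 2 ≤ R → 2 * N < R → (∀ q, 1 ≤ q → q ≤ N → q ∣ R) →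
      ∀ [NeZero R], ∀ (E : Finset (ZMod R × (Fin n → ZMod R))) (b : (Fin n → ℤ) → ℂ) (t : ℝ),
      ∑ ξ ∈ latticeBox n N, ‖b ξ‖ ^ 2 ≤ 1 → C * (N : ℝ) ^ (n / 4 : ℝ) ≤ t →
      (∀ g ∈ E, t ≤ ‖gridWave n R N b g‖) →
      (E.card : ℝ) ≤ C * (R : ℝ) ^ (n + 1) * (N : ℝ) ^ (2 * ε) *
        t ^ (-(2 + 4 / n * (1 + ε)) : ℝ) := by
  obtain ⟨C₁, hC₁1, hC₁⟩ := exists_sq_mul_card_le (n := n) hε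
  set C := max C₁ (3 ^ n) with hCdef
  have hCC₁ : C₁ ≤ C := le_max_left _ _
  have hC3 : (3 : ℝ) ^ n ≤ C := le_max_right _ _
  set D := 2 * C * (2 * C) ^ (2 / n * (1 + ε) : ℝ) * 2 ^ (1 + ε) with hD
  refine ⟨max (2 * C * 7 ^ (n / 2 : ℝ)) D, ?_, ?_⟩
  · refine le_trans ?_ (le_max_left _ _)
    have : (1 : ℝ) ≤ 7 ^ (n / 2 : ℝ) := Real.one_le_rpow (by norm_num) (by positivity)
    nlinarith
  intro N R hN hR hNR hdiv _ E b t hb ht hE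
  have hN1 : (1 : ℝ) ≤ N := by exact_mod_cast hN
  have hN0 : (0 : ℝ) < N := by linarith
  have h7 : (1 : ℝ) ≤ 7 ^ (n / 2 : ℝ) := Real.one_le_rpow (by norm_num) (by positivity)
  have ht1 : 2 * C * 7 ^ (n / 2 : ℝ) * (N : ℝ) ^ (n / 4 : ℝ) ≤ t :=
    (mul_le_mul_of_nonneg_right (le_max_left _ _) (by positivity)).trans ht
  have ht0 : 0 < t := lt_of_lt_of_le (by positivity) ht1
  rcases E.eq_empty_or_nonempty with rfl | hne
  · have : 0 ≤ max (2 * C * 7 ^ (n / 2 : ℝ)) D := le_trans (by positivity) (le_max_left _ _)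
    simp only [Finset.card_empty, Nat.cast_zero]
    positivity
  obtain ⟨g₀, hg₀⟩ := hne
  have htN : t ^ 2 ≤ 3 ^ n * (N : ℝ) ^ n := by
    rw [← mul_pow]
    exact (pow_le_pow_left₀ ht0.le (hE g₀ hg₀) 2).trans (norm_gridWave_sq_le hN hb g₀)
  set z : ℝ := (2 * C * (N : ℝ) ^ n / t ^ 2) ^ (2 / n : ℝ) with hz
  have hz1 : 1 ≤ z := by
    refine Real.one_le_rpow ?_ (by positivity)
    rw [one_le_div (by positivity)]
    have : (0 : ℝ) < (N : ℝ) ^ n := by positivity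
    nlinarith
  have hz7 : z ≤ N / 7 := by
    have h1 : 2 * C * (N : ℝ) ^ n / t ^ 2 ≤ (N / 7 : ℝ) ^ (n / 2 : ℝ) := by
      rw [div_le_iff₀ (by positivity), Real.div_rpow (by positivity) (by norm_num)]
      have h2 : (2 * C * 7 ^ (n / 2 : ℝ) * (N : ℝ) ^ (n / 4 : ℝ)) ^ 2 ≤ t ^ 2 :=
        pow_le_pow_left₀ (by positivity) ht1 2
      have h3 : ((N : ℝ) ^ (n / 4 : ℝ)) ^ 2 = (N : ℝ) ^ (n / 2 : ℝ) := by
        rw [← Real.rpow_natCast, ← Real.rpow_mul hN0.le]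
        congr 1
        push_cast
        ring
      have h4 : (N : ℝ) ^ (n / 2 : ℝ) * (N : ℝ) ^ (n / 2 : ℝ) = (N : ℝ) ^ n := by
        rw [← Real.rpow_add hN0, add_halves, Real.rpow_natCast]
      rw [mul_pow, mul_pow, h3] at h2
      calc 2 * C * (N : ℝ) ^ n
          ≤ (2 * C) ^ 2 * 7 ^ (n / 2 : ℝ) * (N : ℝ) ^ n := by
            refine mul_le_mul_of_nonneg_right ?_ (by positivity)
            nlinarith [one_le_mul_of_one_le_of_one_le (show (1 : ℝ) ≤ 2 * C by linarith) h7]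
        _ = (N : ℝ) ^ (n / 2 : ℝ) / 7 ^ (n / 2 : ℝ) *
            ((2 * C) ^ 2 * (7 ^ (n / 2 : ℝ)) ^ 2 * (N : ℝ) ^ (n / 2 : ℝ)) := by
            rw [← h4]
            field_simp
        _ ≤ _ := by gcongr
    calc z ≤ ((N / 7 : ℝ) ^ (n / 2 : ℝ)) ^ (2 / n : ℝ) := by
          rw [hz]; gcongr
      _ = N / 7 := by
        rw [← Real.rpow_mul (by positivity), div_mul_div_comm, mul_comm, div_self (by positivity),
          Real.rpow_one]
  set Q := ⌈z⌉₊ with hQ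
  have hzQ : z ≤ Q := Nat.le_ceil z
  have hQz : (Q : ℝ) ≤ 2 * z := by
    have := Nat.ceil_lt_add_one (show 0 ≤ z by linarith)
    linarith
  have hQ1 : 1 ≤ Q := by
    have : (1 : ℝ) ≤ Q := hz1.trans hzQ
    exact_mod_cast this
  have hQN : 12 * Q ^ 2 ≤ N ^ 2 := by
    have h1 : (Q : ℝ) ≤ 2 * (N / 7) := by linarith
    have h2 : (Q : ℝ) ^ 2 ≤ (2 * (N / 7)) ^ 2 := pow_le_pow_left₀ (by positivity) h1 2
    have h3 : 12 * (Q : ℝ) ^ 2 ≤ (N : ℝ) ^ 2 := by nlinarith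
    exact_mod_cast h3
  have hQN' : Q ≤ N := by nlinarith
  have key := hC₁ N Q R hQ1 hQN hR hNR (fun q h1 h2 => hdiv q h1 (h2.trans hQN')) E b t hb ht0.le hE
  have hhalf : C₁ * (N : ℝ) ^ n * (Q : ℝ) ^ (-(n / 2 : ℝ)) ≤ t ^ 2 / 2 := by
    have h1 : 2 * C * (N : ℝ) ^ n / t ^ 2 = z ^ (n / 2 : ℝ) := by
      rw [hz, ← Real.rpow_mul (by positivity), div_mul_div_comm, mul_comm (2 : ℝ) n,
        div_self (by positivity), Real.rpow_one]
    have h2 : z ^ (n / 2 : ℝ) ≤ (Q : ℝ) ^ (n / 2 : ℝ) := by gcongr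
    rw [Real.rpow_neg (by positivity), ← div_eq_mul_inv, div_le_iff₀ (by positivity)]
    rw [← h1, div_le_iff₀ (by positivity)] at h2
    have h3 : C₁ * (N : ℝ) ^ n ≤ C * (N : ℝ) ^ n := by gcongr
    linarith
  have hkey : t ^ 2 * E.card ≤ 2 * C * ((2 * z) ^ (1 + ε) / (N : ℝ) ^ 2) * (R : ℝ) ^ (n + 1) := by
    have h1 : C₁ * ((Q : ℝ) ^ (1 + ε) / (N : ℝ) ^ 2) * (R : ℝ) ^ (n + 1) ≤
        C * ((2 * z) ^ (1 + ε) / (N : ℝ) ^ 2) * (R : ℝ) ^ (n + 1) := by gcongr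
    have h2 := mul_le_mul_of_nonneg_right hhalf (Nat.cast_nonneg (α := ℝ) E.card)
    linarith
  have hzε : (2 * z) ^ (1 + ε) / (N : ℝ) ^ 2 = 2 ^ (1 + ε) * (2 * C) ^ (2 / n * (1 + ε) : ℝ) *
      (N : ℝ) ^ (2 * ε) * t ^ (-(4 / n * (1 + ε)) : ℝ) := by
    rw [Real.mul_rpow (by norm_num) (by positivity), hz, ← Real.rpow_mul (by positivity),
      Real.div_rpow (by positivity) (by positivity), Real.mul_rpow (by positivity) (by positivity),
      ← Real.rpow_natCast (N : ℝ) n, ← Real.rpow_natCast t 2, ← Real.rpow_mul (by positivity),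
      ← Real.rpow_mul (by positivity), Real.rpow_neg (by positivity)]
    have e1 : (n : ℝ) * (2 / n * (1 + ε)) = 2 * ε + 2 := by field_simp; ring
    have e2 : ((2 : ℕ) : ℝ) * (2 / n * (1 + ε)) = 4 / n * (1 + ε) := by push_cast; ring
    rw [e1, e2, Real.rpow_add hN0, Real.rpow_two]
    field_simp
  have hfin : (E.card : ℝ) ≤ D * (R : ℝ) ^ (n + 1) * (N : ℝ) ^ (2 * ε) *
      t ^ (-(2 + 4 / n * (1 + ε)) : ℝ) := by
    rw [hzε] at hkey
    rw [neg_add, Real.rpow_add ht0, Real.rpow_neg ht0.le, Real.rpow_two]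
    calc (E.card : ℝ) ≤ 2 * C * (2 ^ (1 + ε) * (2 * C) ^ (2 / n * (1 + ε) : ℝ) *
          (N : ℝ) ^ (2 * ε) * t ^ (-(4 / n * (1 + ε)) : ℝ)) * (R : ℝ) ^ (n + 1) / t ^ 2 := by
          rw [le_div_iff₀ (by positivity), mul_comm]
          exact hkey
      _ = _ := by rw [hD]; ring
  refine hfin.trans ?_
  gcongr
  exact le_max_right _ _

noncomputable section

/-- The `s`-tuples in the lattice box whose vector sum and sum of squared lengths are prescribed. -/
def energyFiber (n s N : ℕ) (A : Fin n → ℤ) (B : ℤ) : Finset (Fin s → Fin n → ℤ) :=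
  (Fintype.piFinset fun _ => latticeBox n N).filter fun x =>
    (∀ j, ∑ i, x i j = A j) ∧ ∑ i, ∑ j, (x i j) ^ 2 = B

end

theorem mem_energyFiber {n s N : ℕ} {A : Fin n → ℤ} {B : ℤ} {x : Fin s → Fin n → ℤ} :
    x ∈ energyFiber n s N A B ↔ (∀ i j, -(N : ℤ) ≤ x i j ∧ x i j ≤ N) ∧
      (∀ j, ∑ i, x i j = A j) ∧ ∑ i, ∑ j, (x i j) ^ 2 = B := by
  simp only [energyFiber, Finset.mem_filter, Fintype.mem_piFinset, mem_latticeBox]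

theorem le_of_mem_energyFiber {n s N : ℕ} {A : Fin n → ℤ} {B : ℤ} {x : Fin s → Fin n → ℤ}
    (hx : x ∈ energyFiber n s N A B) : B ≤ s * n * N ^ 2 := by
  obtain ⟨h1, -, h2⟩ := mem_energyFiber.1 hx
  rw [← h2]
  calc ∑ i, ∑ j, (x i j) ^ 2 ≤ ∑ _i : Fin s, ∑ _j : Fin n, (N : ℤ) ^ 2 :=
        Finset.sum_le_sum fun i _ => Finset.sum_le_sum fun j _ =>
          sq_le_sq' (h1 i j).1 (h1 i j).2
    _ = _ := by simp [mul_assoc]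

theorem sum_norm_gridWave_pow_le {n s R N : ℕ} [NeZero R] {b : (Fin n → ℤ) → ℂ} {r : ℝ}
    (hR : 2 * (s * N) < R) (hR' : s * n * N ^ 2 < R)
    (hr : ∀ A B, ((energyFiber n s N A B).card : ℝ) ≤ r) :
    ∑ g, ‖gridWave n R N b g‖ ^ (2 * s) ≤
      (R : ℝ) ^ (n + 1) * (r * (∑ ξ ∈ latticeBox n N, ‖b ξ‖ ^ 2) ^ s) := by
  classical
  set P : Finset (Fin s → Fin n → ℤ) := Fintype.piFinset fun _ => latticeBox n N with hP
  set Φ : (Fin s → Fin n → ℤ) → ZMod R × (Fin n → ZMod R) := fun x =>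
    ∑ i, parabPoint n R (x i) with hΦ
  set F : ZMod R × (Fin n → ZMod R) → ℂ := fun h => ∑ x ∈ P with Φ x = h, ∏ i, b (x i) with hF
  have hpow : ∀ g, gridWave n R N b g ^ s = gridFourier F g := by
    intro g
    have h1 : gridWave n R N b g ^ s = ∏ _i : Fin s, gridWave n R N b g := by simp
    rw [h1]
    simp only [gridWave, gridFourier, hF]
    rw [Finset.prod_univ_sum]
    simp only [Finset.sum_mul]
    rw [← Finset.sum_fiberwise P Φ]
    refine Finset.sum_congr rfl fun h _ => Finset.sum_congr rfl fun x hx => ?_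
    rw [Finset.prod_mul_distrib, gridChar_comm, ← (Finset.mem_filter.1 hx).2, hΦ, gridChar_sum_left]
  have hfib : ∀ h, ((P.filter fun x => Φ x = h).card : ℝ) ≤ r := by
    intro h
    rcases (P.filter fun x => Φ x = h).eq_empty_or_nonempty with he | ⟨x₀, hx₀⟩
    · rw [he, Finset.card_empty, Nat.cast_zero]
      exact (Nat.cast_nonneg _).trans (hr 0 0)
    refine le_trans ?_ (hr (fun j => ∑ i, x₀ i j) (∑ i, ∑ j, (x₀ i j) ^ 2))
    refine Nat.cast_le.2 (Finset.card_le_card fun x hx => ?_)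
    rw [Finset.mem_filter] at hx hx₀
    have hmem : ∀ y ∈ P, ∀ i j, -(N : ℤ) ≤ y i j ∧ y i j ≤ N := fun y hy i j =>
      mem_latticeBox.1 (Fintype.mem_piFinset.1 hy i) j
    have hlin : ∀ y ∈ P, ∀ j, |∑ i, y i j| ≤ s * N := by
      intro y hy j
      refine (Finset.abs_sum_le_sum_abs _ _).trans ?_
      refine (Finset.sum_le_card_nsmul _ _ (N : ℤ) fun i _ => abs_le.2 (hmem y hy i j)).trans ?_
      simp
    have hsq : ∀ y ∈ P, ∑ i, ∑ j, (y i j) ^ 2 ≤ s * n * N ^ 2 := fun y hy =>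
      le_of_mem_energyFiber (mem_energyFiber.2 ⟨hmem y hy, fun _ => rfl, rfl⟩)
    have hΦeq : Φ x = Φ x₀ := hx.2.trans hx₀.2.symm
    simp only [hΦ, Prod.ext_iff, Prod.fst_sum, Prod.snd_sum, parabPoint] at hΦeq
    refine mem_energyFiber.2 ⟨hmem x hx.1, fun j => ?_, ?_⟩
    · have h2 := congrFun hΦeq.2 j
      simp only [Finset.sum_apply] at h2
      rw [← Int.cast_sum, ← Int.cast_sum, ZMod.intCast_eq_intCast_iff_dvd_sub] at h2
      have h3 := Int.eq_zero_of_abs_lt_dvd h2 (by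
        refine (abs_sub _ _).trans_lt ?_
        have := hlin x hx.1 j
        have := hlin x₀ hx₀.1 j
        have : (2 * (s * N) : ℤ) < R := by exact_mod_cast hR
        linarith)
      linarith
    · have h2 : ((∑ i, ∑ j, (x i j) ^ 2 : ℤ) : ZMod R) = ((∑ i, ∑ j, (x₀ i j) ^ 2 : ℤ) : ZMod R) := by
        have := hΦeq.1
        simp only [Finset.sum_neg_distrib, neg_inj] at this
        push_cast
        exact this
      rw [ZMod.intCast_eq_intCast_iff_dvd_sub] at h2
      have h3 := Int.eq_zero_of_abs_lt_dvd h2 (by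
        have := hsq x hx.1
        have := hsq x₀ hx₀.1
        have : 0 ≤ ∑ i, ∑ j, (x i j) ^ 2 := by positivity
        have : 0 ≤ ∑ i, ∑ j, (x₀ i j) ^ 2 := by positivity
        have : (s * n * N ^ 2 : ℤ) < R := by exact_mod_cast hR'
        rw [abs_lt]
        constructor <;> linarith)
      linarith
  calc ∑ g, ‖gridWave n R N b g‖ ^ (2 * s) = ∑ g, ‖gridFourier F g‖ ^ 2 := by
        refine Finset.sum_congr rfl fun g _ => ?_
        rw [← hpow, norm_pow, ← pow_mul, mul_comm]
    _ = (R : ℝ) ^ (n + 1) * ∑ h, ‖F h‖ ^ 2 := sum_norm_gridFourier_sq F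
    _ ≤ (R : ℝ) ^ (n + 1) * ∑ h, r * ∑ x ∈ P with Φ x = h, ∏ i, ‖b (x i)‖ ^ 2 := by
        gcongr with h
        calc ‖F h‖ ^ 2 ≤ (∑ x ∈ P with Φ x = h, 1 * ‖∏ i, b (x i)‖) ^ 2 := by
              simp only [one_mul]
              gcongr
              exact norm_sum_le _ _
          _ ≤ (∑ x ∈ P with Φ x = h, (1 : ℝ) ^ 2) * ∑ x ∈ P with Φ x = h, ‖∏ i, b (x i)‖ ^ 2 :=
            Finset.sum_mul_sq_le_sq_mul_sq _ _ _
          _ ≤ r * ∑ x ∈ P with Φ x = h, ∏ i, ‖b (x i)‖ ^ 2 := by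
            simp only [norm_prod, Finset.prod_pow]
            gcongr
            simpa using hfib h
    _ = (R : ℝ) ^ (n + 1) * (r * (∑ ξ ∈ latticeBox n N, ‖b ξ‖ ^ 2) ^ s) := by
        rw [← Finset.mul_sum, Finset.sum_fiberwise]
        have h1 : (∑ ξ ∈ latticeBox n N, ‖b ξ‖ ^ 2) ^ s =
          ∏ _i : Fin s, ∑ ξ ∈ latticeBox n N, ‖b ξ‖ ^ 2 := by simp
        rw [h1, Finset.prod_univ_sum]

theorem card_energyFiber_one_le (n N : ℕ) (A : Fin n → ℤ) (B : ℤ) :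
    (energyFiber n 1 N A B).card ≤ 1 := by
  refine Finset.card_le_one.2 fun x hx y hy => ?_
  have h1 := (mem_energyFiber.1 hx).2.1
  have h2 := (mem_energyFiber.1 hy).2.1
  funext i j
  rw [Subsingleton.elim i 0]
  simpa using (h1 j).trans (h2 j).symm

theorem exists_card_representations_le_rpow_of_le (D : ℕ) (hD : 1 ≤ D) {ρ : ℝ} (hρ : 0 < ρ) :
    ∃ C : ℝ, 1 ≤ C ∧ ∀ (N : ℕ) (m : ℤ), 1 ≤ N → m ≤ 18 * N ^ 2 → ∀ S : Finset (ℤ × ℤ),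
      (∀ z ∈ S, z.1 ^ 2 + (D : ℤ) * z.2 ^ 2 = m) → (S.card : ℝ) ≤ C * (N : ℝ) ^ ρ := by
  obtain ⟨C, hC1, hC⟩ := exists_card_representations_le_rpow D hD (ρ / 2) (by linarith)
  have h18 : (1 : ℝ) ≤ 18 ^ (ρ / 2) := Real.one_le_rpow (by norm_num) (by linarith)
  have hC2 : 1 ≤ C * 18 ^ (ρ / 2) := one_le_mul_of_one_le_of_one_le hC1 h18
  refine ⟨C * 18 ^ (ρ / 2), hC2, fun N m hN hm S hS => ?_⟩
  have hN1 : (1 : ℝ) ≤ N := by exact_mod_cast hN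
  rcases le_or_gt m 0 with h0 | h0
  · have hS0 : S ⊆ {0} := by
      intro z hz
      have h := hS z hz
      have hD' : (1 : ℤ) ≤ D := by exact_mod_cast hD
      have h1 : z.2 ^ 2 ≤ D * z.2 ^ 2 := le_mul_of_one_le_left (sq_nonneg _) hD'
      have h2 : z.1 = 0 := pow_eq_zero_iff (two_ne_zero) |>.1 (by nlinarith [sq_nonneg z.1, sq_nonneg z.2])
      have h3 : z.2 = 0 := pow_eq_zero_iff (two_ne_zero) |>.1 (by nlinarith [sq_nonneg z.1, sq_nonneg z.2])
      exact Finset.mem_singleton.2 (Prod.ext h2 h3)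
    have h1 : (S.card : ℝ) ≤ 1 := by exact_mod_cast Finset.card_le_card hS0
    exact h1.trans (one_le_mul_of_one_le_of_one_le hC2 (Real.one_le_rpow hN1 hρ.le))
  · lift m to ℕ using h0.le
    refine (hC m (by exact_mod_cast h0.ne') S hS).trans ?_
    have h1 : (m : ℝ) ≤ 18 * (N : ℝ) ^ 2 := by exact_mod_cast hm
    have h2 : (m : ℝ) ^ (ρ / 2) ≤ 18 ^ (ρ / 2) * (N : ℝ) ^ ρ := by
      calc (m : ℝ) ^ (ρ / 2) ≤ (18 * (N : ℝ) ^ 2) ^ (ρ / 2) := by gcongr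
        _ = _ := by
          rw [Real.mul_rpow (by norm_num) (by positivity), ← Real.rpow_natCast (N : ℝ) 2,
            ← Real.rpow_mul (by positivity)]
          congr 2
          push_cast
          ring
    rw [mul_assoc]
    gcongr

theorem exists_card_energyFiber_one_three_le {ρ : ℝ} (hρ : 0 < ρ) :
    ∃ C : ℝ, 1 ≤ C ∧ ∀ N, 1 ≤ N → ∀ A B, ((energyFiber 1 3 N A B).card : ℝ) ≤ C * (N : ℝ) ^ ρ := by
  obtain ⟨C, hC1, hC⟩ := exists_card_representations_le_rpow_of_le 3 (by norm_num) hρ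
  refine ⟨C, hC1, fun N hN A B => ?_⟩
  rcases (energyFiber 1 3 N A B).eq_empty_or_nonempty with he | ⟨x₀, hx₀⟩
  · rw [he, Finset.card_empty, Nat.cast_zero]
    positivity
  have hB := le_of_mem_energyFiber hx₀
  set φ : (Fin 3 → Fin 1 → ℤ) → ℤ × ℤ := fun x => (3 * x 2 0 - A 0, x 0 0 - x 1 0) with hφ
  have hinj : Set.InjOn φ (energyFiber 1 3 N A B) := by
    intro x hx y hy h
    have h1 := (mem_energyFiber.1 hx).2.1 0
    have h2 := (mem_energyFiber.1 hy).2.1 0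
    simp only [Fin.sum_univ_three] at h1 h2
    simp only [hφ, Prod.mk.injEq] at h
    funext i j
    rw [Subsingleton.elim j 0]
    fin_cases i <;> simp <;> omega
  rw [← Finset.card_image_of_injOn hinj]
  refine hC N (6 * B - 2 * A 0 ^ 2) hN (by push_cast at hB; nlinarith [sq_nonneg (A 0)]) _ fun z hz => ?_
  obtain ⟨x, hx, rfl⟩ := Finset.mem_image.1 hz
  have h1 := (mem_energyFiber.1 hx).2.1 0
  have h2 := (mem_energyFiber.1 hx).2.2
  simp only [Fin.sum_univ_three, Fin.sum_univ_one] at h1 h2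
  rw [hφ, ← h1, ← h2]
  push_cast
  ring

theorem exists_card_energyFiber_two_two_le {ρ : ℝ} (hρ : 0 < ρ) :
    ∃ C : ℝ, 1 ≤ C ∧ ∀ N, 1 ≤ N → ∀ A B, ((energyFiber 2 2 N A B).card : ℝ) ≤ C * (N : ℝ) ^ ρ := by
  obtain ⟨C, hC1, hC⟩ := exists_card_representations_le_rpow_of_le 1 le_rfl hρ
  refine ⟨C, hC1, fun N hN A B => ?_⟩
  rcases (energyFiber 2 2 N A B).eq_empty_or_nonempty with he | ⟨x₀, hx₀⟩
  · rw [he, Finset.card_empty, Nat.cast_zero]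
    positivity
  have hB := le_of_mem_energyFiber hx₀
  set φ : (Fin 2 → Fin 2 → ℤ) → ℤ × ℤ := fun x => (2 * x 0 0 - A 0, 2 * x 0 1 - A 1) with hφ
  have hinj : Set.InjOn φ (energyFiber 2 2 N A B) := by
    intro x hx y hy h
    have h1 := (mem_energyFiber.1 hx).2.1
    have h2 := (mem_energyFiber.1 hy).2.1
    simp only [Fin.sum_univ_two] at h1 h2
    have h10 := h1 0
    have h11 := h1 1
    have h20 := h2 0
    have h21 := h2 1
    simp only [hφ, Prod.mk.injEq] at h
    funext i j
    fin_cases i <;> fin_cases j <;> simp <;> omega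
  rw [← Finset.card_image_of_injOn hinj]
  refine hC N (2 * B - A 0 ^ 2 - A 1 ^ 2) hN
    (by push_cast at hB; nlinarith [sq_nonneg (A 0), sq_nonneg (A 1)]) _ fun z hz => ?_
  obtain ⟨x, hx, rfl⟩ := Finset.mem_image.1 hz
  have h1 := (mem_energyFiber.1 hx).2.1
  have h2 := (mem_energyFiber.1 hx).2.2
  simp only [Fin.sum_univ_two] at h1 h2
  rw [hφ, ← h1, ← h1, ← h2]
  push_cast
  ring

theorem exists_card_energyFiber_three_two_le {ρ : ℝ} (hρ : 0 < ρ) :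
    ∃ C : ℝ, 1 ≤ C ∧ ∀ N, 1 ≤ N → ∀ A B,
      ((energyFiber 3 2 N A B).card : ℝ) ≤ C * (N : ℝ) ^ (1 + ρ) := by
  obtain ⟨C, hC1, hC⟩ := exists_card_representations_le_rpow_of_le 1 le_rfl hρ
  refine ⟨3 * C, by linarith, fun N hN A B => ?_⟩
  have hN1 : (1 : ℝ) ≤ N := by exact_mod_cast hN
  rcases (energyFiber 3 2 N A B).eq_empty_or_nonempty with he | ⟨x₀, hx₀⟩
  · rw [he, Finset.card_empty, Nat.cast_zero]
    positivity
  have hB := le_of_mem_energyFiber hx₀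
  set φ : (Fin 2 → Fin 3 → ℤ) → ℤ × ℤ := fun x => (2 * x 0 0 - A 0, 2 * x 0 1 - A 1) with hφ
  have hmaps : ∀ x ∈ energyFiber 3 2 N A B, x 0 2 ∈ Finset.Icc (-(N : ℤ)) N := fun x hx =>
    Finset.mem_Icc.2 ((mem_energyFiber.1 hx).1 0 2)
  have hslice : ∀ c : ℤ, (((energyFiber 3 2 N A B).filter fun x => x 0 2 = c).card : ℝ) ≤
      C * (N : ℝ) ^ ρ := by
    intro c
    have hinj : Set.InjOn φ ((energyFiber 3 2 N A B).filter fun x => x 0 2 = c) := by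
      intro x hx y hy h
      obtain ⟨hx, hxc⟩ := Finset.mem_filter.1 hx
      obtain ⟨hy, hyc⟩ := Finset.mem_filter.1 hy
      have h1 := (mem_energyFiber.1 hx).2.1
      have h2 := (mem_energyFiber.1 hy).2.1
      simp only [Fin.sum_univ_two] at h1 h2
      have h10 := h1 0
      have h11 := h1 1
      have h12 := h1 2
      have h20 := h2 0
      have h21 := h2 1
      have h22 := h2 2
      simp only [hφ, Prod.mk.injEq] at h
      funext i j
      fin_cases i <;> fin_cases j <;> simp <;> omega
    rw [← Finset.card_image_of_injOn hinj]
    refine hC N (2 * B - A 0 ^ 2 - A 1 ^ 2 - A 2 ^ 2 - (2 * c - A 2) ^ 2) hN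
      (by push_cast at hB; nlinarith [sq_nonneg (A 0), sq_nonneg (A 1), sq_nonneg (A 2),
        sq_nonneg (2 * c - A 2)]) _ fun z hz => ?_
    obtain ⟨x, hx, rfl⟩ := Finset.mem_image.1 hz
    obtain ⟨hx, hxc⟩ := Finset.mem_filter.1 hx
    have h1 := (mem_energyFiber.1 hx).2.1
    have h2 := (mem_energyFiber.1 hx).2.2
    simp only [Fin.sum_univ_two, Fin.sum_univ_three] at h1 h2
    rw [hφ, ← h1, ← h1, ← h1, ← h2, ← hxc]
    push_cast
    ring
  rw [Finset.card_eq_sum_card_fiberwise hmaps]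
  push_cast
  calc _ ≤ ∑ _c ∈ Finset.Icc (-(N : ℤ)) N, C * (N : ℝ) ^ ρ := Finset.sum_le_sum fun c _ => hslice c
    _ = (2 * N + 1 : ℝ) * (C * (N : ℝ) ^ ρ) := by
      rw [Finset.sum_const, nsmul_eq_mul, Int.card_Icc]
      congr 1
      have : ((N : ℤ) + 1 - -(N : ℤ)).toNat = 2 * N + 1 := by omega
      rw [this]
      push_cast
      ring
    _ ≤ (3 * N : ℝ) * (C * (N : ℝ) ^ ρ) := by
      gcongr
      linarith
    _ = _ := by
      rw [Real.rpow_add (by linarith), Real.rpow_one]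
      ring

/-- Interpolates an even moment bound for small values with a weak-type bound for large values. -/
theorem sum_rpow_le_of_weakType {G : Type*} [Fintype G] (u : G → ℝ) {s : ℕ} {p q t₀ L K₁ K₂ : ℝ}
    (hu : ∀ g, 0 ≤ u g) (huL : ∀ g, u g ≤ L) (hL : 0 < L) (ht₀ : 0 < t₀) (hs : 2 * (s : ℝ) ≤ p)
    (hp : 0 < p) (hqp : q < p) (hq : 0 ≤ q) (hK₂ : 0 ≤ K₂)
    (hlow : ∑ g, u g ^ (2 * s) ≤ K₁)
    (hweak : ∀ t, t₀ ≤ t → ∀ E : Finset G, (∀ g ∈ E, t ≤ u g) → (E.card : ℝ) ≤ K₂ * t ^ (-q)) :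
    ∑ g, u g ^ p ≤ t₀ ^ (p - 2 * s) * K₁ +
      2 ^ q * (1 - 2 ^ (-(p - q)))⁻¹ * K₂ * L ^ (p - q) := by
  classical
  obtain ⟨I, hI⟩ := pow_unbounded_of_one_lt (L / t₀) (one_lt_two (α := ℝ))
  set T : ℕ → Finset G := fun i => Finset.univ.filter fun g => t₀ ≤ u g ∧ L / 2 ^ (i + 1) ≤ u g with hT
  have hpt : ∀ g, u g ^ p ≤ t₀ ^ (p - 2 * s) * u g ^ (2 * s) +
      ∑ i ∈ Finset.range I, if g ∈ T i then (L / 2 ^ i) ^ p else 0 := by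
    intro g
    rcases lt_or_ge (u g) t₀ with h | h
    · have h1 : u g ^ p ≤ t₀ ^ (p - 2 * s) * u g ^ (2 * s) := by
        rcases (hu g).eq_or_lt with h0 | h0
        · rw [← h0, Real.zero_rpow hp.ne']
          positivity
        · have : u g ^ p = u g ^ (p - 2 * s) * u g ^ (2 * s) := by
            rw [← Real.rpow_natCast (u g), ← Real.rpow_add h0]
            congr 1
            push_cast
            ring
          rw [this]
          gcongr
      refine h1.trans (le_add_of_nonneg_right (Finset.sum_nonneg fun i _ => ?_))
      split_ifs <;> positivity
    · have h0 : 0 < u g := ht₀.trans_le h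
      obtain ⟨i, hi1, hi2⟩ := exists_nat_pow_near ((one_le_div h0).2 (huL g)) (one_lt_two (α := ℝ))
      have hiI : i < I := by
        refine (pow_lt_pow_iff_right₀ (one_lt_two (α := ℝ))).1 (lt_of_le_of_lt ?_ hI)
        exact hi1.trans (div_le_div_of_nonneg_left hL.le ht₀ h)
      have hgT : g ∈ T i := by
        refine Finset.mem_filter.2 ⟨Finset.mem_univ _, h, ?_⟩
        rw [div_lt_iff₀ h0] at hi2
        rw [div_le_iff₀ (by positivity)]
        linarith
      have h1 : u g ^ p ≤ if g ∈ T i then (L / 2 ^ i) ^ p else 0 := by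
        rw [if_pos hgT]
        refine Real.rpow_le_rpow (hu g) ?_ hp.le
        rw [le_div_iff₀ (by positivity)]
        rw [le_div_iff₀ h0] at hi1
        linarith
      have h2 := Finset.single_le_sum (f := fun i => if g ∈ T i then (L / 2 ^ i) ^ p else 0)
        (fun j _ => by split_ifs <;> positivity) (Finset.mem_range.2 hiI)
      have h3 : 0 ≤ t₀ ^ (p - 2 * s) * u g ^ (2 * s) := by have := hu g; positivity
      linarith
  have hcard : ∀ i, ((T i).card : ℝ) ≤ K₂ * (L / 2 ^ (i + 1)) ^ (-q) := by
    intro i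
    refine (hweak (max t₀ (L / 2 ^ (i + 1))) (le_max_left _ _) (T i) fun g hg =>
      max_le (Finset.mem_filter.1 hg).2.1 (Finset.mem_filter.1 hg).2.2).trans ?_
    refine mul_le_mul_of_nonneg_left ?_ hK₂
    exact Real.rpow_le_rpow_of_nonpos (by positivity) (le_max_right _ _) (by linarith)
  set r : ℝ := 2 ^ (-(p - q)) with hr
  have hr0 : 0 ≤ r := by positivity
  have hr1 : r < 1 := Real.rpow_lt_one_of_one_lt_of_neg one_lt_two (by linarith)
  have hterm : ∀ i : ℕ, (L / 2 ^ i) ^ p * (K₂ * (L / 2 ^ (i + 1)) ^ (-q)) =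
      2 ^ q * K₂ * L ^ (p - q) * r ^ i := by
    intro i
    have h2 : (0 : ℝ) < 2 ^ i := by positivity
    have hy : 0 < L / 2 ^ i := by positivity
    have e1 : L / 2 ^ (i + 1) = (L / 2 ^ i) / 2 := by rw [pow_succ, div_div]
    have e2 : L ^ (p - q) * r ^ i = (L / 2 ^ i) ^ (p - q) := by
      rw [hr, Real.div_rpow hL.le h2.le, ← Real.rpow_natCast, ← Real.rpow_natCast,
        ← Real.rpow_mul (by norm_num), ← Real.rpow_mul (by norm_num), mul_comm _ (i : ℝ), mul_neg,
        Real.rpow_neg (by norm_num), ← div_eq_mul_inv]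
    rw [mul_assoc _ _ (r ^ i), e2, e1]
    generalize L / 2 ^ i = y at hy
    rw [Real.div_rpow hy.le (by norm_num), Real.rpow_neg (by norm_num : (0:ℝ) ≤ 2), sub_eq_add_neg,
      Real.rpow_add hy]
    field_simp
  calc ∑ g, u g ^ p ≤ ∑ g, (t₀ ^ (p - 2 * s) * u g ^ (2 * s) +
        ∑ i ∈ Finset.range I, if g ∈ T i then (L / 2 ^ i) ^ p else 0) :=
        Finset.sum_le_sum fun g _ => hpt g
    _ = t₀ ^ (p - 2 * s) * ∑ g, u g ^ (2 * s) +
        ∑ i ∈ Finset.range I, (L / 2 ^ i) ^ p * (T i).card := by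
        rw [Finset.sum_add_distrib, ← Finset.mul_sum, Finset.sum_comm]
        congr 1
        refine Finset.sum_congr rfl fun i _ => ?_
        rw [← Finset.sum_filter, Finset.filter_univ_mem, Finset.sum_const, nsmul_eq_mul, mul_comm]
    _ ≤ t₀ ^ (p - 2 * s) * K₁ + ∑ i ∈ Finset.range I, 2 ^ q * K₂ * L ^ (p - q) * r ^ i := by
        refine add_le_add (by gcongr) (Finset.sum_le_sum fun i _ => ?_)
        exact (mul_le_mul_of_nonneg_left (hcard i) (by positivity)).trans_eq (hterm i)
    _ ≤ t₀ ^ (p - 2 * s) * K₁ + 2 ^ q * K₂ * L ^ (p - q) * (1 - r)⁻¹ := by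
        rw [← Finset.mul_sum]
        gcongr
        rw [← tsum_geometric_of_lt_one hr0 hr1]
        exact (summable_geometric_of_lt_one hr0 hr1).sum_le_tsum _ fun i _ => by positivity
    _ = _ := by ring

theorem AdmissibleStrichartz.one_le {n : ℕ} {p : ℝ} (h : AdmissibleStrichartz n p) : 1 ≤ n := by
  rcases h with h | h | h <;> omega

theorem AdmissibleStrichartz.lt {n : ℕ} {p : ℝ} (h : AdmissibleStrichartz n p) :
    2 + 4 / (n : ℝ) < p := by
  rcases h with ⟨rfl, h⟩ | ⟨rfl | rfl, h⟩ | ⟨hn, h⟩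
  · norm_num; linarith
  · norm_num; linarith
  · norm_num; linarith
  · refine lt_of_lt_of_le ?_ h
    have : (0 : ℝ) < n := by exact_mod_cast (by omega : 0 < n)
    rw [lt_div_iff₀ this, add_mul, div_mul_cancel₀ _ this.ne']
    linarith

theorem AdmissibleStrichartz.exists_card_energyFiber_le {n : ℕ} {p : ℝ}
    (h : AdmissibleStrichartz n p) :
    ∃ (s : ℕ) (r C : ℝ), s ≤ 3 ∧ 2 * (s : ℝ) ≤ p ∧
      n / 4 * (p - 2 * s) + r ≤ n * p / 2 - (n + 2) ∧ 1 ≤ C ∧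
      ∀ N, 1 ≤ N → ∀ A B, ((energyFiber n s N A B).card : ℝ) ≤ C * (N : ℝ) ^ r := by
  have hlt := h.lt
  rcases h with ⟨rfl, h⟩ | ⟨rfl | rfl, h⟩ | ⟨hn, h⟩
  · obtain ⟨C, hC1, hC⟩ := exists_card_energyFiber_one_three_le (ρ := (p - 6) / 4) (by linarith)
    exact ⟨3, _, C, le_rfl, by norm_num; linarith, by norm_num; linarith, hC1, hC⟩
  · obtain ⟨C, hC1, hC⟩ := exists_card_energyFiber_two_two_le (ρ := (p - 4) / 2) (by linarith)
    exact ⟨2, _, C, by norm_num, by norm_num; linarith, by norm_num; linarith, hC1, hC⟩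
  · obtain ⟨C, hC1, hC⟩ := exists_card_energyFiber_three_two_le (ρ := 3 * (p - 4) / 4) (by linarith)
    exact ⟨2, _, C, by norm_num, by norm_num; linarith, by norm_num; linarith, hC1, hC⟩
  · have hn0 : (0 : ℝ) < n := by exact_mod_cast (by omega : 0 < n)
    have h4 : 0 ≤ 4 / (n : ℝ) := by positivity
    refine ⟨1, 0, 1, by norm_num, by norm_num; linarith, ?_, le_rfl, fun N hN A B => ?_⟩
    · rw [div_le_iff₀ hn0] at h
      push_cast
      linarith
    · rw [Real.rpow_zero, mul_one]
      exact_mod_cast card_energyFiber_one_le n N A B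

theorem exists_sum_norm_gridWave_rpow_le_of_sum_le_one {n : ℕ} {p : ℝ}
    (h : AdmissibleStrichartz n p) :
    ∃ C : ℝ, 0 < C ∧ ∀ N R : ℕ, 1 ≤ N → 6 * n * N ^ 2 < R → (∀ q, 1 ≤ q → q ≤ N → q ∣ R) →
      ∀ [NeZero R], ∀ b : (Fin n → ℤ) → ℂ, ∑ ξ ∈ latticeBox n N, ‖b ξ‖ ^ 2 ≤ 1 →
      ∑ g, ‖gridWave n R N b g‖ ^ p ≤
        C * (R : ℝ) ^ (n + 1) * (N : ℝ) ^ (n * p / 2 - (n + 2) : ℝ) := by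
  have hn := h.one_le
  have hlt := h.lt
  obtain ⟨s, r, A, hs3, hsp, hr, hA1, hA⟩ := h.exists_card_energyFiber_le
  set ε : ℝ := (p - (2 + 4 / n)) * n / 8 with hεdef
  have hε : 0 < ε := by
    have : 0 < p - (2 + 4 / n) := by linarith
    positivity
  obtain ⟨W, hW1, hW⟩ := exists_card_superlevel_le hn hε
  set q : ℝ := 2 + 4 / n * (1 + ε) with hq
  have hqn : n * q = 2 * n + 4 * (1 + ε) := by rw [hq]; field_simp
  have hqp : q < p := by
    have : q = 2 + 4 / n + (p - (2 + 4 / n)) / 2 := by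
      rw [hq, hεdef]; field_simp; ring
    linarith
  have hq0 : 0 ≤ q := by rw [hq]; positivity
  have hp0 : 0 < p := hq0.trans_lt hqp
  have hgeom : 0 < (1 - (2 : ℝ) ^ (-(p - q)))⁻¹ :=
    inv_pos.2 (sub_pos.2 (Real.rpow_lt_one_of_one_lt_of_neg one_lt_two (by linarith)))
  refine ⟨W ^ (p - 2 * s) * A + 2 ^ q * (1 - (2 : ℝ) ^ (-(p - q)))⁻¹ * W * 3 ^ (n * (p - q) / 2),
    by positivity, fun N R hN hR hdiv _ b hb => ?_⟩
  have hN1 : (1 : ℝ) ≤ N := by exact_mod_cast hN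
  have hN0 : (0 : ℝ) < N := by linarith
  have hlow : ∑ g, ‖gridWave n R N b g‖ ^ (2 * s) ≤ (R : ℝ) ^ (n + 1) * (A * (N : ℝ) ^ r) := by
    refine (sum_norm_gridWave_pow_le (r := A * (N : ℝ) ^ r) ?_ ?_ (hA N hN)).trans ?_
    · have : s * N ≤ 3 * N := Nat.mul_le_mul_right _ hs3
      nlinarith
    · have : s * n * N ^ 2 ≤ 3 * n * N ^ 2 :=
        Nat.mul_le_mul_right _ (Nat.mul_le_mul_right _ hs3)
      nlinarith
    · refine mul_le_mul_of_nonneg_left ?_ (by positivity)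
      exact mul_le_of_le_one_right (by positivity) (pow_le_one₀ (by positivity) hb)
  have hsup : ∀ g, ‖gridWave n R N b g‖ ≤ (3 * N : ℝ) ^ (n / 2 : ℝ) := by
    intro g
    refine le_of_sq_le_sq ?_ (by positivity)
    refine (norm_gridWave_sq_le hN hb g).trans_eq ?_
    rw [← Real.rpow_natCast, ← Real.rpow_natCast _ 2, ← Real.rpow_mul (by positivity)]
    congr 1
    push_cast
    ring
  have key := sum_rpow_le_of_weakType (fun g => ‖gridWave n R N b g‖) (s := s) (p := p) (q := q)
    (t₀ := W * (N : ℝ) ^ (n / 4 : ℝ)) (L := (3 * N : ℝ) ^ (n / 2 : ℝ))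
    (K₂ := W * (R : ℝ) ^ (n + 1) * (N : ℝ) ^ (2 * ε))
    (fun g => norm_nonneg _) hsup (by positivity) (by positivity) hsp hp0 hqp hq0 (by positivity)
    hlow (fun t ht E hE => hW N R hN (by nlinarith) (by nlinarith) hdiv E b t hb ht hE)
  refine key.trans ?_
  have e1 : (W * (N : ℝ) ^ (n / 4 : ℝ)) ^ (p - 2 * s) * ((R : ℝ) ^ (n + 1) * (A * (N : ℝ) ^ r)) ≤
      W ^ (p - 2 * s) * A * ((R : ℝ) ^ (n + 1) * (N : ℝ) ^ (n * p / 2 - (n + 2) : ℝ)) := by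
    rw [Real.mul_rpow (by positivity) (by positivity), ← Real.rpow_mul hN0.le]
    calc _ = W ^ (p - 2 * s) * A * ((R : ℝ) ^ (n + 1) *
        ((N : ℝ) ^ (n / 4 * (p - 2 * s) : ℝ) * (N : ℝ) ^ r)) := by ring
      _ ≤ _ := by
        rw [← Real.rpow_add hN0]
        gcongr
  have e2 : (N : ℝ) ^ (2 * ε) * ((3 * N : ℝ) ^ (n / 2 : ℝ)) ^ (p - q) =
      3 ^ (n * (p - q) / 2) * (N : ℝ) ^ (n * p / 2 - (n + 2) : ℝ) := by
    rw [← Real.rpow_mul (by positivity), Real.mul_rpow (by norm_num) hN0.le, mul_left_comm,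
      ← Real.rpow_add hN0]
    congr 2
    · ring
    · linarith
  calc _ ≤ W ^ (p - 2 * s) * A * ((R : ℝ) ^ (n + 1) * (N : ℝ) ^ (n * p / 2 - (n + 2) : ℝ)) +
        2 ^ q * (1 - (2 : ℝ) ^ (-(p - q)))⁻¹ * W * (R : ℝ) ^ (n + 1) *
          ((N : ℝ) ^ (2 * ε) * ((3 * N : ℝ) ^ (n / 2 : ℝ)) ^ (p - q)) := by
        refine add_le_add e1 (le_of_eq ?_)
        ring
    _ = _ := by
        rw [e2]
        ring

/-- The discrete Strichartz estimate on the grid. -/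
theorem exists_sum_norm_gridWave_rpow_le {n : ℕ} {p : ℝ} (h : AdmissibleStrichartz n p) :
    ∃ C : ℝ, 0 < C ∧ ∀ N R : ℕ, 1 ≤ N → 6 * n * N ^ 2 < R → (∀ q, 1 ≤ q → q ≤ N → q ∣ R) →
      ∀ [NeZero R], ∀ b : (Fin n → ℤ) → ℂ,
      ∑ g, ‖gridWave n R N b g‖ ^ p ≤ C * (R : ℝ) ^ (n + 1) *
        (N : ℝ) ^ (n * p / 2 - (n + 2) : ℝ) * √(∑ ξ ∈ latticeBox n N, ‖b ξ‖ ^ 2) ^ p := by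
  obtain ⟨C, hC0, hC⟩ := exists_sum_norm_gridWave_rpow_le_of_sum_le_one h
  have hp0 : 0 < p := lt_trans (by positivity) h.lt
  refine ⟨C, hC0, fun N R hN hR hdiv _ b => ?_⟩
  set σ := √(∑ ξ ∈ latticeBox n N, ‖b ξ‖ ^ 2) with hσ
  have hσ2 : σ ^ 2 = ∑ ξ ∈ latticeBox n N, ‖b ξ‖ ^ 2 := Real.sq_sqrt (by positivity)
  rcases (Real.sqrt_nonneg (∑ ξ ∈ latticeBox n N, ‖b ξ‖ ^ 2)).eq_or_lt with h0 | h0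
  · have hb : ∀ ξ ∈ latticeBox n N, b ξ = 0 := by
      rw [← hσ] at h0
      rw [← h0, zero_pow two_ne_zero] at hσ2
      intro ξ hξ
      have := (Finset.sum_eq_zero_iff_of_nonneg fun ξ _ => by positivity).1 hσ2.symm ξ hξ
      simpa using this
    have hU : ∀ g, gridWave n R N b g = 0 := fun g =>
      Finset.sum_eq_zero fun ξ hξ => by rw [hb ξ hξ, zero_mul]
    simp only [hU, norm_zero, Real.zero_rpow hp0.ne', Finset.sum_const_zero]
    positivity
  · rw [← hσ] at h0
    have h1 := hC N R hN hR hdiv (fun ξ => (σ : ℂ)⁻¹ * b ξ) (by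
      simp only [norm_mul, mul_pow]
      rw [← Finset.mul_sum, ← hσ2, norm_inv, Complex.norm_real, Real.norm_of_nonneg h0.le, inv_pow,
        inv_mul_cancel₀ (by positivity)])
    have hU : ∀ g, ‖gridWave n R N (fun ξ => (σ : ℂ)⁻¹ * b ξ) g‖ ^ p =
        (σ ^ p)⁻¹ * ‖gridWave n R N b g‖ ^ p := by
      intro g
      have : gridWave n R N (fun ξ => (σ : ℂ)⁻¹ * b ξ) g = (σ : ℂ)⁻¹ * gridWave n R N b g := by
        simp only [gridWave, Finset.mul_sum, mul_assoc]
      rw [this, norm_mul, norm_inv, Complex.norm_real, Real.norm_of_nonneg h0.le,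
        Real.mul_rpow (by positivity) (norm_nonneg _), Real.inv_rpow h0.le]
    simp only [hU] at h1
    rw [← Finset.mul_sum, inv_mul_le_iff₀ (by positivity)] at h1
    linarith

noncomputable section

/-- The space-time torus on which the free waves live. -/
abbrev SpaceTimeTorus (n : ℕ) : Type :=
  AddCircle (2 * π) × (Fin n → AddCircle (2 * π))

/-- The plane wave of frequency `ξ` on the space-time torus. -/
def torusChar {n : ℕ} (ξ : Fin n → ℤ) (y : SpaceTimeTorus n) : ℂ :=
  fourier (-∑ i, (ξ i) ^ 2) y.1 * ∏ i, fourier (ξ i) (y.2 i)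

/-- The point of the `R`-torsion grid on the space-time torus with index `g`. -/
def gridPoint {n R : ℕ} (g : ZMod R × (Fin n → ZMod R)) : SpaceTimeTorus n :=
  (((g.1.val * (2 * π / R) : ℝ) : AddCircle (2 * π)),
    fun i => (((g.2 i).val * (2 * π / R) : ℝ) : AddCircle (2 * π)))

end

theorem fourier_apply_add {T : ℝ} (k : ℤ) (x y : AddCircle T) :
    fourier k (x + y) = fourier k x * fourier k y := by
  simp only [fourier_apply, smul_add, AddCircle.toCircle_add, Circle.coe_mul]

theorem norm_fourier_apply {T : ℝ} (k : ℤ) (x : AddCircle T) : ‖fourier k x‖ = 1 := by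
  rw [fourier_apply, Circle.norm_coe]

theorem fourier_coe_val_mul {R : ℕ} [NeZero R] (k : ℤ) (j : ZMod R) :
    fourier k (((j.val * (2 * π / R) : ℝ)) : AddCircle (2 * π)) = ZMod.stdAddChar ((k : ZMod R) * j) := by
  have h1 : (k : ZMod R) * j = ((k * (j.val : ℤ) : ℤ) : ZMod R) := by
    push_cast
    rw [ZMod.natCast_zmod_val]
  rw [h1, stdAddChar_intCast_eq_expCirc, fourier_coe_apply, expCirc]
  congr 1
  have : (R : ℂ) ≠ 0 := Nat.cast_ne_zero.2 (NeZero.ne R)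
  have : (π : ℂ) ≠ 0 := Complex.ofReal_ne_zero.2 Real.pi_ne_zero
  push_cast
  field_simp

theorem norm_torusChar {n : ℕ} (ξ : Fin n → ℤ) (y : SpaceTimeTorus n) : ‖torusChar ξ y‖ = 1 := by
  simp only [torusChar, norm_mul, norm_prod, norm_fourier_apply, Finset.prod_const_one, mul_one]

theorem torusChar_add {n : ℕ} (ξ : Fin n → ℤ) (y y' : SpaceTimeTorus n) :
    torusChar ξ (y + y') = torusChar ξ y * torusChar ξ y' := by
  simp only [torusChar, Prod.fst_add, Prod.snd_add, Pi.add_apply, fourier_apply_add,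
    Finset.prod_mul_distrib]
  ring

theorem torusChar_gridPoint {n R : ℕ} [NeZero R] (ξ : Fin n → ℤ)
    (g : ZMod R × (Fin n → ZMod R)) :
    torusChar ξ (gridPoint g) = gridChar (parabPoint n R ξ) g := by
  simp only [torusChar, gridPoint, fourier_coe_val_mul, gridChar, parabPoint,
    AddChar.map_add_eq_mul, stdAddChar_sum]
  push_cast
  rfl

theorem continuous_torusChar {n : ℕ} (ξ : Fin n → ℤ) : Continuous (torusChar ξ) := by
  unfold torusChar
  fun_prop

theorem torusChar_coe {n : ℕ} (ξ : Fin n → ℤ) (t : ℝ) (x : Fin n → ℝ) :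
    torusChar ξ ((t : AddCircle (2 * π)), fun i => (x i : AddCircle (2 * π))) =
      Complex.exp (Complex.I * (((∑ i, x i * (ξ i : ℝ)) - t * ∑ i, (ξ i : ℝ) ^ 2 : ℝ) : ℂ)) := by
  have h : ∀ (k : ℤ) (s : ℝ), fourier k (s : AddCircle (2 * π)) =
      Complex.exp (Complex.I * (k * s)) := by
    intro k s
    rw [fourier_coe_apply]
    congr 1
    push_cast
    field_simp
  simp only [torusChar, h]
  rw [← Complex.exp_sum, ← Complex.exp_add]
  congr 1
  push_cast
  rw [← Finset.mul_sum, ← mul_add]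
  congr 1
  rw [Finset.sum_congr rfl fun i _ => mul_comm (ξ i : ℂ) (x i : ℂ)]
  ring

/-- Galilean invariance on the grid. -/
theorem gridChar_parabPoint_add {n R : ℕ} [NeZero R] (c η : Fin n → ℤ)
    (g : ZMod R × (Fin n → ZMod R)) :
    gridChar (parabPoint n R (c + η)) g = gridChar (parabPoint n R c) g *
      gridChar (parabPoint n R η) (g.1, fun i => g.2 i - 2 * g.1 * c i) := by
  simp only [gridChar, parabPoint]
  rw [← AddChar.map_add_eq_mul]
  congr 1
  simp only [Pi.add_apply, Int.cast_add, neg_mul, Finset.sum_mul, ← Finset.sum_neg_distrib]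
  simp only [← Finset.sum_add_distrib]
  refine Finset.sum_congr rfl fun i _ => ?_
  ring

theorem sum_norm_sum_gridChar_rpow {n R N : ℕ} [NeZero R] (p : ℝ) (c : Fin n → ℤ)
    (b : (Fin n → ℤ) → ℂ) :
    ∑ g, ‖∑ η ∈ latticeBox n N, b η * gridChar (parabPoint n R (c + η)) g‖ ^ p =
      ∑ g, ‖gridWave n R N b g‖ ^ p := by
  refine Fintype.sum_bijective
    (fun g : ZMod R × (Fin n → ZMod R) => (g.1, fun i => g.2 i - 2 * g.1 * c i)) ?_ _ _ fun g => ?_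
  · refine Function.bijective_iff_has_inverse.2 ⟨fun g => (g.1, fun i => g.2 i + 2 * g.1 * c i),
      fun g => ?_, fun g => ?_⟩ <;> simp
  · congr 1
    simp only [gridChar_parabPoint_add c, gridWave]
    simp only [mul_left_comm (b _)]
    rw [← Finset.mul_sum, norm_mul, norm_gridChar, one_mul]

theorem measurePreserving_stBox [Fact (0 < 2 * π)] (n : ℕ) :
    MeasurePreserving (fun q : ℝ × (Fin n → ℝ) =>
      (((q.1 : AddCircle (2 * π)), fun i => (q.2 i : AddCircle (2 * π))) : SpaceTimeTorus n))
      (volume.restrict (stBox n)) volume := by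
  have h1 : MeasurePreserving ((↑) : ℝ → AddCircle (2 * π))
      (volume.restrict (Set.Icc 0 (2 * π))) volume := by
    have := AddCircle.measurePreserving_mk (2 * π) 0
    rwa [zero_add, restrict_Ioc_eq_restrict_Icc] at this
  have h2 : volume.restrict (stBox n) = (volume.restrict (Set.Icc 0 (2 * π))).prod
      (Measure.pi fun _ : Fin n => (volume : Measure ℝ).restrict (Set.Icc 0 (2 * π))) := by
    rw [stBox, Measure.volume_eq_prod, ← Measure.prod_restrict, volume_pi, Measure.restrict_pi_pi]
  rw [h2]
  exact h1.prod (measurePreserving_pi _ _ fun _ => h1)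

theorem volume_univ_spaceTimeTorus [Fact (0 < 2 * π)] (n : ℕ) :
    (volume : Measure (SpaceTimeTorus n)).real Set.univ = (2 * π) ^ (n + 1) := by
  rw [Measure.real, Measure.volume_eq_prod, ← Set.univ_prod_univ, Measure.prod_prod, volume_pi,
    ← Set.pi_univ Set.univ, Measure.pi_pi]
  simp only [AddCircle.measure_univ, Finset.prod_const, Finset.card_univ, Fintype.card_fin]
  rw [← pow_succ', ENNReal.toReal_pow, ENNReal.toReal_ofReal (by positivity)]

/-- If the sums of a continuous function over translates of a finite family are at most `K`, then
its mean is at most `K` divided by the size of the family. -/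
theorem card_mul_integral_le {G α : Type*} [AddCommGroup G] [TopologicalSpace G]
    [IsTopologicalAddGroup G] [CompactSpace G] [MeasurableSpace G] [BorelSpace G]
    (μ : Measure G) [IsFiniteMeasure μ] [μ.IsAddLeftInvariant] [Fintype α] (s : α → G) {F : G → ℝ}
    (hF : Continuous F) {K : ℝ} (hK : ∀ y, ∑ g, F (y + s g) ≤ K) :
    (Fintype.card α : ℝ) * ∫ y, F y ∂μ ≤ μ.real Set.univ * K := by
  have hFint : ∀ z : G, Integrable (fun y => F (y + z)) μ := fun z =>
    (hF.comp (continuous_add_const z)).integrable_of_hasCompactSupport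
      (HasCompactSupport.of_compactSpace _)
  calc (Fintype.card α : ℝ) * ∫ y, F y ∂μ = ∑ g, ∫ y, F (y + s g) ∂μ := by
        simp only [integral_add_right_eq_self, Finset.sum_const, Finset.card_univ, nsmul_eq_mul]
    _ = ∫ y, ∑ g, F (y + s g) ∂μ := (integral_finsetSum _ fun g _ => hFint _).symm
    _ ≤ ∫ _, K ∂μ := integral_mono (integrable_finsetSum _ fun g _ => hFint _)
        (integrable_const _) hK
    _ = _ := by rw [integral_const, smul_eq_mul]

theorem abs_le_mul_of_orthonormal {n : ℕ} {v : Fin n → Fin n → ℝ}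
    (hv : ∀ i j, (∑ m, v i m * v j m) = if i = j then (1 : ℝ) else 0) {w : Fin n → ℝ} {N : ℝ}
    (hw : ∀ i, |∑ m, w m * v i m| ≤ N) (m : Fin n) : |w m| ≤ n * N := by
  have hV : Matrix.of v * (Matrix.of v).transpose = 1 := by
    ext i j
    simp [Matrix.mul_apply, hv, Matrix.one_apply]
  have hV' : ∀ k, ∑ i, v i k * v i m = if k = m then (1 : ℝ) else 0 := by
    intro k
    have hVt : (Matrix.of v).transpose * Matrix.of v = 1 := mul_eq_one_comm.1 hV
    have := congrFun (congrFun hVt k) m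
    simpa [Matrix.mul_apply, Matrix.one_apply] using this
  have hvm : ∀ i, |v i m| ≤ 1 := by
    intro i
    have h1 : v i m * v i m ≤ ∑ i, v i m * v i m :=
      Finset.single_le_sum (f := fun i => v i m * v i m) (fun j _ => mul_self_nonneg _)
        (Finset.mem_univ i)
    rw [hV', if_pos rfl] at h1
    exact abs_le_one_iff_mul_self_le_one.2 h1
  have hexp : w m = ∑ i, (∑ k, w k * v i k) * v i m := by
    simp only [Finset.sum_mul]
    rw [Finset.sum_comm]
    simp only [mul_assoc, ← Finset.mul_sum, hV']
    simp
  rw [hexp]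
  calc _ ≤ ∑ i, |(∑ k, w k * v i k) * v i m| := Finset.abs_sum_le_sum_abs _ _
    _ ≤ ∑ _i : Fin n, N * 1 := by
      refine Finset.sum_le_sum fun i _ => ?_
      rw [abs_mul]
      exact mul_le_mul (hw i) (hvm i) (abs_nonneg _) ((abs_nonneg _).trans (hw i))
    _ = _ := by simp

/-- The Strichartz estimate for frequencies in an axis-parallel cube centred at a lattice point. -/
theorem exists_setIntegral_norm_tWave_rpow_le {n : ℕ} {p : ℝ} (h : AdmissibleStrichartz n p) :
    ∃ C : ℝ, 0 < C ∧ ∀ N : ℕ, 1 ≤ N → ∀ (c : Fin n → ℤ) (a : (Fin n → ℤ) →₀ ℂ),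
      (∀ ξ ∈ a.support, ξ - c ∈ latticeBox n N) →
      ∫ q in stBox n, ‖tWave n a q.1 q.2‖ ^ p ≤
        C * (N : ℝ) ^ (n * p / 2 - (n + 2) : ℝ) * l2Norm n a ^ p := by
  obtain ⟨C, hC0, hC⟩ := exists_sum_norm_gridWave_rpow_le h
  have hp0 : 0 < p := lt_trans (by positivity) h.lt
  refine ⟨(2 * π) ^ (n + 1) * C, by positivity, fun N hN c a ha => ?_⟩
  have : Fact (0 < 2 * π) := ⟨Real.two_pi_pos⟩
  set R := Nat.factorial N * (6 * n * N ^ 2 + 1) with hRdef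
  have hR0 : 0 < R := by positivity
  have : NeZero R := ⟨hR0.ne'⟩
  have hR : 6 * n * N ^ 2 < R :=
    (Nat.lt_succ_self _).trans_le (Nat.le_mul_of_pos_left _ (Nat.factorial_pos _))
  have hdiv : ∀ q, 1 ≤ q → q ≤ N → q ∣ R := fun q h1 h2 =>
    (Nat.dvd_factorial h1 h2).trans (Nat.dvd_mul_right _ _)
  have hsum : ∀ {M : Type} [AddCommMonoid M] (f : (Fin n → ℤ) → M), (∀ ξ, a ξ = 0 → f ξ = 0) →
      ∑ ξ ∈ a.support, f ξ = ∑ η ∈ latticeBox n N, f (c + η) := by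
    intro M _ f hf
    rw [← Finset.sum_image (s := latticeBox n N) (g := fun η => c + η) (f := f)
      fun x _ y _ hxy => add_left_cancel hxy]
    refine Finset.sum_subset (fun ξ hξ => Finset.mem_image.2 ⟨ξ - c, ha ξ hξ, by abel⟩) ?_
    intro ξ _ hξ
    exact hf ξ (Finsupp.notMem_support_iff.1 hξ)
  set F : SpaceTimeTorus n → ℝ := fun y => ‖∑ ξ ∈ a.support, a ξ * torusChar ξ y‖ ^ p with hF
  have hFc : Continuous F := by
    refine Continuous.rpow_const (Continuous.norm ?_) fun _ => Or.inr hp0.le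
    exact continuous_finsetSum _ fun ξ _ => continuous_const.mul (continuous_torusChar ξ)
  have hK : ∀ y, ∑ g : ZMod R × (Fin n → ZMod R), F (y + gridPoint g) ≤
      C * (R : ℝ) ^ (n + 1) * (N : ℝ) ^ (n * p / 2 - (n + 2) : ℝ) * l2Norm n a ^ p := by
    intro y
    have h1 : l2Norm n a = √(∑ η ∈ latticeBox n N, ‖a (c + η) * torusChar (c + η) y‖ ^ 2) := by
      rw [l2Norm, hsum (fun ξ => ‖a ξ‖ ^ 2) fun ξ hξ => by simp [hξ]]
      simp only [norm_mul, norm_torusChar, mul_one]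
    rw [h1]
    refine le_trans (le_of_eq ?_) (hC N R hN hR hdiv _)
    rw [← sum_norm_sum_gridChar_rpow p c]
    refine Finset.sum_congr rfl fun g _ => ?_
    simp only [hF, torusChar_add, torusChar_gridPoint]
    rw [hsum (fun ξ => a ξ * (torusChar ξ y * gridChar (parabPoint n R ξ) g))
      fun ξ hξ => by simp [hξ]]
    simp only [mul_assoc]
  have hpi : (volume : Measure (Fin n → AddCircle (2 * π))).IsAddLeftInvariant := by
    rw [volume_pi]
    infer_instance
  have hvol : (volume : Measure (SpaceTimeTorus n)).IsAddLeftInvariant := by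
    rw [Measure.volume_eq_prod]
    infer_instance
  have hmean := card_mul_integral_le (volume : Measure (SpaceTimeTorus n)) gridPoint hFc hK
  have hbox : ∫ q in stBox n, ‖tWave n a q.1 q.2‖ ^ p = ∫ y, F y := by
    rw [← (measurePreserving_stBox n).map_eq,
      integral_map (measurePreserving_stBox n).measurable.aemeasurable hFc.aestronglyMeasurable]
    simp only [hF, torusChar_coe, tWave]
  have hcard : (Fintype.card (ZMod R × (Fin n → ZMod R)) : ℝ) = (R : ℝ) ^ (n + 1) := by
    simp [ZMod.card, pow_succ']
  rw [hcard, volume_univ_spaceTimeTorus] at hmean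
  rw [hbox]
  have hRpos : (0 : ℝ) < (R : ℝ) ^ (n + 1) := by positivity
  refine le_of_mul_le_mul_left (hmean.trans_eq ?_) hRpos
  ring

/-- the Strichartz estimate for frequencies in an arbitrarily centered and
oriented cube of side length `2N`, with a constant independent of center and orientation. -/
theorem strichartz_cubes (n : ℕ) (p : ℝ) (h : AdmissibleStrichartz n p) :
    ∃ C > 0, ∀ N : ℝ, 1 ≤ N → ∀ ξ₀ : Fin n → ℝ, ∀ v : Fin n → (Fin n → ℝ),
      (∀ i j, (∑ m, v i m * v j m) = if i = j then (1 : ℝ) else 0) →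
      ∀ a : (Fin n → ℤ) →₀ ℂ,
      (∀ ξ ∈ a.support, ∀ i, |∑ m, ((ξ m : ℝ) - ξ₀ m) * v i m| ≤ N) →
      boxLpNorm n p (tWave n a) ≤ C * N ^ ((n : ℝ) / 2 - ((n : ℝ) + 2) / p) * l2Norm n a := by
  obtain ⟨C, hC0, hC⟩ := exists_setIntegral_norm_tWave_rpow_le h
  have hn0 : (0 : ℝ) < n := by exact_mod_cast h.one_le
  have hlt := h.lt
  have hp0 : 0 < p := lt_trans (by positivity) hlt
  have he : 0 ≤ (n : ℝ) / 2 - (n + 2) / p := by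
    rw [sub_nonneg, div_le_iff₀ hp0]
    have : (n : ℝ) / 2 * (2 + 4 / n) = n + 2 := by field_simp; ring
    have := mul_lt_mul_of_pos_left hlt (half_pos hn0)
    linarith
  refine ⟨C ^ (1 / p) * (n + 2 : ℝ) ^ ((n : ℝ) / 2 - (n + 2) / p), by positivity, ?_⟩
  intro N hN ξ₀ v hv a ha
  set c : Fin n → ℤ := fun i => ⌊ξ₀ i⌋ with hc
  set M : ℕ := ⌈n * N + 1⌉₊ with hM
  have hM1 : 1 ≤ M := Nat.one_le_ceil_iff.2 (by positivity)
  have hMN : (M : ℝ) ≤ (n + 2) * N := by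
    have := Nat.ceil_lt_add_one (show 0 ≤ n * N + 1 by positivity)
    linarith
  have hbox : ∀ ξ ∈ a.support, ξ - c ∈ latticeBox n M := by
    intro ξ hξ
    refine mem_latticeBox.2 fun i => abs_le.1 ?_
    have h1 := abs_le.1 (abs_le_mul_of_orthonormal hv (ha ξ hξ) i)
    have h2 := Int.floor_le (ξ₀ i)
    have h3 := Int.lt_floor_add_one (ξ₀ i)
    have h4 := Nat.le_ceil (n * N + 1)
    have h5 : |((ξ i : ℝ) - (⌊ξ₀ i⌋ : ℝ))| ≤ M := by
      rw [abs_le]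
      constructor <;> linarith [h1.1, h1.2]
    exact_mod_cast h5
  have hl0 : 0 ≤ l2Norm n a := Real.sqrt_nonneg _
  have hint0 : 0 ≤ ∫ q in stBox n, ‖tWave n a q.1 q.2‖ ^ p :=
    integral_nonneg fun q => by positivity
  have hexp : ((n : ℝ) * p / 2 - (n + 2)) * (1 / p) = n / 2 - (n + 2) / p := by
    field_simp
  calc boxLpNorm n p (tWave n a)
      ≤ (C * (M : ℝ) ^ (n * p / 2 - (n + 2) : ℝ) * l2Norm n a ^ p) ^ (1 / p) :=
        Real.rpow_le_rpow hint0 (hC M hM1 c a hbox) (by positivity)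
    _ = C ^ (1 / p) * (M : ℝ) ^ ((n : ℝ) / 2 - (n + 2) / p) * l2Norm n a := by
        rw [Real.mul_rpow (by positivity) (by positivity),
          Real.mul_rpow hC0.le (by positivity), ← Real.rpow_mul (by positivity),
          ← Real.rpow_mul hl0, hexp, mul_one_div_cancel hp0.ne', Real.rpow_one]
    _ ≤ C ^ (1 / p) * ((n + 2) * N) ^ ((n : ℝ) / 2 - (n + 2) / p) * l2Norm n a := by
        gcongr
    _ = _ := by
        rw [Real.mul_rpow (by positivity) (by positivity)]
        ring
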